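/- (Direct-sum form of the main theorem.) Let F ∈ ℂ[X,Y,Z] be an irreducible homogeneous polynomial of degree d ≥ 4 whose curve F = 0 has only nodes as singularities, let Δ be the set of nodes, n = |Δ| ≤ binom(d−1,2) − 1. Then there exists a homogeneous polynomial σ̃ of degree d vanishing at every point of Δ such that the space V_{2d−3}(Δ) of homogeneous forms of degree 2d − 3 vanishing at every point of Δ decomposes as the direct sum V_{2d−3}(Δ) = {a·F_X + b·F_Y + c·F_Z : a, b, c homogeneous of degree d−2} ⊕ σ̃·V_{d−3}(Δ); in particular dim V_{2d−3}(Δ) = 3·binom(d,2) + binom(d−1,2) − n = binom(2d−1,2) − n. -/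

import Mathlib

open MvPolynomial

noncomputable section

/-- The complex projective plane. -/
abbrev P2 : Type := Projectivization ℂ (Fin 3 → ℂ)

/-- A (homogeneous) polynomial `G` vanishes at a point `p ∈ ℙ²`. -/
def VanAt (G : MvPolynomial (Fin 3) ℂ) (p : P2) : Prop :=
  eval p.rep G = 0

/-- The submodule of polynomials vanishing at every point of `S`. -/
def vanishing (S : Set P2) : Submodule ℂ (MvPolynomial (Fin 3) ℂ) where
  carrier := {G | ∀ p ∈ S, VanAt G p}
  add_mem' := by
    intro a b ha hb p hp
    have h1 := ha p hp
    have h2 := hb p hp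
    simp only [VanAt] at h1 h2 ⊢
    simp [h1, h2]
  zero_mem' := by
    intro p hp
    simp [VanAt]
  smul_mem' := by
    intro c G hG p hp
    have h1 := hG p hp
    simp only [VanAt] at h1 ⊢
    simp [h1]

/-- `V_k(S)`: homogeneous polynomials of degree `k` (together with `0`)
vanishing at every point of `S`. -/
def Vsp (k : ℕ) (S : Set P2) : Submodule ℂ (MvPolynomial (Fin 3) ℂ) :=
  homogeneousSubmodule (Fin 3) ℂ k ⊓ vanishing S

/-- `p` is a singular point of the curve `F = 0`. -/
def SingPt (F : MvPolynomial (Fin 3) ℂ) (p : P2) : Prop :=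
  ∀ i : Fin 3, eval p.rep (pderiv i F) = 0

/-- `p` is a node of the curve `F = 0`. -/
def IsNode (F : MvPolynomial (Fin 3) ℂ) (p : P2) : Prop :=
  SingPt F p ∧
    (Matrix.of fun i j : Fin 3 => eval p.rep (pderiv i (pderiv j F))).rank = 2

/-- The curve `F = 0` is nodal: every singular point is a node. -/
def Nodal (F : MvPolynomial (Fin 3) ℂ) : Prop :=
  ∀ p : P2, SingPt F p → IsNode F p

/-- The set of nodes of the curve `F = 0`. -/
def nodes (F : MvPolynomial (Fin 3) ℂ) : Set P2 :=
  {p | IsNode F p}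

/-- The common zero set in `ℙ²` of two polynomials. -/
def zeroSet (F₁ F₂ : MvPolynomial (Fin 3) ℂ) : Set P2 :=
  {p | VanAt F₁ p ∧ VanAt F₂ p}


/-- The subspace `{a·F_X + b·F_Y + c·F_Z : a, b, c homogeneous of degree m}`. -/
def jacSub (F : MvPolynomial (Fin 3) ℂ) (m : ℕ) :
    Submodule ℂ (MvPolynomial (Fin 3) ℂ) where
  carrier := {G | ∃ a b c : MvPolynomial (Fin 3) ℂ,
    a.IsHomogeneous m ∧ b.IsHomogeneous m ∧ c.IsHomogeneous m ∧
    G = a * pderiv 0 F + b * pderiv 1 F + c * pderiv 2 F}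
  add_mem' := by
    rintro x y ⟨a, b, c, ha, hb, hc, rfl⟩ ⟨a', b', c', ha', hb', hc', rfl⟩
    exact ⟨a + a', b + b', c + c', ha.add ha', hb.add hb', hc.add hc', by ring⟩
  zero_mem' :=
    ⟨0, 0, 0, isHomogeneous_zero _ _ _, isHomogeneous_zero _ _ _,
      isHomogeneous_zero _ _ _, by ring⟩
  smul_mem' := by
    rintro r x ⟨a, b, c, ha, hb, hc, rfl⟩
    refine ⟨r • a, r • b, r • c, ?_, ?_, ?_, by
      simp [smul_add, smul_mul_assoc]⟩
    · exact (mem_homogeneousSubmodule _ _).1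
        ((homogeneousSubmodule (Fin 3) ℂ m).smul_mem r
          ((mem_homogeneousSubmodule _ _).2 ha))
    · exact (mem_homogeneousSubmodule _ _).1
        ((homogeneousSubmodule (Fin 3) ℂ m).smul_mem r
          ((mem_homogeneousSubmodule _ _).2 hb))
    · exact (mem_homogeneousSubmodule _ _).1
        ((homogeneousSubmodule (Fin 3) ℂ m).smul_mem r
          ((mem_homogeneousSubmodule _ _).2 hc))


/-! ### General lemmas on homogeneous polynomials -/

section basics

variable {τ : Type*}

/-- The coefficient of degree `m - a` used to extract homogeneous coefficients. -/
def hq (m a : ℕ) (p : MvPolynomial τ ℂ) : MvPolynomial τ ℂ :=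
  if m < a then 0 else homogeneousComponent (m - a) p

lemma hq_homog (m a : ℕ) (p : MvPolynomial τ ℂ) : (hq m a p).IsHomogeneous (m - a) := by
  unfold hq
  split_ifs
  · exact isHomogeneous_zero _ _ _
  · exact homogeneousComponent_isHomogeneous _ _

lemma hq_zero {m a : ℕ} (h : m < a) (p : MvPolynomial τ ℂ) : hq m a p = 0 := by
  simp [hq, h]

lemma hc_mul {m a : ℕ} (p f : MvPolynomial τ ℂ) (hf : f.IsHomogeneous a) :
    homogeneousComponent m (p * f) = hq m a p * f := by
  have h1 : p * f = ∑ i ∈ Finset.range (p.totalDegree + 1), homogeneousComponent i p * f := by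
    rw [← Finset.sum_mul, sum_homogeneousComponent]
  rw [h1, map_sum]
  have h2 : ∀ i, homogeneousComponent m (homogeneousComponent i p * f) =
      if i + a = m then homogeneousComponent i p * f else 0 := by
    intro i
    have := homogeneousComponent_of_mem (m := m)
      (((homogeneousComponent_isHomogeneous i p).mul hf) :
        homogeneousComponent i p * f ∈ homogeneousSubmodule τ ℂ (i + a))
    rw [this]
    simp [eq_comm]
  simp_rw [h2]
  unfold hq
  split_ifs with h
  · rw [zero_mul]
    apply Finset.sum_eq_zero
    intro i _
    rw [if_neg (by omega)]
  · have h3 : ∀ i, (i + a = m) ↔ (i = m - a) := by intro i; omega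
    simp_rw [h3]
    rw [Finset.sum_ite_eq']
    split_ifs with h4
    · rfl
    · rw [homogeneousComponent_eq_zero _ _ (by
        simp only [Finset.mem_range, not_lt] at h4; omega), zero_mul]

lemma hc_self {m : ℕ} {x : MvPolynomial τ ℂ} (hx : x.IsHomogeneous m) :
    homogeneousComponent m x = x := homogeneousComponent_eq_self hx

lemma homog_of_mul {m a : ℕ} {p f : MvPolynomial τ ℂ} (hf : f.IsHomogeneous a) (hf0 : f ≠ 0)
    (h : (p * f).IsHomogeneous m) : p = hq m a p := by
  have h1 := hc_self h
  rw [hc_mul p f hf] at h1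
  exact (mul_right_cancel₀ hf0 h1).symm

lemma eq_zero_of_dvd_of_lt {m a : ℕ} {x f : MvPolynomial τ ℂ} (hf : f.IsHomogeneous a)
    (hx : x.IsHomogeneous m) (hlt : m < a) (h : f ∣ x) : x = 0 := by
  obtain ⟨p, rfl⟩ := h
  rw [← hc_self hx, mul_comm, hc_mul p f hf, hq_zero hlt, zero_mul]

lemma homog_pd {m : ℕ} {F : MvPolynomial τ ℂ} (hF : F.IsHomogeneous m) (i : τ) :
    (pderiv i F).IsHomogeneous (m - 1) := hF.pderiv

lemma eval_smul_homog {m : ℕ} {F : MvPolynomial τ ℂ} (hF : F.IsHomogeneous m) (c : ℂ)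
    (x : τ → ℂ) : eval (c • x) F = c ^ m * eval x F := by
  rw [eval_eq, eval_eq, Finset.mul_sum]
  apply Finset.sum_congr rfl
  intro s hs
  have h1 : s.degree = m := (hF.degree_eq_sum_deg_support hs).symm
  simp only [Pi.smul_apply, smul_eq_mul, mul_pow, Finset.prod_mul_distrib]
  rw [Finset.prod_pow_eq_pow_sum]
  have : ∑ i ∈ s.support, s i = m := h1
  rw [this]; ring

lemma finrank_homog (n k : ℕ) :
    Module.finrank ℂ (homogeneousSubmodule (Fin n) ℂ k) = (n + k - 1).choose k := by
  have h3 : {d : Fin n →₀ ℕ | d.degree = k} =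
      ((Finset.univ : Finset (Fin n)).finsuppAntidiag k : Set (Fin n →₀ ℕ)) := by
    ext d
    simp [Finset.mem_finsuppAntidiag, Finsupp.degree_eq_sum]
  have e1 : homogeneousSubmodule (Fin n) ℂ k =
      AddMonoidAlgebra.supported ℂ ℂ
        ((Finset.univ : Finset (Fin n)).finsuppAntidiag k : Set (Fin n →₀ ℕ)) := by
    rw [← h3]
    exact homogeneousSubmodule_eq_finsupp_supported _ _ _
  rw [e1, (AddMonoidAlgebra.supportedEquivFinsupp (R := ℂ) (S := ℂ) _).finrank_eq,
    Module.finrank_finsupp_self]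
  have := Finset.card_finsuppAntidiag_nat_eq_choose (s := (Finset.univ : Finset (Fin n))) k
  simp only [Finset.card_univ, Fintype.card_fin] at this
  rw [← this]
  simp

instance finite_homog (n k : ℕ) : Module.Finite ℂ (homogeneousSubmodule (Fin n) ℂ k) :=
  Module.Finite.iff_fg.2 (homogeneousSubmodule_fg _ _ _)

lemma local_global {n : ℕ} (K : Ideal (MvPolynomial (Fin n) ℂ)) (x : MvPolynomial (Fin n) ℂ)
    (h : ∀ q : Fin n → ℂ, ∃ g, eval q g ≠ 0 ∧ g * x ∈ K) : x ∈ K := by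
  by_contra hx
  let L : Ideal (MvPolynomial (Fin n) ℂ) := K.colon {x}
  have hL : L ≠ ⊤ := by
    intro h1
    have : (1 : MvPolynomial (Fin n) ℂ) ∈ L := h1 ▸ Submodule.mem_top
    rw [Submodule.mem_colon_singleton] at this
    exact hx (by simpa using this)
  obtain ⟨M, hM, hLM⟩ := Ideal.exists_le_maximal L hL
  obtain ⟨q, hq⟩ := eq_vanishingIdeal_singleton_of_isMaximal ℂ hM
  obtain ⟨g, hg, hgx⟩ := h q
  have : g ∈ M := hLM (by rw [Submodule.mem_colon_singleton]; simpa using hgx)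
  rw [hq, mem_vanishingIdeal_singleton_iff] at this
  exact hg (by simpa [aeval_eq_eval] using this)

end basics

/-! ### Binary forms -/

section binary

lemma relPrime_of_no_common_zero (f g : MvPolynomial (Fin 2) ℂ)
    (h : ∀ x : Fin 2 → ℂ, x ≠ 0 → ¬ (eval x f = 0 ∧ eval x g = 0)) : IsRelPrime f g := by
  have hrad : ∀ i : Fin 2, ∃ n, (X i : MvPolynomial (Fin 2) ℂ) ^ n ∈ Ideal.span {f, g} := by
    intro i
    have : (X i : MvPolynomial (Fin 2) ℂ) ∈ (Ideal.span {f, g}).radical := by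
      rw [← vanishingIdeal_zeroLocus_eq_radical (K := ℂ), mem_vanishingIdeal_iff]
      intro x hx
      rw [mem_zeroLocus_iff] at hx
      have h1 := hx f (Ideal.subset_span (by simp))
      have h2 := hx g (Ideal.subset_span (by simp))
      simp only [aeval_eq_eval, coe_eval₂Hom] at h1 h2
      by_contra h3
      refine h x ?_ ⟨by simpa using h1, by simpa using h2⟩
      rintro rfl
      simp at h3
    exact this
  obtain ⟨n, hn⟩ := hrad 0
  obtain ⟨m, hm⟩ := hrad 1
  have h01 : IsRelPrime (X 0 : MvPolynomial (Fin 2) ℂ) (X 1) := by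
    rw [(X_prime (R := ℂ) (i := (0 : Fin 2))).irreducible.isRelPrime_iff_not_dvd]
    rw [X_dvd_X]
    simp
  have hp : IsRelPrime ((X 0 : MvPolynomial (Fin 2) ℂ) ^ n) (X 1 ^ m) := IsRelPrime.pow h01
  intro c hcf hcg
  apply hp
  · obtain ⟨a, b, hab⟩ := Ideal.mem_span_pair.1 hn
    rw [← hab]
    exact dvd_add (hcf.mul_left _) (hcg.mul_left _)
  · obtain ⟨a, b, hab⟩ := Ideal.mem_span_pair.1 hm
    rw [← hab]
    exact dvd_add (hcf.mul_left _) (hcg.mul_left _)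

lemma syz_of_relPrime {f g p q : MvPolynomial (Fin 2) ℂ} (hrel : IsRelPrime f g) (hg : g ≠ 0)
    (h : p * f + q * g = 0) : ∃ c, p = c * g ∧ q = - (c * f) := by
  have h1 : g ∣ p * f := ⟨-q, by linear_combination h⟩
  obtain ⟨c, hc⟩ := hrel.symm.dvd_of_dvd_mul_right h1
  refine ⟨c, by rw [hc, mul_comm], ?_⟩
  apply mul_right_cancel₀ hg
  rw [hc] at h
  linear_combination h

/-- If `x` is homogeneous and in `(f,g)`, the coefficients can be chosen homogeneous. -/
lemma homog_coeffs {τ : Type*} {f g x : MvPolynomial τ ℂ} {a b m : ℕ} (hf : f.IsHomogeneous a)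
    (hg : g.IsHomogeneous b) (hx : x.IsHomogeneous m) (h : x ∈ Ideal.span {f, g}) :
    ∃ p q, x = p * f + q * g ∧ p.IsHomogeneous (m - a) ∧ q.IsHomogeneous (m - b) ∧
      (m < a → p = 0) ∧ (m < b → q = 0) := by
  obtain ⟨p, q, hpq⟩ := Ideal.mem_span_pair.1 h
  refine ⟨hq m a p, hq m b q, ?_, hq_homog _ _ _, hq_homog _ _ _, fun h => hq_zero h _,
    fun h => hq_zero h _⟩
  rw [← hc_mul p f hf, ← hc_mul q g hg, ← map_add, hpq, hc_self hx]

/-- The map `(p,q) ↦ p f + q g` on forms of given degrees. -/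
def pairMap (f g : MvPolynomial (Fin 2) ℂ) (i j : ℕ) :
    (homogeneousSubmodule (Fin 2) ℂ i × homogeneousSubmodule (Fin 2) ℂ j) →ₗ[ℂ]
      MvPolynomial (Fin 2) ℂ :=
  ((LinearMap.mulRight ℂ f).comp (Submodule.subtype _)).coprod
    ((LinearMap.mulRight ℂ g).comp (Submodule.subtype _))

lemma pairMap_apply (f g : MvPolynomial (Fin 2) ℂ) (i j : ℕ) (p) :
    pairMap f g i j p = p.1 * f + p.2 * g := by
  simp [pairMap]

variable {f g : MvPolynomial (Fin 2) ℂ} {a b : ℕ}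

lemma pairMap_finrank (hf : f.IsHomogeneous a)
    (hg : g.IsHomogeneous b) (hf0 : f ≠ 0) (hg0 : g ≠ 0) (hrel : IsRelPrime f g)
    {i j : ℕ} (hi : i < b) (hij : i + a = j + b) :
    Module.finrank ℂ (LinearMap.range (pairMap f g i j)) = (i + 1) + (j + 1) := by
  have hinj : Function.Injective (pairMap f g i j) := by
    rw [← LinearMap.ker_eq_bot, LinearMap.ker_eq_bot']
    rintro ⟨⟨p, hp⟩, ⟨q, hq'⟩⟩ h
    rw [pairMap_apply] at h
    simp only at h
    obtain ⟨c, hc1, hc2⟩ := syz_of_relPrime hrel hg0 h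
    have hp0 : p = 0 := eq_zero_of_dvd_of_lt hg hp hi ⟨c, by rw [hc1, mul_comm]⟩
    subst hp0
    have hq0 : q = 0 := by
      rw [zero_mul, zero_add] at h
      exact (mul_eq_zero.1 h).resolve_right hg0
    subst hq0
    rfl
  rw [LinearMap.finrank_range_of_inj hinj, Module.finrank_prod, finrank_homog, finrank_homog]
  have e1 : 2 + i - 1 = i + 1 := by omega
  have e2 : 2 + j - 1 = j + 1 := by omega
  rw [e1, e2]
  simp

lemma pairMap_range_le (hf : f.IsHomogeneous a)
    (hg : g.IsHomogeneous b) (hf0 : f ≠ 0) (hg0 : g ≠ 0) (hrel : IsRelPrime f g)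
    {i j m : ℕ} (h1 : i + a = m) (h2 : j + b = m) :
    LinearMap.range (pairMap f g i j) ≤ homogeneousSubmodule (Fin 2) ℂ m := by
  rintro _ ⟨⟨⟨p, hp⟩, ⟨q, hq'⟩⟩, rfl⟩
  rw [pairMap_apply]
  refine Submodule.add_mem _ ?_ ?_
  · rw [← h1]; exact IsHomogeneous.mul hp hf
  · rw [← h2]; exact IsHomogeneous.mul hq' hg

lemma binary_top (hf : f.IsHomogeneous a)
    (hg : g.IsHomogeneous b) (hf0 : f ≠ 0) (hg0 : g ≠ 0) (hrel : IsRelPrime f g)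
    (ha : 1 ≤ a) (hb : 1 ≤ b) {x : MvPolynomial (Fin 2) ℂ}
    (hx : x.IsHomogeneous (a + b - 1)) : x ∈ Ideal.span {f, g} := by
  have h1 := pairMap_finrank hf hg hf0 hg0 hrel (i := b - 1) (j := a - 1) (by omega) (by omega)
  have h2 := pairMap_range_le hf hg hf0 hg0 hrel (i := b - 1) (j := a - 1) (m := a + b - 1)
    (by omega) (by omega)
  have h3 : LinearMap.range (pairMap f g (b - 1) (a - 1)) =
      homogeneousSubmodule (Fin 2) ℂ (a + b - 1) := by
    apply Submodule.eq_of_le_of_finrank_eq h2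
    rw [h1, finrank_homog]
    have e1 : 2 + (a + b - 1) - 1 = (a + b - 1) + 1 := by omega
    rw [e1]
    simp
    omega
  have h4 : x ∈ LinearMap.range (pairMap f g (b - 1) (a - 1)) := by rw [h3]; exact hx
  obtain ⟨p, rfl⟩ := h4
  rw [pairMap_apply, Ideal.mem_span_pair]
  exact ⟨_, _, rfl⟩

lemma binary_top' (hf : f.IsHomogeneous a)
    (hg : g.IsHomogeneous b) (hf0 : f ≠ 0) (hg0 : g ≠ 0) (hrel : IsRelPrime f g)
    (ha : 1 ≤ a) (hb : 1 ≤ b) (k : ℕ) : ∀ {x : MvPolynomial (Fin 2) ℂ}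
    (_ : x.IsHomogeneous (a + b - 1 + k)), x ∈ Ideal.span {f, g} := by
  induction k with
  | zero => intro x hx; exact binary_top hf hg hf0 hg0 hrel ha hb hx
  | succ k ih =>
    intro x hx
    have h1 := hx.sum_X_mul_pderiv
    have h2 : ∀ i, pderiv i x ∈ Ideal.span {f, g} := by
      intro i
      apply ih
      have := homog_pd hx i
      simpa [← add_assoc] using this
    have h3 : (a + b - 1 + (k + 1)) • x ∈ Ideal.span {f, g} := by
      rw [← h1]
      exact Ideal.sum_mem _ fun i _ => Ideal.mul_mem_left _ _ (h2 i)
    have h4 : x = C ((a + b - 1 + (k + 1) : ℕ) : ℂ)⁻¹ * ((a + b - 1 + (k + 1)) • x) := by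
      rw [nsmul_eq_mul, ← mul_assoc, ← map_natCast (C : ℂ →+* MvPolynomial (Fin 2) ℂ), ← C_mul,
        inv_mul_cancel₀ (by norm_cast), C_1, one_mul]
    rw [h4]
    exact Ideal.mul_mem_left _ _ h3

lemma binary_codim (hf : f.IsHomogeneous a)
    (hg : g.IsHomogeneous b) (hf0 : f ≠ 0) (hg0 : g ≠ 0) (hrel : IsRelPrime f g)
    (ha : 2 ≤ a) (hb : 2 ≤ b) :
    ∃ m₀ : MvPolynomial (Fin 2) ℂ, m₀.IsHomogeneous (a + b - 2) ∧
      ∀ x : MvPolynomial (Fin 2) ℂ, x.IsHomogeneous (a + b - 2) →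
        ∃ c : ℂ, x - C c * m₀ ∈ Ideal.span {f, g} := by
  have h1 := pairMap_finrank hf hg hf0 hg0 hrel (i := b - 2) (j := a - 2) (by omega) (by omega)
  have h2 := pairMap_range_le hf hg hf0 hg0 hrel (i := b - 2) (j := a - 2) (m := a + b - 2)
    (by omega) (by omega)
  set R := LinearMap.range (pairMap f g (b - 2) (a - 2)) with hR
  have hH : Module.finrank ℂ (homogeneousSubmodule (Fin 2) ℂ (a + b - 2)) =
      Module.finrank ℂ R + 1 := by
    rw [h1, finrank_homog]
    have e1 : 2 + (a + b - 2) - 1 = (a + b - 2) + 1 := by omega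
    rw [e1]
    simp
    omega
  have h5 : ∃ m₀ ∈ homogeneousSubmodule (Fin 2) ℂ (a + b - 2), m₀ ∉ R := by
    by_contra! hcon
    have : R = homogeneousSubmodule (Fin 2) ℂ (a + b - 2) := le_antisymm h2 hcon
    rw [← this] at hH
    omega
  obtain ⟨m₀, hm₀, hm₀R⟩ := h5
  refine ⟨m₀, hm₀, fun x hx => ?_⟩
  have h6 : R ⊔ Submodule.span ℂ {m₀} = homogeneousSubmodule (Fin 2) ℂ (a + b - 2) := by
    have hle : R ⊔ Submodule.span ℂ {m₀} ≤ homogeneousSubmodule (Fin 2) ℂ (a + b - 2) :=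
      sup_le h2 (by rw [Submodule.span_singleton_le_iff_mem]; exact hm₀)
    have : FiniteDimensional ℂ ↥(R ⊔ Submodule.span ℂ {m₀}) :=
      Submodule.finiteDimensional_of_le hle
    apply Submodule.eq_of_le_of_finrank_le hle
    rw [hH]
    apply Nat.succ_le_of_lt
    apply Submodule.finrank_lt_finrank_of_lt
    refine lt_of_le_of_ne le_sup_left ?_
    intro heq
    apply hm₀R
    rw [heq]
    exact Submodule.mem_sup_right (Submodule.mem_span_singleton_self _)
  have h7 : x ∈ R ⊔ Submodule.span ℂ {m₀} := by rw [h6]; exact hx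
  obtain ⟨y, ⟨p, rfl⟩, z, hz, hyz⟩ := Submodule.mem_sup.1 h7
  obtain ⟨c, rfl⟩ := Submodule.mem_span_singleton.1 hz
  refine ⟨c, ?_⟩
  rw [← hyz, smul_eq_C_mul, add_sub_cancel_right, pairMap_apply, Ideal.mem_span_pair]
  exact ⟨_, _, rfl⟩

lemma binary_socle (hf : f.IsHomogeneous a)
    (hg : g.IsHomogeneous b) (hf0 : f ≠ 0) (hg0 : g ≠ 0) (hrel : IsRelPrime f g)
    {i : ℕ} (hi : i + 2 < a + b) {P : MvPolynomial (Fin 2) ℂ}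
    (hP : P.IsHomogeneous i) (h0 : X 0 * P ∈ Ideal.span {f, g})
    (h1 : X 1 * P ∈ Ideal.span {f, g}) : P ∈ Ideal.span {f, g} := by
  have hX0 : (X 0 * P).IsHomogeneous (1 + i) := (isHomogeneous_X _ _).mul hP
  have hX1 : (X 1 * P).IsHomogeneous (1 + i) := (isHomogeneous_X _ _).mul hP
  obtain ⟨u, v, huv, hu, hv, hu0, hv0⟩ := homog_coeffs hf hg hX0 h0
  obtain ⟨u', v', huv', hu', hv', hu0', hv0'⟩ := homog_coeffs hf hg hX1 h1
  have hs : (X 1 * u - X 0 * u') * f + (X 1 * v - X 0 * v') * g = 0 := by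
    linear_combination (- X 1) * huv + X 0 * huv'
  obtain ⟨c, hc1, hc2⟩ := syz_of_relPrime hrel hg0 hs
  have hz : X 1 * u - X 0 * u' = 0 := by
    by_cases hia : 1 + i < a
    · rw [hu0 hia, hu0' hia]; simp
    · refine eq_zero_of_dvd_of_lt hg (m := 1 + (1 + i - a)) ?_ (by omega)
        ⟨c, by rw [hc1, mul_comm]⟩
      exact ((isHomogeneous_X _ _).mul hu).sub ((isHomogeneous_X _ _).mul hu')
  have hz' : X 1 * v - X 0 * v' = 0 := by
    rw [hz, zero_mul, zero_add] at hs
    exact (mul_eq_zero.1 hs).resolve_right hg0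
  have key : ∀ w w' : MvPolynomial (Fin 2) ℂ, X 1 * w - X 0 * w' = 0 → X 0 ∣ w := by
    intro w w' h
    have : (X 0 : MvPolynomial (Fin 2) ℂ) ∣ X 1 * w := ⟨w', by linear_combination h⟩
    refine ((X_prime (R := ℂ) (i := (0 : Fin 2))).dvd_or_dvd this).resolve_left ?_
    rw [X_dvd_X]
    simp
  obtain ⟨s, rfl⟩ := key _ _ hz
  obtain ⟨t, rfl⟩ := key _ _ hz'
  rw [Ideal.mem_span_pair]
  refine ⟨s, t, ?_⟩
  apply mul_left_cancel₀ (X_ne_zero (R := ℂ) (0 : Fin 2))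
  linear_combination - huv

lemma binary_dual (hf : f.IsHomogeneous a)
    (hg : g.IsHomogeneous b) (hf0 : f ≠ 0) (hg0 : g ≠ 0) (hrel : IsRelPrime f g)
    (j : ℕ) : ∀ {i : ℕ} (_ : i + j + 2 = a + b) {P : MvPolynomial (Fin 2) ℂ}
    (_ : P.IsHomogeneous i)
    (_ : ∀ Q : MvPolynomial (Fin 2) ℂ, Q.IsHomogeneous j → Q * P ∈ Ideal.span {f, g}),
    P ∈ Ideal.span {f, g} := by
  induction j with
  | zero =>
    intro i _ P _ h
    simpa using h 1 (isHomogeneous_one _ _)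
  | succ j ih =>
    intro i hi P hP h
    have key : ∀ k : Fin 2, X k * P ∈ Ideal.span {f, g} := by
      intro k
      apply ih (i := 1 + i) (by omega) ((isHomogeneous_X _ _).mul hP)
      intro Q hQ
      have := h (Q * X k) (hQ.mul (isHomogeneous_X _ _))
      rwa [mul_assoc] at this
    exact binary_socle hf hg hf0 hg0 hrel (by omega) hP (key 0) (key 1)

end binary

/-! ### Finiteness of intersections and generic choices -/

abbrev S3 : Type := MvPolynomial (Fin 3) ℂ

/-- The ideal of the line spanned by `p`. -/
def lineHom (p : Fin 3 → ℂ) : S3 →ₐ[ℂ] Polynomial ℂ :=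
  aeval (fun i => Polynomial.C (p i) * Polynomial.X)

lemma lineHom_eval (p : Fin 3 → ℂ) (G : S3) (c : ℂ) :
    (lineHom p G).eval c = eval (c • p) G := by
  have : ((Polynomial.aeval c).comp (lineHom p) : S3 →ₐ[ℂ] ℂ) = aeval (c • p) := by
    ext i
    simp only [lineHom, AlgHom.comp_apply, aeval_X, map_mul, Polynomial.aeval_C, Polynomial.aeval_X,
      Pi.smul_apply, smul_eq_mul, Algebra.algebraMap_self, RingHom.id_apply]
    ring
  have h2 := DFunLike.congr_fun this G
  simp only [AlgHom.comp_apply, Polynomial.coe_aeval_eq_eval] at h2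
  rw [h2, aeval_eq_eval]

lemma mem_line_iff (p : Fin 3 → ℂ) (G : S3) :
    G ∈ RingHom.ker (lineHom p) ↔ ∀ c : ℂ, eval (c • p) G = 0 := by
  rw [RingHom.mem_ker]
  constructor
  · intro h c
    rw [← lineHom_eval, h]; simp
  · intro h
    apply Polynomial.funext
    intro c
    rw [lineHom_eval, h]; simp

lemma homog_mem_line {m : ℕ} {p : Fin 3 → ℂ} {G : S3} (hG : G.IsHomogeneous m)
    (h : eval p G = 0) : G ∈ RingHom.ker (lineHom p) := by
  rw [mem_line_iff]
  intro c
  rw [eval_smul_homog hG, h, mul_zero]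

lemma krull_chain (a b c d e : PrimeSpectrum S3) (h1 : a < b) (h2 : b < c) (h3 : c < d)
    (h4 : d < e) : False := by
  have hd : ringKrullDim S3 = 3 := by
    rw [MvPolynomial.ringKrullDim_of_isNoetherianRing]
    simp
  let s : LTSeries (PrimeSpectrum S3) :=
    ((((RelSeries.singleton _ a).snoc b (by simpa using h1)).snoc c (by simpa using h2)).snoc d
      (by simpa using h3)).snoc e (by simpa using h4)
  have hs : s.length = 4 := by simp [s]
  have := Order.LTSeries.length_le_krullDim s
  rw [hs] at this
  rw [ringKrullDim] at hd
  rw [hd] at this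
  exact absurd this (by decide)

lemma weak_bezout {m k : ℕ} {F G : S3} (hF : F.IsHomogeneous m) (hG : G.IsHomogeneous k)
    (hirr : Irreducible F) (hnd : ¬ F ∣ G) : (zeroSet F G).Finite := by
  have hinj : Function.Injective (fun p : P2 => RingHom.ker (lineHom p.rep)) := by
    intro p q hpq
    simp only at hpq
    have key : ∀ i j, p.rep i * q.rep j = p.rep j * q.rep i := by
      intro i j
      have h1 : (C (p.rep i) * X j - C (p.rep j) * X i : S3) ∈ RingHom.ker (lineHom p.rep) := by
        rw [mem_line_iff]; intro c; simp; ring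
      rw [hpq, mem_line_iff] at h1
      have := h1 1
      simp at this
      linear_combination this
    have hp := p.rep_nonzero
    obtain ⟨i, hi⟩ : ∃ i, p.rep i ≠ 0 := by
      by_contra! h; exact hp (funext h)
    have hq := q.rep_nonzero
    have : p.rep i • q.rep = q.rep i • p.rep := by
      funext j
      simp only [Pi.smul_apply, smul_eq_mul]
      linear_combination key i j
    have hqi : q.rep i ≠ 0 := by
      intro h0
      rw [h0, zero_smul] at this
      exact (smul_ne_zero hi hq) this
    rw [← p.mk_rep, ← q.mk_rep, Projectivization.mk_eq_mk_iff]
    refine ⟨(Units.mk0 _ hqi)⁻¹ * Units.mk0 _ hi, ?_⟩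
    rw [mul_smul, inv_smul_eq_iff]
    exact this
  have hfin := Ideal.finite_minimalPrimes_of_isNoetherianRing S3 (Ideal.span {F, G})
  refine Set.Finite.of_finite_image (f := fun p : P2 => RingHom.ker (lineHom p.rep)) 
    (hfin.subset ?_) (hinj.injOn)
  rintro _ ⟨p, ⟨hpF, hpG⟩, rfl⟩
  simp only
  have hprime : (RingHom.ker (lineHom p.rep)).IsPrime := RingHom.ker_isPrime _
  have hle : Ideal.span {F, G} ≤ RingHom.ker (lineHom p.rep) := by
    rw [Ideal.span_le]
    rintro x (rfl | rfl)
    · exact homog_mem_line hF hpF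
    · exact homog_mem_line hG hpG
  obtain ⟨P, hP, hPle⟩ := Ideal.exists_minimalPrimes_le hle
  rcases eq_or_lt_of_le hPle with h | h
  · rw [← h]; exact hP
  exfalso
  have hPp : P.IsPrime := hP.1.1
  have hFG : Ideal.span {F, G} ≤ P := hP.1.2
  have hF0 : F ≠ 0 := hirr.ne_zero
  have hFp : (Ideal.span {F}).IsPrime := (Ideal.span_singleton_prime hF0).2 hirr.prime
  have hmp : (RingHom.ker (eval (0 : Fin 3 → ℂ))).IsPrime := RingHom.ker_isPrime _
  have hbp : (⊥ : Ideal S3).IsPrime := Ideal.isPrime_bot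
  refine krull_chain ⟨⊥, hbp⟩ ⟨_, hFp⟩ ⟨P, hPp⟩ ⟨_, hprime⟩ ⟨_, hmp⟩ ?_ ?_ ?_ ?_
  · show (⊥ : Ideal S3) < Ideal.span {F}
    rw [bot_lt_iff_ne_bot]
    simpa using hF0
  · show Ideal.span {F} < P
    refine lt_of_le_of_ne ?_ ?_
    · rw [Ideal.span_singleton_le_iff_mem]; exact hFG (Ideal.subset_span (by simp))
    · intro h
      apply hnd
      rw [← Ideal.mem_span_singleton, h]
      exact hFG (Ideal.subset_span (by simp))
  · exact h
  · show RingHom.ker (lineHom p.rep) < RingHom.ker (eval (0 : Fin 3 → ℂ))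
    refine lt_of_le_of_ne ?_ ?_
    · intro x hx
      rw [mem_line_iff] at hx
      have := hx 0
      rw [zero_smul] at this
      exact this
    · intro h
      apply p.rep_nonzero
      funext i
      have : (X i : S3) ∈ RingHom.ker (eval (0 : Fin 3 → ℂ)) := by
        rw [RingHom.mem_ker]; simp
      rw [← h, mem_line_iff] at this
      simpa using this 1

lemma exists_avoid {n : ℕ} (s : Finset (MvPolynomial (Fin n) ℂ)) (hs : ∀ q ∈ s, q ≠ 0) :
    ∃ v, ∀ q ∈ s, eval v q ≠ 0 := by
  have h : ∏ q ∈ s, q ≠ 0 := Finset.prod_ne_zero_iff.2 hs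
  by_contra! hc
  apply h
  apply MvPolynomial.funext
  intro v
  obtain ⟨q, hq, hv⟩ := hc v
  rw [map_prod, map_zero]
  exact Finset.prod_eq_zero hq hv

/-! ### Non-flexes -/

lemma pd_comm (i j : Fin 3) (F : S3) : pderiv i (pderiv j F) = pderiv j (pderiv i F) := by
  have h : (⁅(pderiv i : Derivation ℂ S3 S3), (pderiv j : Derivation ℂ S3 S3)⁆) = 0 := by
    apply MvPolynomial.derivation_ext
    intro k
    rw [Derivation.commutator_apply]
    simp [pderiv_X, Pi.single_apply, apply_ite]
  have := DFunLike.congr_fun h F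
  rw [Derivation.commutator_apply] at this
  exact sub_eq_zero.1 this

lemma euler0 {d : ℕ} {F : S3} (hF : F.IsHomogeneous d) :
    X 0 * pderiv 0 F + X 1 * pderiv 1 F + X 2 * pderiv 2 F = (d : S3) * F := by
  have := hF.sum_X_mul_pderiv
  rw [Fin.sum_univ_three, nsmul_eq_mul] at this
  exact this

lemma euler1 {d : ℕ} {F : S3} (hF : F.IsHomogeneous d) (j : Fin 3) :
    X 0 * pderiv j (pderiv 0 F) + X 1 * pderiv j (pderiv 1 F) + X 2 * pderiv j (pderiv 2 F)
      = ((d - 1 : ℕ) : S3) * pderiv j F := by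
  rw [pd_comm j 0, pd_comm j 1, pd_comm j 2]
  exact euler0 (homog_pd hF j)

lemma aeval_sub_mem {σ τ : Type*} (I : Ideal (MvPolynomial τ ℂ)) (g h : σ → MvPolynomial τ ℂ)
    (hgh : ∀ i, g i - h i ∈ I) (F : MvPolynomial σ ℂ) : aeval g F - aeval h F ∈ I := by
  rw [← Ideal.Quotient.eq]
  have : ((Ideal.Quotient.mkₐ ℂ I).comp (aeval g)) = ((Ideal.Quotient.mkₐ ℂ I).comp (aeval h)) := by
    ext i
    simp only [AlgHom.comp_apply, aeval_X, Ideal.Quotient.mkₐ_eq_mk]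
    rw [Ideal.Quotient.eq]
    exact hgh i
  exact DFunLike.congr_fun this F

/-- The Hessian determinant. -/
def hessDet (F : S3) : S3 :=
  pderiv 0 (pderiv 0 F) * (pderiv 1 (pderiv 1 F) * pderiv 2 (pderiv 2 F)
      - pderiv 1 (pderiv 2 F) * pderiv 1 (pderiv 2 F))
    - pderiv 0 (pderiv 1 F) * (pderiv 0 (pderiv 1 F) * pderiv 2 (pderiv 2 F)
      - pderiv 1 (pderiv 2 F) * pderiv 0 (pderiv 2 F))
    + pderiv 0 (pderiv 2 F) * (pderiv 0 (pderiv 1 F) * pderiv 1 (pderiv 2 F)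
      - pderiv 1 (pderiv 1 F) * pderiv 0 (pderiv 2 F))

lemma hessDet_homog {d : ℕ} {F : S3} (hF : F.IsHomogeneous d) :
    (hessDet F).IsHomogeneous ((d - 1 - 1) + ((d - 1 - 1) + (d - 1 - 1))) := by
  have h : ∀ i j : Fin 3, (pderiv i (pderiv j F)).IsHomogeneous (d - 1 - 1) :=
    fun i j => homog_pd (homog_pd hF j) i
  unfold hessDet
  exact (((h _ _).mul (((h _ _).mul (h _ _)).sub ((h _ _).mul (h _ _)))).sub
    ((h _ _).mul (((h _ _).mul (h _ _)).sub ((h _ _).mul (h _ _))))).add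
    ((h _ _).mul (((h _ _).mul (h _ _)).sub ((h _ _).mul (h _ _))))

lemma X1_dvd_of_eval {k : ℕ} {B : MvPolynomial (Fin 2) ℂ} (hB : B.IsHomogeneous k)
    (h : eval ![1, 0] B = 0) : X 1 ∣ B := by
  have h1 : aeval (fun i => (X i : MvPolynomial (Fin 2) ℂ)) B -
      aeval (![X 0, 0] : Fin 2 → MvPolynomial (Fin 2) ℂ) B ∈ Ideal.span {(X 1 : MvPolynomial (Fin 2) ℂ)} := by
    apply aeval_sub_mem
    intro i
    rw [Ideal.mem_span_singleton]
    fin_cases i <;> simp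
  have h2 : aeval (![X 0, 0] : Fin 2 → MvPolynomial (Fin 2) ℂ) B = 0 := by
    apply MvPolynomial.funext
    intro x
    have : ((aeval x : MvPolynomial (Fin 2) ℂ →ₐ[ℂ] ℂ).comp
        (aeval (![X 0, 0] : Fin 2 → MvPolynomial (Fin 2) ℂ))) = aeval (x 0 • ![1, 0]) := by
      ext i
      fin_cases i <;> simp
    have h3 := DFunLike.congr_fun this B
    simp only [AlgHom.comp_apply, aeval_eq_eval] at h3
    rw [eval_smul_homog hB, h, mul_zero] at h3
    rw [h3, map_zero]
  rw [h2, sub_zero, Ideal.mem_span_singleton, aeval_X_left, AlgHom.id_apply] at h1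
  exact h1

lemma binary_split {k : ℕ} : ∀ {B : MvPolynomial (Fin 2) ℂ}, B.IsHomogeneous k → B ≠ 0 →
    ∃ (m : ℕ) (B' : MvPolynomial (Fin 2) ℂ), B = B' * X 1 ^ m ∧ eval ![1, 0] B' ≠ 0 := by
  induction k with
  | zero =>
    intro B hB h0
    refine ⟨0, B, by simp, fun h => h0 ?_⟩
    exact eq_zero_of_dvd_of_lt (isHomogeneous_X ℂ 1) hB (by norm_num) (X1_dvd_of_eval hB h)
  | succ k ih =>
    intro B hB h0
    by_cases h : eval ![1, 0] B = 0
    · obtain ⟨q, rfl⟩ := X1_dvd_of_eval hB h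
      rw [mul_comm] at hB
      have h1 := homog_of_mul (isHomogeneous_X ℂ (1 : Fin 2)) (X_ne_zero _) hB
      have h2 : q.IsHomogeneous k := by rw [h1]; exact hq_homog _ _ _
      obtain ⟨m, B', rfl, hB'⟩ := ih h2 (right_ne_zero_of_mul h0)
      exact ⟨m + 1, B', by ring, hB'⟩
    · exact ⟨0, B, by simp, h⟩

lemma cross_nonflex {R : Type*} [CommRing R] (x0 x1 x2 f0 f1 f2 a b c e g h u0 u1 u2 F n m D : R)
    (E : x0 * f0 + x1 * f1 + x2 * f2 = m * F)
    (E0 : x0 * a + x1 * b + x2 * c = n * f0)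
    (E1 : x0 * b + x1 * e + x2 * g = n * f1)
    (E2 : x0 * c + x1 * g + x2 * h = n * f2)
    (hD : D = a * (e * h - g * g) - b * (b * h - g * c) + c * (b * g - e * c))
    (k0 k1 k2 : R)
    (hk0 : k0 = (f1 * u2 - f2 * u1) * a + (f2 * u0 - f0 * u2) * b + (f0 * u1 - f1 * u0) * c)
    (hk1 : k1 = (f1 * u2 - f2 * u1) * b + (f2 * u0 - f0 * u2) * e + (f0 * u1 - f1 * u0) * g)
    (hk2 : k2 = (f1 * u2 - f2 * u1) * c + (f2 * u0 - f0 * u2) * g + (f0 * u1 - f1 * u0) * h) :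
    n ^ 2 * (f1 * k2 - f2 * k1) = (x0 * u0 + x1 * u1 + x2 * u2) * x0 * D
      - n * m * (u0 * (e * h - g * g) + u1 * (c * g - b * h) + u2 * (b * g - c * e)) * F ∧
    n ^ 2 * (f2 * k0 - f0 * k2) = (x0 * u0 + x1 * u1 + x2 * u2) * x1 * D
      - n * m * (u0 * (c * g - b * h) + u1 * (a * h - c * c) + u2 * (b * c - a * g)) * F ∧
    n ^ 2 * (f0 * k1 - f1 * k0) = (x0 * u0 + x1 * u1 + x2 * u2) * x2 * D
      - n * m * (u0 * (b * g - c * e) + u1 * (b * c - a * g) + u2 * (a * e - b * b)) * F := by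
  subst hD hk0 hk1 hk2
  refine ⟨?_, ?_, ?_⟩
  · linear_combination
      n * (-((f1 * u2 - f2 * u1) * c + (f2 * u0 - f0 * u2) * g + (f0 * u1 - f1 * u0) * h) * E1
        + ((f1 * u2 - f2 * u1) * b + (f2 * u0 - f0 * u2) * e + (f0 * u1 - f1 * u0) * g) * E2)
      - n * (u0 * (e * h - g * g) + u1 * (c * g - b * h) + u2 * (b * g - c * e)) * E
      - (x0 * u0 + x1 * u1 + x2 * u2) *
        ((e * h - g * g) * E0 + (c * g - b * h) * E1 + (b * g - c * e) * E2)
  · linear_combination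
      n * (-((f1 * u2 - f2 * u1) * a + (f2 * u0 - f0 * u2) * b + (f0 * u1 - f1 * u0) * c) * E2
        + ((f1 * u2 - f2 * u1) * c + (f2 * u0 - f0 * u2) * g + (f0 * u1 - f1 * u0) * h) * E0)
      - n * (u0 * (c * g - b * h) + u1 * (a * h - c * c) + u2 * (b * c - a * g)) * E
      - (x0 * u0 + x1 * u1 + x2 * u2) *
        ((c * g - b * h) * E0 + (a * h - c * c) * E1 + (b * c - a * g) * E2)
  · linear_combination
      n * (-((f1 * u2 - f2 * u1) * b + (f2 * u0 - f0 * u2) * e + (f0 * u1 - f1 * u0) * g) * E0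
        + ((f1 * u2 - f2 * u1) * a + (f2 * u0 - f0 * u2) * b + (f0 * u1 - f1 * u0) * c) * E1)
      - n * (u0 * (b * g - c * e) + u1 * (b * c - a * g) + u2 * (a * e - b * b)) * E
      - (x0 * u0 + x1 * u1 + x2 * u2) *
        ((b * g - c * e) * E0 + (b * c - a * g) * E1 + (a * e - b * b) * E2)

lemma cramer_id (p q n : Fin 3 → ℂ) (D Di : ℂ) (hDi : D * Di = 1)
    (hD : D = (p 1 * q 2 - p 2 * q 1) * n 0 + (p 2 * q 0 - p 0 * q 2) * n 1
      + (p 0 * q 1 - p 1 * q 0) * n 2) (x : Fin 3 → ℂ) (i : Fin 3) :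
    x i = Di * ((q 1 * n 2 - q 2 * n 1) * x 0 + (q 2 * n 0 - q 0 * n 2) * x 1
        + (q 0 * n 1 - q 1 * n 0) * x 2) * p i
      + Di * ((n 1 * p 2 - n 2 * p 1) * x 0 + (n 2 * p 0 - n 0 * p 2) * x 1
        + (n 0 * p 1 - n 1 * p 0) * x 2) * q i
      + Di * ((p 1 * q 2 - p 2 * q 1) * x 0 + (p 2 * q 0 - p 0 * q 2) * x 1
        + (p 0 * q 1 - p 1 * q 0) * x 2) * n i := by
  have key : D * x i = ((q 1 * n 2 - q 2 * n 1) * x 0 + (q 2 * n 0 - q 0 * n 2) * x 1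
        + (q 0 * n 1 - q 1 * n 0) * x 2) * p i
      + ((n 1 * p 2 - n 2 * p 1) * x 0 + (n 2 * p 0 - n 0 * p 2) * x 1
        + (n 0 * p 1 - n 1 * p 0) * x 2) * q i
      + ((p 1 * q 2 - p 2 * q 1) * x 0 + (p 2 * q 0 - p 0 * q 2) * x 1
        + (p 0 * q 1 - p 1 * q 0) * x 2) * n i := by
    subst hD
    fin_cases i <;> simp <;> ring
  linear_combination Di * key - x i * hDi

/-- The constant linear form `a · r`. -/
def linF (a : Fin 3 → ℂ) : S3 := C (a 0) * X 0 + C (a 1) * X 1 + C (a 2) * X 2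

lemma eval_linF (a x : Fin 3 → ℂ) : eval x (linF a) = a 0 * x 0 + a 1 * x 1 + a 2 * x 2 := by
  simp [linF]

lemma linF_homog (a : Fin 3 → ℂ) : (linF a).IsHomogeneous 1 := by
  unfold linF
  have : ∀ i : Fin 3, (C (a i) * X i : S3).IsHomogeneous 1 := by
    intro i
    have := (isHomogeneous_C (Fin 3) (a i)).mul (isHomogeneous_X ℂ i)
    simpa using this
  exact ((this 0).add (this 1)).add (this 2)

/-- Restriction to a line `y = 0` spanned by independent `p, q`. -/
lemma line_restrict (p q n a : Fin 3 → ℂ) {D Di t : ℂ} (hDi : D * Di = 1)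
    (hD : D = (p 1 * q 2 - p 2 * q 1) * n 0 + (p 2 * q 0 - p 0 * q 2) * n 1
      + (p 0 * q 1 - p 1 * q 0) * n 2)
    (h0 : p 1 * q 2 - p 2 * q 1 = t * a 0) (h1 : p 2 * q 0 - p 0 * q 2 = t * a 1)
    (h2 : p 0 * q 1 - p 1 * q 0 = t * a 2) :
    ∃ α β : Fin 3 → ℂ, eval p (linF α) = 1 ∧ eval p (linF β) = 0 ∧ eval q (linF β) = 1 ∧
      ∀ F : S3, ∃ G, F = G * linF a + aeval (![linF α, linF β] : Fin 2 → S3)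
        (aeval (fun i => C (p i) * X 0 + C (q i) * X 1 : Fin 3 → MvPolynomial (Fin 2) ℂ) F) := by
  refine ⟨![Di * (q 1 * n 2 - q 2 * n 1), Di * (q 2 * n 0 - q 0 * n 2),
    Di * (q 0 * n 1 - q 1 * n 0)], ![Di * (n 1 * p 2 - n 2 * p 1), Di * (n 2 * p 0 - n 0 * p 2),
    Di * (n 0 * p 1 - n 1 * p 0)], ?_, ?_, ?_, ?_⟩
  · rw [eval_linF]; simp; linear_combination hDi - Di * hD
  · rw [eval_linF]; simp; ring
  · rw [eval_linF]; simp; linear_combination hDi - Di * hD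
  · intro F
    set α : Fin 3 → ℂ := ![Di * (q 1 * n 2 - q 2 * n 1), Di * (q 2 * n 0 - q 0 * n 2),
      Di * (q 0 * n 1 - q 1 * n 0)] with hα
    set β : Fin 3 → ℂ := ![Di * (n 1 * p 2 - n 2 * p 1), Di * (n 2 * p 0 - n 0 * p 2),
      Di * (n 0 * p 1 - n 1 * p 0)] with hβ
    have h3 := aeval_sub_mem (Ideal.span {linF a}) (fun i => (X i : S3))
      (fun i => C (p i) * linF α + C (q i) * linF β) (by
        intro i
        rw [Ideal.mem_span_singleton]
        refine ⟨C (Di * t * n i), ?_⟩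
        apply MvPolynomial.funext
        intro x
        have := cramer_id p q n D Di hDi hD x i
        simp only [map_sub, map_add, map_mul, eval_X, eval_C, eval_linF]
        simp only [hα, hβ, Matrix.cons_val_zero, Matrix.cons_val_one, Matrix.cons_val]
        rw [h0, h1, h2] at this
        linear_combination this) F
    rw [aeval_X_left, AlgHom.id_apply, Ideal.mem_span_singleton'] at h3
    obtain ⟨G, hG⟩ := h3
    refine ⟨G, ?_⟩
    have h4 : ((aeval (![linF α, linF β] : Fin 2 → S3)).comp
        (aeval (fun i => C (p i) * X 0 + C (q i) * X 1 : Fin 3 → MvPolynomial (Fin 2) ℂ)))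
        = aeval (fun i => C (p i) * linF α + C (q i) * linF β) := by
      ext i
      simp
    have h5 := DFunLike.congr_fun h4 F
    rw [AlgHom.comp_apply] at h5
    rw [h5]
    linear_combination -hG

set_option maxHeartbeats 2000000 in
lemma nonflex {d : ℕ} (hd : 2 ≤ d) {F : S3} (hF : F.IsHomogeneous d) (hirr : Irreducible F)
    {p : Fin 3 → ℂ} (hp : eval p F = 0) {j : Fin 3} (hj : eval p (pderiv j F) ≠ 0) :
    ¬ F ∣ hessDet F := by
  rintro ⟨W, hW⟩
  have hp0 : ∃ k, p k ≠ 0 := by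
    by_contra! h
    apply hj
    have : p = (0 : ℂ) • p := by funext i; simp [h]
    rw [this, eval_smul_homog (homog_pd hF j), zero_pow (by omega), zero_mul]
  obtain ⟨k, hk⟩ := hp0
  set c : Fin 3 → ℂ := fun i => eval p (pderiv i F) with hc
  have hpc : p 0 * c 0 + p 1 * c 1 + p 2 * c 2 = 0 := by
    have := congrArg (eval p) (euler0 hF)
    simpa [hp] using this
  obtain ⟨u, hu⟩ : ∃ u : Fin 3 → ℂ, p 0 * u 0 + p 1 * u 1 + p 2 * u 2 ≠ 0 := by
    refine ⟨Pi.single k 1, ?_⟩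
    fin_cases k <;> simpa using hk
  obtain ⟨n, hn⟩ : ∃ n : Fin 3 → ℂ, c 0 * n 0 + c 1 * n 1 + c 2 * n 2 ≠ 0 := by
    refine ⟨Pi.single j 1, ?_⟩
    fin_cases j <;> simpa using hj
  set f0 := pderiv 0 F with hf0
  set f1 := pderiv 1 F with hf1
  set f2 := pderiv 2 F with hf2
  set w0 : S3 := f1 * C (u 2) - f2 * C (u 1) with hw0
  set w1 : S3 := f2 * C (u 0) - f0 * C (u 2) with hw1
  set w2 : S3 := f0 * C (u 1) - f1 * C (u 0) with hw2
  let δ : Derivation ℂ S3 S3 := w0 • pderiv 0 + w1 • pderiv 1 + w2 • pderiv 2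
  have hδ : ∀ G, δ G = w0 * pderiv 0 G + w1 * pderiv 1 G + w2 * pderiv 2 G := by
    intro G; simp [δ]
  have hδC : ∀ a : ℂ, δ (C a) = 0 := fun a => by rw [hδ]; simp
  have hδlin : ∀ a : Fin 3 → ℂ, δ (linF a) = C (a 0) * w0 + C (a 1) * w1 + C (a 2) * w2 := by
    intro a
    rw [hδ]
    simp [linF, pderiv_X, Pi.single_apply]
    ring
  have hδF : δ F = 0 := by
    rw [hδ, ← hf0, ← hf1, ← hf2, hw0, hw1, hw2]; ring
  set q : Fin 3 → ℂ := ![c 1 * u 2 - c 2 * u 1, c 2 * u 0 - c 0 * u 2, c 0 * u 1 - c 1 * u 0] with hq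
  have hδlinp : ∀ a : Fin 3 → ℂ, eval p (δ (linF a)) = eval q (linF a) := by
    intro a
    rw [hδlin, eval_linF]
    simp [hw0, hw1, hw2, hq, hc, hf0, hf1, hf2]
  have hd1 : (((d - 1 : ℕ) : S3)) ^ 2 ≠ 0 := by
    have : ((d - 1 : ℕ) : S3) ≠ 0 := by
      rw [Nat.cast_ne_zero]; omega
    exact pow_ne_zero _ this
  -- parallelism
  have hcross := cross_nonflex (X 0) (X 1) (X 2) f0 f1 f2 (pderiv 0 f0) (pderiv 0 f1) (pderiv 0 f2)
    (pderiv 1 f1) (pderiv 1 f2) (pderiv 2 f2) (C (u 0)) (C (u 1)) (C (u 2)) F ((d - 1 : ℕ) : S3)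
    (d : S3) (hessDet F) (euler0 hF) (euler1 hF 0)
    (by have := euler1 hF 1; rwa [pd_comm 1 0] at this)
    (by have := euler1 hF 2; rwa [pd_comm 2 0, pd_comm 2 1] at this) rfl
    (δ f0) (δ f1) (δ f2) 
    (by rw [hδ, hf0, pd_comm 1 0, pd_comm 2 0])
    (by rw [hδ, hf1, pd_comm 2 1]) (by rw [hδ])
  rw [hW] at hcross
  obtain ⟨h0, h1, h2⟩ := hcross
  have hdvd : ∀ z : S3, F ∣ ((d - 1 : ℕ) : S3) ^ 2 * z → F ∣ z := by
    intro z hz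
    have h3 : IsUnit ((((d - 1 : ℕ) : S3)) ^ 2) := by
      apply IsUnit.pow
      have : ((d - 1 : ℕ) : S3) = C ((d - 1 : ℕ) : ℂ) := by simp
      rw [this]
      apply IsUnit.map
      rw [isUnit_iff_ne_zero, Nat.cast_ne_zero]; omega
    rwa [← h3.dvd_mul_left]
  have g0 : F ∣ f1 * δ f2 - f2 * δ f1 := by
    apply hdvd
    rw [h0]
    exact dvd_sub (dvd_mul_of_dvd_right (dvd_mul_right F W) _) (dvd_mul_left F _)
  have g1 : F ∣ f2 * δ f0 - f0 * δ f2 := by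
    apply hdvd
    rw [h1]
    exact dvd_sub (dvd_mul_of_dvd_right (dvd_mul_right F W) _) (dvd_mul_left F _)
  have g2 : F ∣ f0 * δ f1 - f1 * δ f0 := by
    apply hdvd
    rw [h2]
    exact dvd_sub (dvd_mul_of_dvd_right (dvd_mul_right F W) _) (dvd_mul_left F _)
  have hpar : ∀ a : Fin 3, F ∣ pderiv j F * δ (pderiv a F) - δ (pderiv j F) * pderiv a F := by
    obtain ⟨z0, g0⟩ := g0
    obtain ⟨z1, g1⟩ := g1
    obtain ⟨z2, g2⟩ := g2
    intro a
    have e0 : (pderiv 0) F = f0 := rfl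
    have e1 : (pderiv 1) F = f1 := rfl
    have e2 : (pderiv 2) F = f2 := rfl
    clear_value f0 f1 f2
    fin_cases j <;> fin_cases a <;>
      simp only [Fin.zero_eta, Fin.mk_one, Fin.reduceFinMk, e0, e1, e2]
    · exact ⟨0, by ring⟩
    · exact ⟨z2, by linear_combination g2⟩
    · exact ⟨-z1, by linear_combination -g1⟩
    · exact ⟨-z2, by linear_combination -g2⟩
    · exact ⟨0, by ring⟩
    · exact ⟨z0, by linear_combination g0⟩
    · exact ⟨z1, by linear_combination g1⟩
    · exact ⟨-z0, by linear_combination -g0⟩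
    · exact ⟨0, by ring⟩
  set y : S3 := linF c with hy
  have hyp : eval p y = 0 := by rw [hy, eval_linF]; linear_combination hpc
  have hδyp : eval p (δ y) = 0 := by
    rw [hy, hδlinp, eval_linF, hq]; simp; ring
  have hδδ : F ∣ pderiv j F * δ (δ y) - δ (pderiv j F) * δ y := by
    obtain ⟨z0, g0⟩ := hpar 0
    obtain ⟨z1, g1⟩ := hpar 1
    obtain ⟨z2, g2⟩ := hpar 2
    rw [← hf0] at g0
    rw [← hf1] at g1
    rw [← hf2] at g2
    have hm : ∀ (a : S3) (b : ℂ), δ (a * C b) = δ a * C b := by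
      intro a b; rw [Derivation.leibniz, hδC]; simp [mul_comm]
    have hm' : ∀ (a : S3) (b : ℂ), δ (C b * a) = C b * δ a := by
      intro a b; rw [Derivation.leibniz, hδC]; simp
    have e : δ (δ y) = C (c 0) * (δ f1 * C (u 2) - δ f2 * C (u 1))
        + C (c 1) * (δ f2 * C (u 0) - δ f0 * C (u 2))
        + C (c 2) * (δ f0 * C (u 1) - δ f1 * C (u 0)) := by
      rw [hy, hδlin, hw0, hw1, hw2]
      simp only [map_add, map_sub, hm, hm']
    rw [e, hy, hδlin, hw0, hw1, hw2]
    refine ⟨C (c 0) * (z1 * C (u 2) - z2 * C (u 1))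
        + C (c 1) * (z2 * C (u 0) - z0 * C (u 2))
        + C (c 2) * (z0 * C (u 1) - z1 * C (u 0)), ?_⟩
    linear_combination C (c 0) * (g1 * C (u 2) - g2 * C (u 1))
        + C (c 1) * (g2 * C (u 0) - g0 * C (u 2))
        + C (c 2) * (g0 * C (u 1) - g1 * C (u 0))
  -- the stable ideal
  let K : Ideal S3 := Ideal.span {F, y, δ y}
  have hFK : F ∈ K := Ideal.subset_span (by simp)
  have hyK : y ∈ K := Ideal.subset_span (by simp)
  have hdyK : δ y ∈ K := Ideal.subset_span (by simp)
  have hKp : ∀ x ∈ K, eval p x = 0 := by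
    intro x hx
    have : K ≤ RingHom.ker (eval p) := by
      rw [Ideal.span_le]
      rintro z (rfl | rfl | rfl)
      · exact hp
      · exact hyp
      · exact hδyp
    exact this hx
  have hKst : ∀ x ∈ K, pderiv j F * δ x ∈ K := by
    intro x hx
    refine Submodule.span_induction (p := fun x _ => pderiv j F * δ x ∈ K) ?_ ?_ ?_ ?_ hx
    · rintro z (rfl | rfl | rfl)
      · rw [hδF]; simp
      · exact K.mul_mem_left _ hdyK
      · obtain ⟨t, ht⟩ := hδδ
        have : pderiv j F * δ (δ y) = t * F + δ (pderiv j F) * δ y := by linear_combination ht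
        rw [this]
        exact K.add_mem (K.mul_mem_left _ hFK) (K.mul_mem_left _ hdyK)
    · simp
    · intro a b _ _ ha hb
      rw [map_add, mul_add]; exact K.add_mem ha hb
    · intro a b hbK hb
      rw [smul_eq_mul, Derivation.leibniz, smul_eq_mul, smul_eq_mul]
      have : pderiv j F * (a * δ b + b * δ a) = a * (pderiv j F * δ b) + (pderiv j F * δ a) * b := by
        ring
      rw [this]
      exact K.add_mem (K.mul_mem_left _ hb) (K.mul_mem_left _ hbK)
  have t0 : p 1 * q 2 - p 2 * q 1 = (p 0 * u 0 + p 1 * u 1 + p 2 * u 2) * c 0 := by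
    simp only [hq, Matrix.cons_val_zero, Matrix.cons_val_one, Matrix.cons_val]
    linear_combination -u 0 * hpc
  have t1 : p 2 * q 0 - p 0 * q 2 = (p 0 * u 0 + p 1 * u 1 + p 2 * u 2) * c 1 := by
    simp only [hq, Matrix.cons_val_zero, Matrix.cons_val_one, Matrix.cons_val]
    linear_combination -u 1 * hpc
  have t2 : p 0 * q 1 - p 1 * q 0 = (p 0 * u 0 + p 1 * u 1 + p 2 * u 2) * c 2 := by
    simp only [hq, Matrix.cons_val_zero, Matrix.cons_val_one, Matrix.cons_val]
    linear_combination -u 2 * hpc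
  have hDne : (p 0 * u 0 + p 1 * u 1 + p 2 * u 2) * (c 0 * n 0 + c 1 * n 1 + c 2 * n 2) ≠ 0 :=
    mul_ne_zero hu hn
  obtain ⟨α, β, hα, hβ, hβq, hres⟩ := line_restrict p q n c (mul_inv_cancel₀ hDne)
    (by rw [t0, t1, t2]; ring) t0 t1 t2
  have claim : ∀ m : ℕ, ∀ z : S3, z * linF β ^ m ∈ K → eval p z = 0 := by
    intro m
    induction m with
    | zero => intro z hz; apply hKp; simpa using hz
    | succ m ih =>
      intro z hz
      have h3 := hKst _ hz
      have h4 := ih (pderiv j F * (δ z * linF β + (m + 1 : ℕ) * z * δ (linF β))) (by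
        convert h3 using 1
        rw [Derivation.leibniz, Derivation.leibniz_pow]
        simp only [smul_eq_mul, nsmul_eq_mul, Nat.add_sub_cancel]
        ring)
      simp only [map_mul, map_add, hβ, hδlinp, hβq, map_natCast, mul_zero, zero_add, mul_one] at h4
      have h5 : ((m + 1 : ℕ) : ℂ) ≠ 0 := Nat.cast_ne_zero.2 (by omega)
      exact ((mul_eq_zero.1 h4).resolve_left hj |> mul_eq_zero.1).resolve_left h5
  obtain ⟨G, hG⟩ := hres F
  set B := aeval (fun i => C (p i) * X 0 + C (q i) * X 1 : Fin 3 → MvPolynomial (Fin 2) ℂ) F with hB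
  have hBh : B.IsHomogeneous d := by
    have := hF.aeval (g := (fun i => C (p i) * X 0 + C (q i) * X 1 : Fin 3 → MvPolynomial (Fin 2) ℂ))
      (n := 1) (by
      intro i
      have h0 : ∀ (a : ℂ) (k : Fin 2), (C a * X k : MvPolynomial (Fin 2) ℂ).IsHomogeneous 1 := by
        intro a k
        have := (isHomogeneous_C (Fin 2) a).mul (isHomogeneous_X ℂ k)
        simpa using this
      exact (h0 _ _).add (h0 _ _))
    rw [one_mul] at this
    exact this
  by_cases hB0 : B = 0
  · rw [hB0, map_zero, add_zero, ← hy] at hG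
    have hyh : y.IsHomogeneous 1 := linF_homog c
    have hG' := hG
    rcases (hirr.isUnit_or_isUnit hG) with h | h
    · have h5 : F ∣ y := by
        conv_lhs => rw [hG]
        exact (h.mul_left_dvd).2 dvd_rfl
      have h6 := eq_zero_of_dvd_of_lt hF hyh (by omega) h5
      rw [h6, mul_zero] at hG
      exact hirr.ne_zero hG
    · exact (h.map (eval p)).ne_zero hyp
  · obtain ⟨m, B', hBB, hB'⟩ := binary_split hBh hB0
    rw [hBB, map_mul, map_pow, aeval_X] at hG
    have e1 : (![linF α, linF β] : Fin 2 → S3) 1 = linF β := rfl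
    rw [e1] at hG
    have h7 := claim m (aeval (![linF α, linF β] : Fin 2 → S3) B') (by
      have : aeval (![linF α, linF β] : Fin 2 → S3) B' * linF β ^ m = F - G * y := by
        linear_combination -hG
      rw [this]
      exact K.sub_mem hFK (K.mul_mem_left _ hyK))
    apply hB'
    have h8 : ((aeval p : S3 →ₐ[ℂ] ℂ).comp (aeval (![linF α, linF β] : Fin 2 → S3)))
        = aeval (![1, 0] : Fin 2 → ℂ) := by
      ext i
      fin_cases i
      · simpa [aeval_eq_eval] using hα
      · simpa [aeval_eq_eval] using hβ
    have h9 := DFunLike.congr_fun h8 B'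
    simp only [AlgHom.comp_apply, aeval_eq_eval] at h9
    rw [← h9]; exact h7

/-! ### Choice of the line at infinity and of the polar point -/

/-- The line at infinity. -/
def ell (α β : ℂ) : S3 := X 2 - C α * X 0 - C β * X 1

lemma eval_ell (α β : ℂ) (x : Fin 3 → ℂ) : eval x (ell α β) = x 2 - α * x 0 - β * x 1 := by
  simp [ell]

lemma ell_homog (α β : ℂ) : (ell α β).IsHomogeneous 1 := by
  have h0 : ∀ (a : ℂ) (k : Fin 3), (C a * X k : S3).IsHomogeneous 1 := by
    intro a k
    have := (isHomogeneous_C (Fin 3) a).mul (isHomogeneous_X ℂ k)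
    simpa using this
  exact ((isHomogeneous_X ℂ 2).sub (h0 _ _)).sub (h0 _ _)

lemma ell_ne_zero (α β : ℂ) : ell α β ≠ 0 := by
  intro h
  have := congrArg (eval ![0, 0, 1]) h
  simp [eval_ell] at this

/-- Directional derivative. -/
def dv (v : Fin 3 → ℂ) (G : S3) : S3 :=
  C (v 0) * pderiv 0 G + C (v 1) * pderiv 1 G + C (v 2) * pderiv 2 G

lemma eval_dv (v x : Fin 3 → ℂ) (G : S3) : eval x (dv v G) =
    v 0 * eval x (pderiv 0 G) + v 1 * eval x (pderiv 1 G) + v 2 * eval x (pderiv 2 G) := by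
  simp [dv]

lemma dv_homog {d : ℕ} {G : S3} (hG : G.IsHomogeneous d) (v : Fin 3 → ℂ) :
    (dv v G).IsHomogeneous (d - 1) := by
  have h0 : ∀ (a : ℂ) (k : Fin 3), (C a * pderiv k G : S3).IsHomogeneous (d - 1) := by
    intro a k
    have := (isHomogeneous_C (Fin 3) a).mul (homog_pd hG k)
    simpa using this
  exact ((h0 _ _).add (h0 _ _)).add (h0 _ _)

lemma pd_dv (v : Fin 3 → ℂ) (G : S3) (i : Fin 3) : pderiv i (dv v G) =
    C (v 0) * pderiv i (pderiv 0 G) + C (v 1) * pderiv i (pderiv 1 G)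
      + C (v 2) * pderiv i (pderiv 2 G) := by
  simp [dv]

/-- Restriction to the line at infinity. -/
def rho (α β : ℂ) : S3 →ₐ[ℂ] MvPolynomial (Fin 2) ℂ :=
  aeval ![X 0, X 1, C α * X 0 + C β * X 1]

lemma eval_rho (α β : ℂ) (y : Fin 2 → ℂ) (G : S3) :
    eval y (rho α β G) = eval ![y 0, y 1, α * y 0 + β * y 1] G := by
  have : (aeval y : MvPolynomial (Fin 2) ℂ →ₐ[ℂ] ℂ).comp (rho α β) =
      aeval ![y 0, y 1, α * y 0 + β * y 1] := by
    ext i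
    fin_cases i <;> simp [rho]
  have h := DFunLike.congr_fun this G
  simp only [AlgHom.comp_apply, aeval_eq_eval] at h
  exact h

lemma rho_homog {α β : ℂ} {d : ℕ} {G : S3} (hG : G.IsHomogeneous d) :
    (rho α β G).IsHomogeneous d := by
  have := hG.aeval (g := (![X 0, X 1, C α * X 0 + C β * X 1] : Fin 3 → MvPolynomial (Fin 2) ℂ))
    (n := 1) (by
    have h0 : ∀ (a : ℂ) (k : Fin 2), (C a * X k : MvPolynomial (Fin 2) ℂ).IsHomogeneous 1 := by
      intro a k
      have := (isHomogeneous_C (Fin 2) a).mul (isHomogeneous_X ℂ k)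
      simpa using this
    intro i
    fin_cases i
    · exact isHomogeneous_X ℂ 0
    · exact isHomogeneous_X ℂ 1
    · exact (h0 _ _).add (h0 _ _))
  rw [one_mul] at this
  exact this

lemma rho_ell (α β : ℂ) : rho α β (ell α β) = 0 := by
  simp [rho, ell]

/-- Section of the restriction. -/
def iot : MvPolynomial (Fin 2) ℂ →ₐ[ℂ] S3 := aeval ![X 0, X 1]

lemma rho_iot (α β : ℂ) (G : MvPolynomial (Fin 2) ℂ) : rho α β (iot G) = G := by
  have : (rho α β).comp iot = AlgHom.id ℂ _ := by
    ext i
    fin_cases i <;> simp [rho, iot]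
  exact DFunLike.congr_fun this G

lemma iot_homog {d : ℕ} {G : MvPolynomial (Fin 2) ℂ} (hG : G.IsHomogeneous d) :
    (iot G).IsHomogeneous d := by
  have := hG.aeval (g := (![X 0, X 1] : Fin 2 → S3)) (n := 1) (by
    intro i
    fin_cases i
    · exact isHomogeneous_X ℂ 0
    · exact isHomogeneous_X ℂ 1)
  rw [one_mul] at this
  exact this

lemma sub_iot_rho (α β : ℂ) (G : S3) : ∃ w, G = iot (rho α β G) + w * ell α β := by
  have h := aeval_sub_mem (Ideal.span {ell α β}) (fun i => (X i : S3))
    (![X 0, X 1, C α * X 0 + C β * X 1] : Fin 3 → S3) (by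
      intro i
      rw [Ideal.mem_span_singleton]
      fin_cases i
      · simp
      · simp
      · refine ⟨1, ?_⟩
        simp [ell]; ring) G
  have h2 : iot.comp (rho α β) = aeval (![X 0, X 1, C α * X 0 + C β * X 1] : Fin 3 → S3) := by
    ext i
    fin_cases i <;> simp [iot, rho]
  have h3 := DFunLike.congr_fun h2 G
  rw [AlgHom.comp_apply] at h3
  rw [← h3, aeval_X_left, AlgHom.id_apply, Ideal.mem_span_singleton'] at h
  obtain ⟨w, hw⟩ := h
  exact ⟨w, by linear_combination -hw⟩

lemma ell_dvd_of_rho {α β : ℂ} {G : S3} (h : rho α β G = 0) : ell α β ∣ G := by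
  obtain ⟨w, hw⟩ := sub_iot_rho α β G
  rw [h, map_zero, zero_add] at hw
  exact ⟨w, by rw [hw]; ring⟩

lemma ell_not_dvd {d : ℕ} (hd : 2 ≤ d) {F : S3} (hF : F.IsHomogeneous d) (hirr : Irreducible F)
    (α β : ℂ) : ¬ ell α β ∣ F := by
  rintro ⟨w, hw⟩
  rcases hirr.isUnit_or_isUnit hw with h | h
  · have := (h.map (eval (0 : Fin 3 → ℂ))).ne_zero
    rw [eval_ell] at this
    simp at this
  · have h2 : F ∣ ell α β := by
      conv_lhs => rw [hw]
      exact (h.mul_right_dvd).2 dvd_rfl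
    exact ell_ne_zero α β (eq_zero_of_dvd_of_lt hF (ell_homog α β) (by omega) h2)

lemma exists_zero_on_ell {d : ℕ} (hd : 2 ≤ d) {F : S3} (hF : F.IsHomogeneous d)
    (hirr : Irreducible F) (α β : ℂ) : ∃ x : Fin 3 → ℂ, x ≠ 0 ∧ eval x F = 0 ∧
      eval x (ell α β) = 0 := by
  by_contra! hc
  have h1 : IsRelPrime (rho α β F) 0 := by
    apply relPrime_of_no_common_zero
    intro y hy hy0
    refine hc ![y 0, y 1, α * y 0 + β * y 1] ?_ ?_ ?_
    · intro h
      apply hy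
      funext i
      fin_cases i
      · exact congrFun h 0
      · exact congrFun h 1
    · rw [← eval_rho]; exact hy0.1
    · rw [eval_ell]; simp
  have h2 : IsUnit (rho α β F) := h1 dvd_rfl (dvd_zero _)
  have h3 := (h2.map (eval (0 : Fin 2 → ℂ))).ne_zero
  apply h3
  have := eval_smul_homog (rho_homog (α := α) (β := β) hF) 0 0
  rw [smul_zero, zero_pow (by omega), zero_mul] at this
  exact this

lemma par_of_cross {a m : Fin 3 → ℂ} (hm : m ≠ 0) (h0 : a 1 * m 2 - a 2 * m 1 = 0)
    (h1 : a 2 * m 0 - a 0 * m 2 = 0) (h2 : a 0 * m 1 - a 1 * m 0 = 0) :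
    ∃ t : ℂ, ∀ i, a i = t * m i := by
  obtain ⟨k, hk⟩ : ∃ k, m k ≠ 0 := by
    by_contra! h; exact hm (funext h)
  refine ⟨a k / m k, ?_⟩
  intro i
  field_simp
  fin_cases k <;> fin_cases i <;> simp
  · linear_combination -h2
  · linear_combination h1
  · linear_combination h2
  · linear_combination -h0
  · linear_combination -h1
  · linear_combination h0

lemma exists_ell {F : S3} (hfin : {p : P2 | SingPt F p}.Finite) :
    ∃ α β : ℂ, ∀ p : P2, SingPt F p → eval p.rep (ell α β) ≠ 0 := by
  classical
  let Q : P2 → MvPolynomial (Fin 2) ℂ := fun p =>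
    C (p.rep 2) - C (p.rep 0) * X 0 - C (p.rep 1) * X 1
  have hQ : ∀ p, Q p ≠ 0 := by
    intro p h
    apply p.rep_nonzero
    have h0 := congrArg (eval ![0, 0]) h
    have h1 := congrArg (eval ![1, 0]) h
    have h2 := congrArg (eval ![0, 1]) h
    simp [Q] at h0 h1 h2
    rw [h0] at h1 h2
    funext i
    fin_cases i
    · simpa using h1
    · simpa using h2
    · exact h0
  obtain ⟨v, hv⟩ := exists_avoid (hfin.toFinset.image Q) (by
    intro q hq
    obtain ⟨p, _, rfl⟩ := Finset.mem_image.1 hq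
    exact hQ p)
  refine ⟨v 0, v 1, fun p hp => ?_⟩
  have := hv (Q p) (Finset.mem_image_of_mem _ (by simpa using hp))
  rw [eval_ell]
  simp [Q] at this
  intro h
  apply this
  linear_combination h

/-- The Hessian quadratic form at `x`. -/
def hessQ (F : S3) (x : Fin 3 → ℂ) : S3 :=
  C (eval x (pderiv 0 (pderiv 0 F))) * X 0 * X 0 + C (eval x (pderiv 1 (pderiv 1 F))) * X 1 * X 1
    + C (eval x (pderiv 2 (pderiv 2 F))) * X 2 * X 2
    + C (2 * eval x (pderiv 0 (pderiv 1 F))) * X 0 * X 1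
    + C (2 * eval x (pderiv 0 (pderiv 2 F))) * X 0 * X 2
    + C (2 * eval x (pderiv 1 (pderiv 2 F))) * X 1 * X 2

lemma eval_dvdv (F : S3) (v x : Fin 3 → ℂ) : eval x (dv v (dv v F)) = eval v (hessQ F x) := by
  rw [eval_dv, pd_dv, pd_dv, pd_dv, pd_comm 1 0, pd_comm 2 0, pd_comm 2 1]
  simp [hessQ]
  ring

lemma hessQ_ne_zero {F : S3} {x : Fin 3 → ℂ}
    (hker : ∀ w : Fin 3 → ℂ, (∀ i, ∑ j, eval x (pderiv i (pderiv j F)) * w j = 0) →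
      ∃ c : ℂ, w = c • x) : hessQ F x ≠ 0 := by
  intro h
  have e0 := congrArg (eval ![1, 0, 0]) h
  have e1 := congrArg (eval ![0, 1, 0]) h
  have e2 := congrArg (eval ![0, 0, 1]) h
  have e3 := congrArg (eval ![1, 1, 0]) h
  have e4 := congrArg (eval ![1, 0, 1]) h
  have e5 := congrArg (eval ![0, 1, 1]) h
  simp [hessQ] at e0 e1 e2 e3 e4 e5
  simp [e0, e1, e2] at e3 e4 e5
  have hz : ∀ w : Fin 3 → ℂ, ∃ c : ℂ, w = c • x := by
    intro w
    apply hker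
    intro i
    rw [Fin.sum_univ_three]
    fin_cases i <;> simp [e0, e1, e2, e3, e4, e5, pd_comm 1 0, pd_comm 2 0, pd_comm 2 1]
  obtain ⟨a, ha⟩ := hz ![1, 0, 0]
  obtain ⟨b, hb⟩ := hz ![0, 1, 0]
  have a0 := congrFun ha 0
  have b0 := congrFun hb 0
  have b1 := congrFun hb 1
  have a1 := congrFun ha 1
  simp at a0 a1 b0 b1
  rcases a1 with h | h
  · rw [h] at a0; simp at a0
  · rw [h] at b1; simp at b1

/-- Every nonzero vector is a multiple of the representative of its class. -/
lemma exists_rep {x : Fin 3 → ℂ} (hx : x ≠ 0) : ∃ (p : P2) (c : ℂ), c ≠ 0 ∧ x = c • p.rep := by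
  obtain ⟨a, ha⟩ := Projectivization.exists_smul_eq_mk_rep ℂ x hx
  refine ⟨Projectivization.mk ℂ x hx, ((a⁻¹ : ℂˣ) : ℂ), Units.ne_zero _, ?_⟩
  rw [← ha]
  show x = a⁻¹ • (a • x)
  simp

lemma homog_zero_smul {m : ℕ} {G : S3} (hG : G.IsHomogeneous m) {c : ℂ} (hc : c ≠ 0)
    (x : Fin 3 → ℂ) : eval (c • x) G = 0 ↔ eval x G = 0 := by
  rw [eval_smul_homog hG, mul_eq_zero]
  constructor
  · rintro (h | h)
    · exact absurd h (pow_ne_zero _ hc)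
    · exact h
  · exact Or.inr

lemma hess_kernel_det {F : S3} {x z : Fin 3 → ℂ} (hz : z ≠ 0)
    (h0 : eval x (pderiv 0 (pderiv 0 F)) * z 0 + eval x (pderiv 0 (pderiv 1 F)) * z 1
      + eval x (pderiv 0 (pderiv 2 F)) * z 2 = 0)
    (h1 : eval x (pderiv 0 (pderiv 1 F)) * z 0 + eval x (pderiv 1 (pderiv 1 F)) * z 1
      + eval x (pderiv 1 (pderiv 2 F)) * z 2 = 0)
    (h2 : eval x (pderiv 0 (pderiv 2 F)) * z 0 + eval x (pderiv 1 (pderiv 2 F)) * z 1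
      + eval x (pderiv 2 (pderiv 2 F)) * z 2 = 0) : eval x (hessDet F) = 0 := by
  obtain ⟨k, hk⟩ : ∃ k, z k ≠ 0 := by
    by_contra! h; exact hz (funext h)
  simp only [hessDet, map_add, map_sub, map_mul]
  generalize eval x (pderiv 0 (pderiv 0 F)) = a at *
  generalize eval x (pderiv 0 (pderiv 1 F)) = b at *
  generalize eval x (pderiv 0 (pderiv 2 F)) = c at *
  generalize eval x (pderiv 1 (pderiv 1 F)) = e at *
  generalize eval x (pderiv 1 (pderiv 2 F)) = g at *
  generalize eval x (pderiv 2 (pderiv 2 F)) = h at *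
  apply mul_right_cancel₀ hk
  rw [zero_mul]
  fin_cases k
  · show _ * z 0 = 0
    linear_combination (e * h - g * g) * h0 + (c * g - b * h) * h1 + (b * g - c * e) * h2
  · show _ * z 1 = 0
    linear_combination (c * g - b * h) * h0 + (a * h - c * c) * h1 + (b * c - a * g) * h2
  · show _ * z 2 = 0
    linear_combination (b * g - c * e) * h0 + (b * c - a * g) * h1 + (a * e - b * b) * h2

set_option maxHeartbeats 800000 in
lemma smooth_case {d : ℕ} (hd : 2 ≤ d) {F : S3} (hF : F.IsHomogeneous d) {x v : Fin 3 → ℂ}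
    (hx : x ≠ 0) (hxF : eval x F = 0) (hg : ∃ i, eval x (pderiv i F) ≠ 0) (hvF : eval v F ≠ 0)
    (hv1 : eval x (dv v F) = 0) (hv2 : eval x (dv v (dv v F)) = 0) : eval x (hessDet F) = 0 := by
  have E := congrArg (eval x) (euler0 hF)
  have E0 := congrArg (eval x) (euler1 hF 0)
  have E1 := congrArg (eval x) (euler1 hF 1)
  have E2 := congrArg (eval x) (euler1 hF 2)
  rw [pd_comm 1 0] at E1
  rw [pd_comm 2 0, pd_comm 2 1] at E2
  rw [eval_dvdv] at hv2
  rw [eval_dv] at hv1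
  simp only [hessQ, map_add, map_mul, eval_X, eval_C, map_natCast] at E E0 E1 E2 hv2
  rw [hxF, mul_zero] at E
  have hN : ((d - 1 : ℕ) : ℂ) ≠ 0 := Nat.cast_ne_zero.2 (by omega)
  have hxv : ∀ t : ℂ, v ≠ t • x := by
    intro t h
    apply hvF
    rw [h, eval_smul_homog hF, hxF, mul_zero]
  set f : Fin 3 → ℂ := fun i => eval x (pderiv i F) with hf
  have hf0 : f ≠ 0 := by
    obtain ⟨i, hi⟩ := hg
    intro h; exact hi (congrFun h i)
  have f0 : eval x (pderiv 0 F) = f 0 := rfl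
  have f1 : eval x (pderiv 1 F) = f 1 := rfl
  have f2 : eval x (pderiv 2 F) = f 2 := rfl
  rw [f0, f1, f2] at E hv1
  rw [f0] at E0
  rw [f1] at E1
  rw [f2] at E2
  have main := fun z => hess_kernel_det (F := F) (x := x) (z := z)
  clear_value f
  generalize ((d - 1 : ℕ) : ℂ) = N at *
  generalize eval x (pderiv 0 (pderiv 0 F)) = a at *
  generalize eval x (pderiv 0 (pderiv 1 F)) = b at *
  generalize eval x (pderiv 0 (pderiv 2 F)) = c at *
  generalize eval x (pderiv 1 (pderiv 1 F)) = e at *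
  generalize eval x (pderiv 1 (pderiv 2 F)) = g at *
  generalize eval x (pderiv 2 (pderiv 2 F)) = h at *
  set m : Fin 3 → ℂ := ![x 1 * v 2 - x 2 * v 1, x 2 * v 0 - x 0 * v 2, x 0 * v 1 - x 1 * v 0] with hm
  have m0 : m 0 = x 1 * v 2 - x 2 * v 1 := rfl
  have m1 : m 1 = x 2 * v 0 - x 0 * v 2 := rfl
  have m2 : m 2 = x 0 * v 1 - x 1 * v 0 := rfl
  have hm0 : m ≠ 0 := by
    intro h
    obtain ⟨t, ht⟩ := par_of_cross (a := v) hx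
      (by have := congrFun h 0; rw [m0] at this; simp at this; linear_combination -this)
      (by have := congrFun h 1; rw [m1] at this; simp at this; linear_combination -this)
      (by have := congrFun h 2; rw [m2] at this; simp at this; linear_combination -this)
    exact hxv t (funext ht)
  have perp : ∀ z : Fin 3 → ℂ, z 0 * x 0 + z 1 * x 1 + z 2 * x 2 = 0 →
      z 0 * v 0 + z 1 * v 1 + z 2 * v 2 = 0 → ∃ t : ℂ, ∀ i, z i = t * m i := by
    intro z z1 z2
    apply par_of_cross hm0
    · rw [m1, m2]; linear_combination x 0 * z2 - v 0 * z1
    · rw [m0, m2]; linear_combination x 1 * z2 - v 1 * z1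
    · rw [m0, m1]; linear_combination x 2 * z2 - v 2 * z1
  obtain ⟨s, hs⟩ := perp f (by linear_combination E) (by linear_combination hv1)
  have hs0 : s ≠ 0 := by
    rintro rfl
    apply hf0; funext i; rw [hs i]; simp
  obtain ⟨t, ht⟩ := perp ![a * v 0 + b * v 1 + c * v 2, b * v 0 + e * v 1 + g * v 2,
      c * v 0 + g * v 1 + h * v 2]
    (by simp; linear_combination v 0 * E0 + v 1 * E1 + v 2 * E2 + N * hv1) 
    (by simp; linear_combination hv2)
  have t0 := ht 0
  have t1 := ht 1
  have t2 := ht 2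
  simp at t0 t1 t2
  have s0 := hs 0
  have s1 := hs 1
  have s2 := hs 2
  -- the kernel vector
  apply main (fun i => N * s * v i - t * x i)
  · intro hz
    apply hxv (t / (N * s))
    funext i
    have := congrFun hz i
    simp at this
    simp
    field_simp
    linear_combination this
  · linear_combination N * s * t0 - t * E0 - t * N * s0
  · linear_combination N * s * t1 - t * E1 - t * N * s1
  · linear_combination N * s * t2 - t * E2 - t * N * s2

lemma exists_choice {d : ℕ} (hd : 2 ≤ d) {F : S3} (hF : F.IsHomogeneous d) (hirr : Irreducible F)
    (hfin : {p : P2 | SingPt F p}.Finite)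
    (hker : ∀ x : Fin 3 → ℂ, x ≠ 0 → (∀ i, eval x (pderiv i F) = 0) → ∀ w : Fin 3 → ℂ,
      (∀ i, ∑ j, eval x (pderiv i (pderiv j F)) * w j = 0) → ∃ c : ℂ, w = c • x) :
    ∃ (α β : ℂ) (v : Fin 3 → ℂ),
      (∀ x : Fin 3 → ℂ, x ≠ 0 → (∀ i, eval x (pderiv i F) = 0) → eval x (ell α β) ≠ 0) ∧
      (∀ x : Fin 3 → ℂ, x ≠ 0 → eval x (ell α β) = 0 → eval x F = 0 → eval x (dv v F) ≠ 0) ∧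
      (∀ x : Fin 3 → ℂ, x ≠ 0 → eval x F = 0 → eval x (dv v F) = 0 →
        eval x (dv v (dv v F)) ≠ 0) := by
  classical
  obtain ⟨α, β, hell⟩ := exists_ell hfin
  have hsing : ∀ (p : P2) (c : ℂ), c ≠ 0 → ((∀ i, eval (c • p.rep) (pderiv i F) = 0) ↔ SingPt F p) := by
    intro p c hc
    exact forall_congr' fun i => homog_zero_smul (homog_pd hF i) hc _
  have ha : ∀ x : Fin 3 → ℂ, x ≠ 0 → (∀ i, eval x (pderiv i F) = 0) → eval x (ell α β) ≠ 0 := by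
    intro x hx hs
    obtain ⟨p, c, hc, rfl⟩ := exists_rep hx
    rw [Ne, homog_zero_smul (ell_homog α β) hc]
    exact hell p ((hsing p c hc).1 hs)
  have hfin1 : (zeroSet F (ell α β)).Finite := by
    apply weak_bezout hF (ell_homog α β) hirr
    intro h
    exact ell_ne_zero α β (eq_zero_of_dvd_of_lt hF (ell_homog α β) (by omega) h)
  have hfin2 : (zeroSet F (hessDet F)).Finite := by
    apply weak_bezout hF (hessDet_homog hF) hirr
    obtain ⟨x, hx, hxF, hxl⟩ := exists_zero_on_ell hd hF hirr α β
    have : ∃ j, eval x (pderiv j F) ≠ 0 := by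
      by_contra! h
      exact ha x hx h hxl
    obtain ⟨j, hj⟩ := this
    exact nonflex hd hF hirr hxF hj
  let s : Finset S3 := ({F} ∪ (hfin.toFinset.image fun p => hessQ F p.rep)) ∪
    (((hfin1.toFinset ∪ hfin2.toFinset).filter (fun p => ¬ SingPt F p)).image
      fun p => linF (fun i => eval p.rep (pderiv i F)))
  obtain ⟨v, hv⟩ := exists_avoid s (by
    intro q hq
    simp only [s, Finset.mem_union, Finset.mem_singleton, Finset.mem_image, Finset.mem_filter,
      Set.Finite.mem_toFinset] at hq
    rcases hq with (rfl | ⟨p, hp, rfl⟩) | ⟨p, ⟨_, hp⟩, rfl⟩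
    · exact hirr.ne_zero
    · exact hessQ_ne_zero (hker p.rep p.rep_nonzero hp)
    · intro h0
      apply hp
      intro i
      have := congrArg (eval (Pi.single i 1)) h0
      rw [eval_linF] at this
      fin_cases i <;> simpa using this)
  have hvF : eval v F ≠ 0 := hv F (by simp [s])
  have hvn : ∀ p, SingPt F p → eval v (hessQ F p.rep) ≠ 0 := by
    intro p hp
    apply hv
    simp only [s, Finset.mem_union, Finset.mem_image, Set.Finite.mem_toFinset]
    exact Or.inl (Or.inr ⟨p, hp, rfl⟩)
  have hvs : ∀ p, ¬ SingPt F p → p ∈ zeroSet F (ell α β) ∨ p ∈ zeroSet F (hessDet F) →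
      eval p.rep (dv v F) ≠ 0 := by
    intro p hp hz
    have := hv (linF (fun i => eval p.rep (pderiv i F))) (by
      simp only [s, Finset.mem_union, Finset.mem_image, Finset.mem_filter, Set.Finite.mem_toFinset]
      exact Or.inr ⟨p, ⟨hz, hp⟩, rfl⟩)
    rw [eval_linF] at this
    rw [eval_dv]
    intro h; apply this; linear_combination h
  refine ⟨α, β, v, ha, ?_, ?_⟩
  · intro x hx hxl hxF
    have hns : ¬ ∀ i, eval x (pderiv i F) = 0 := fun h => ha x hx h hxl
    obtain ⟨p, c, hc, rfl⟩ := exists_rep hx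
    rw [hsing p c hc] at hns
    rw [homog_zero_smul (ell_homog α β) hc] at hxl
    rw [homog_zero_smul hF hc] at hxF
    rw [Ne, homog_zero_smul (dv_homog hF v) hc]
    exact hvs p hns (Or.inl ⟨hxF, hxl⟩)
  · intro x hx hxF hxv hxvv
    by_cases hs : ∀ i, eval x (pderiv i F) = 0
    · obtain ⟨p, c, hc, rfl⟩ := exists_rep hx
      rw [hsing p c hc] at hs
      rw [homog_zero_smul (dv_homog (dv_homog hF v) v) hc, eval_dvdv] at hxvv
      exact hvn p hs hxvv
    · have hdet := smooth_case hd hF hx hxF (by push Not at hs; exact hs) hvF hxv hxvv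
      obtain ⟨p, c, hc, rfl⟩ := exists_rep hx
      rw [hsing p c hc] at hs
      rw [homog_zero_smul hF hc] at hxF
      rw [homog_zero_smul (hessDet_homog hF) hc] at hdet
      rw [homog_zero_smul (dv_homog hF v) hc] at hxv
      exact hvs p hs (Or.inr ⟨hxF, hdet⟩) hxv
/-! ### The configuration -/

/-- The standing assumptions. -/
structure Cfg (d : ℕ) (F : S3) (α β : ℂ) (v : Fin 3 → ℂ) : Prop where
  hd : 4 ≤ d
  hF : F.IsHomogeneous d
  irr : Irreducible F
  ker : ∀ x : Fin 3 → ℂ, x ≠ 0 → (∀ i, eval x (pderiv i F) = 0) → ∀ w : Fin 3 → ℂ,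
      (∀ i, ∑ j, eval x (pderiv i (pderiv j F)) * w j = 0) → ∃ c : ℂ, w = c • x
  h0 : ∀ x : Fin 3 → ℂ, x ≠ 0 → (∀ i, eval x (pderiv i F) = 0) → eval x (ell α β) ≠ 0
  h1 : ∀ x : Fin 3 → ℂ, x ≠ 0 → eval x (ell α β) = 0 → eval x F = 0 → eval x (dv v F) ≠ 0
  h2 : ∀ x : Fin 3 → ℂ, x ≠ 0 → eval x F = 0 → eval x (dv v F) = 0 →
      eval x (dv v (dv v F)) ≠ 0

/-- The homogeneous complete intersection ideal. -/
def II (F : S3) (v : Fin 3 → ℂ) : Ideal S3 := Ideal.span {F, dv v F}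

/-- The affine ideal. -/
def KK (F : S3) (α β : ℂ) (v : Fin 3 → ℂ) : Ideal S3 :=
  II F v ⊔ Ideal.span {ell α β - 1}

section D1
variable {d : ℕ} {F : S3} {α β : ℂ} {v : Fin 3 → ℂ}

lemma II_le_KK : II F v ≤ KK F α β v := le_sup_left

lemma F_mem_II : F ∈ II F v := Ideal.subset_span (by simp)

lemma g_mem_II : dv v F ∈ II F v := Ideal.subset_span (by simp)

lemma ell_sub_mem : ell α β - 1 ∈ KK F α β v :=
  le_sup_right (a := II F v) (Ideal.mem_span_singleton_self _)

lemma mem_KK {x : S3} : x ∈ KK F α β v ↔ ∃ c, x - c * (ell α β - 1) ∈ II F v := by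
  rw [KK, Submodule.mem_sup]
  constructor
  · rintro ⟨y, hy, z, hz, rfl⟩
    obtain ⟨c, rfl⟩ := Ideal.mem_span_singleton'.1 hz
    exact ⟨c, by simpa using hy⟩
  · rintro ⟨c, hc⟩
    exact ⟨_, hc, c * (ell α β - 1), Ideal.mem_span_singleton'.2 ⟨c, rfl⟩, by ring⟩

lemma ellpow_sub_mem (j : ℕ) (x : S3) : x - ell α β ^ j * x ∈ KK F α β v := by
  have h : ell α β - 1 ∣ ell α β ^ j - 1 := by
    simpa using sub_dvd_pow_sub_pow (ell α β) 1 j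
  obtain ⟨w, hw⟩ := h
  have : x - ell α β ^ j * x = (-(w * x)) * (ell α β - 1) := by
    linear_combination (-x) * hw
  rw [this]
  exact Ideal.mul_mem_left _ _ ell_sub_mem

lemma Cfg.g_homog (K : Cfg d F α β v) : (dv v F).IsHomogeneous (d - 1) := dv_homog K.hF v

lemma Cfg.rF0 (K : Cfg d F α β v) : rho α β F ≠ 0 := by
  intro h
  exact ell_not_dvd (by have := K.hd; omega) K.hF K.irr α β (ell_dvd_of_rho h)

lemma Cfg.rg0 (K : Cfg d F α β v) : rho α β (dv v F) ≠ 0 := by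
  intro h
  obtain ⟨x, hx, hxF, hxe⟩ := exists_zero_on_ell (by have := K.hd; omega) K.hF K.irr α β
  obtain ⟨w, hw⟩ := ell_dvd_of_rho h
  apply K.h1 x hx hxe hxF
  rw [hw, map_mul, hxe, zero_mul]

lemma Cfg.g0 (K : Cfg d F α β v) : dv v F ≠ 0 := by
  intro h
  apply K.rg0
  rw [h, map_zero]

lemma Cfg.rel (K : Cfg d F α β v) : IsRelPrime (rho α β F) (rho α β (dv v F)) := by
  apply relPrime_of_no_common_zero
  rintro y hy ⟨h1, h2⟩
  rw [eval_rho] at h1 h2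
  refine K.h1 _ ?_ ?_ h1 h2
  · intro h
    apply hy
    have e0 := congrFun h 0
    have e1 := congrFun h 1
    simp at e0 e1
    funext i
    fin_cases i
    · exact e0
    · exact e1
  · simp [eval_ell]

lemma Cfg.R1 (K : Cfg d F α β v) {x : S3} (h : ell α β * x ∈ II F v) : x ∈ II F v := by
  obtain ⟨p, q, hpq⟩ := Ideal.mem_span_pair.1 h
  have h1 := congrArg (rho α β) hpq
  rw [map_add, map_mul, map_mul, map_mul, rho_ell, zero_mul] at h1
  obtain ⟨c, hc1, hc2⟩ := syz_of_relPrime K.rel K.rg0 h1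
  obtain ⟨p', hp'⟩ : ell α β ∣ p - iot c * dv v F := by
    apply ell_dvd_of_rho
    rw [map_sub, map_mul, rho_iot, hc1, sub_self]
  obtain ⟨q', hq'⟩ : ell α β ∣ q + iot c * F := by
    apply ell_dvd_of_rho
    rw [map_add, map_mul, rho_iot, hc2, neg_add_cancel]
  refine Ideal.mem_span_pair.2 ⟨p', q', ?_⟩
  apply mul_left_cancel₀ (ell_ne_zero α β)
  linear_combination hpq - F * hp' - dv v F * hq'

lemma Cfg.R1pow (K : Cfg d F α β v) (j : ℕ) {x : S3} (h : ell α β ^ j * x ∈ II F v) :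
    x ∈ II F v := by
  induction j with
  | zero => simpa using h
  | succ j ih =>
    apply ih
    apply K.R1
    rwa [← mul_assoc, ← pow_succ']

lemma Cfg.II_comp (K : Cfg d F α β v) {x : S3} (h : x ∈ II F v) (m : ℕ) :
    homogeneousComponent m x ∈ II F v := by
  obtain ⟨p, q, rfl⟩ := Ideal.mem_span_pair.1 h
  rw [map_add, hc_mul _ _ K.hF, hc_mul _ _ K.g_homog]
  exact Ideal.mem_span_pair.2 ⟨_, _, rfl⟩

lemma hc_mul_ell (c : S3) (j : ℕ) :
    homogeneousComponent (j + 1) (c * ell α β) = homogeneousComponent j c * ell α β := by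
  rw [hc_mul _ _ (ell_homog α β)]
  simp [hq]

lemma hc_mul_ell0 (c : S3) :
    homogeneousComponent 0 (c * ell α β) = 0 := by
  rw [hc_mul _ _ (ell_homog α β)]
  simp [hq]

lemma Cfg.R2 (K : Cfg d F α β v) {x : S3} {m : ℕ} (hx : x.IsHomogeneous m)
    (h : x ∈ KK F α β v) : x ∈ II F v := by
  obtain ⟨c, hc⟩ := mem_KK.1 h
  have hc' : x + c - c * ell α β ∈ II F v := by convert hc using 1; ring
  have key : ∀ j, homogeneousComponent j x + homogeneousComponent j c
      - homogeneousComponent j (c * ell α β) ∈ II F v := by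
    intro j
    have := K.II_comp hc' j
    simpa using this
  have hne : ∀ j, j ≠ m → homogeneousComponent j x = 0 := by
    intro j hj
    rw [homogeneousComponent_of_mem hx, if_neg hj]
  have hxm : homogeneousComponent m x = x := by
    rw [homogeneousComponent_of_mem hx, if_pos rfl]
  have low : ∀ k, k < m → homogeneousComponent k c ∈ II F v := by
    intro k
    induction k with
    | zero =>
      intro hk
      have := key 0
      rw [hne 0 (by omega), hc_mul_ell0] at this
      simpa using this
    | succ k ih =>
      intro hk
      have h1 := key (k + 1)
      rw [hne _ (by omega), hc_mul_ell] at h1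
      have h2 := Ideal.mul_mem_right (ell α β) _ (ih (by omega))
      have := add_mem h1 h2
      simpa using this
  have mid : x + homogeneousComponent m c ∈ II F v := by
    rcases m with _ | m
    · have := key 0
      rw [hxm, hc_mul_ell0] at this
      simpa using this
    · have h1 := key (m + 1)
      rw [hxm, hc_mul_ell] at h1
      have h2 := Ideal.mul_mem_right (ell α β) _ (low m (by omega))
      have := add_mem h1 h2
      simpa using this
  have high : ∀ j, homogeneousComponent (m + j) c - ell α β ^ j * homogeneousComponent m c
      ∈ II F v := by
    intro j
    induction j with
    | zero => simp
    | succ j ih =>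
      have h1 := key (m + j + 1)
      rw [hne _ (by omega), hc_mul_ell] at h1
      have h2 := Ideal.mul_mem_right (ell α β) _ ih
      have := add_mem h1 h2
      convert this using 1
      rw [← add_assoc]
      ring
  have hlast := high (c.totalDegree + 1)
  rw [homogeneousComponent_eq_zero _ _ (by omega), zero_sub, neg_mem_iff] at hlast
  have hcm := K.R1pow _ hlast
  have := sub_mem mid hcm
  simpa using this

lemma Cfg.lift (K : Cfg d F α β v) {G : S3} {k : ℕ} (hG : G.IsHomogeneous (k + 1))
    (h : rho α β G ∈ Ideal.span {rho α β F, rho α β (dv v F)}) :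
    ∃ w : S3, w.IsHomogeneous k ∧ G - ell α β * w ∈ II F v := by
  obtain ⟨p, q, hpq⟩ := Ideal.mem_span_pair.1 h
  obtain ⟨w, hw⟩ : ell α β ∣ G - (iot p * F + iot q * dv v F) := by
    apply ell_dvd_of_rho
    rw [map_sub, map_add, map_mul, map_mul, rho_iot, rho_iot, hpq, sub_self]
  refine ⟨homogeneousComponent k w, homogeneousComponent_isHomogeneous _ _, ?_⟩
  have h1 : G - w * ell α β ∈ II F v := by
    have : G - w * ell α β = iot p * F + iot q * dv v F := by linear_combination hw
    rw [this]
    exact Ideal.mem_span_pair.2 ⟨_, _, rfl⟩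
  have h2 := K.II_comp h1 (k + 1)
  rw [map_sub, homogeneousComponent_of_mem hG, if_pos rfl, hc_mul_ell] at h2
  rwa [mul_comm]

lemma ell_mul_homog {w : S3} {k : ℕ} (j : ℕ) (hw : w.IsHomogeneous k) :
    (ell α β ^ j * w).IsHomogeneous (j + k) := by
  have := ((ell_homog α β).pow j).mul hw
  simpa using this

lemma Cfg.red_homog (K : Cfg d F α β v) (k : ℕ) : ∀ {x : S3} (_ : x.IsHomogeneous k),
    ∃ y : S3, y.IsHomogeneous (2 * d - 3) ∧ x - y ∈ KK F α β v := by
  have hd := K.hd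
  induction k with
  | zero =>
    intro x hx
    refine ⟨ell α β ^ (2 * d - 3) * x, ?_, ellpow_sub_mem _ _⟩
    simpa using ell_mul_homog (2 * d - 3) hx
  | succ k ih =>
    intro x hx
    by_cases hk : k + 1 ≤ 2 * d - 3
    · refine ⟨ell α β ^ (2 * d - 3 - (k + 1)) * x, ?_, ellpow_sub_mem _ _⟩
      have := ell_mul_homog (α := α) (β := β) (2 * d - 3 - (k + 1)) hx
      rwa [Nat.sub_add_cancel hk] at this
    · have hr : (rho α β x).IsHomogeneous (d + (d - 1) - 1 + (k + 1 - (2 * d - 2))) := by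
        have := rho_homog (α := α) (β := β) hx
        convert this using 1
        omega
      have := binary_top' (rho_homog K.hF) (rho_homog K.g_homog) K.rF0 K.rg0 K.rel
        (by omega) (by omega) _ hr
      obtain ⟨w, hw, hxw⟩ := K.lift hx this
      obtain ⟨y, hy, hwy⟩ := ih hw
      refine ⟨y, hy, ?_⟩
      have h1 := ellpow_sub_mem (F := F) (α := α) (β := β) (v := v) 1 w
      have h2 := II_le_KK (α := α) (β := β) hxw
      have := sub_mem (add_mem hwy h2) h1
      convert this using 1
      ring

lemma Cfg.red (K : Cfg d F α β v) (x : S3) :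
    ∃ y : S3, y.IsHomogeneous (2 * d - 3) ∧ x - y ∈ KK F α β v := by
  choose! f hf1 hf2 using fun k (y : S3) (hy : y.IsHomogeneous k) => K.red_homog k hy
  refine ⟨∑ k ∈ Finset.range (x.totalDegree + 1), f k (homogeneousComponent k x), ?_, ?_⟩
  · apply IsHomogeneous.sum
    intro k _
    exact hf1 _ _ (homogeneousComponent_isHomogeneous _ _)
  · have h1 : x - ∑ k ∈ Finset.range (x.totalDegree + 1), f k (homogeneousComponent k x) =
        ∑ k ∈ Finset.range (x.totalDegree + 1),
          (homogeneousComponent k x - f k (homogeneousComponent k x)) := by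
      rw [Finset.sum_sub_distrib, sum_homogeneousComponent]
    rw [h1]
    apply sum_mem
    intro k _
    exact hf2 _ _ (homogeneousComponent_isHomogeneous _ _)

end D1
/-! ### Duality -/

section D2
variable {d : ℕ} {F : S3} {α β : ℂ} {v : Fin 3 → ℂ}

/-- `S_k + KK`. -/
def BB (F : S3) (α β : ℂ) (v : Fin 3 → ℂ) (k : ℕ) : Submodule ℂ S3 :=
  homogeneousSubmodule (Fin 3) ℂ k ⊔ (KK F α β v).restrictScalars ℂ

lemma mem_BB {x : S3} {k : ℕ} : x ∈ BB F α β v k ↔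
    ∃ y : S3, y.IsHomogeneous k ∧ x - y ∈ KK F α β v := by
  rw [BB, Submodule.mem_sup]
  constructor
  · rintro ⟨y, hy, z, hz, rfl⟩
    exact ⟨y, hy, by simpa using hz⟩
  · rintro ⟨y, hy, hz⟩
    exact ⟨y, hy, x - y, hz, by ring⟩

lemma Cfg.exists_tau (K : Cfg d F α β v) :
    ∃ τ : S3 →ₗ[ℂ] ℂ, ∀ x, τ x = 0 ↔ x ∈ BB F α β v (2 * d - 4) := by
  have hd := K.hd
  obtain ⟨m₀, hm₀, hm⟩ := binary_codim (rho_homog (α := α) (β := β) K.hF)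
    (rho_homog K.g_homog) K.rF0 K.rg0 K.rel (by omega) (by omega)
  have e1 : d + (d - 1) - 2 = 2 * d - 4 + 1 := by omega
  have e2 : 2 * d - 3 = 2 * d - 4 + 1 := by omega
  rw [e1] at hm₀ hm
  have key : ∀ x : S3, ∃ c : ℂ, x - c • iot m₀ ∈ BB F α β v (2 * d - 4) := by
    intro x
    obtain ⟨y, hy, hxy⟩ := K.red x
    rw [e2] at hy
    obtain ⟨c, hc⟩ := hm _ (rho_homog hy)
    have hG : (y - C c * iot m₀).IsHomogeneous (2 * d - 4 + 1) := by
      refine hy.sub ?_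
      have := (isHomogeneous_C (Fin 3) c).mul (iot_homog hm₀)
      rwa [zero_add] at this
    obtain ⟨w, hw, hGw⟩ := K.lift (α := α) (β := β) hG (by
      rw [map_sub, map_mul, rho_iot]
      convert hc using 3
      simp [rho])
    refine ⟨c, mem_BB.2 ⟨w, hw, ?_⟩⟩
    have h1 := ellpow_sub_mem (F := F) (α := α) (β := β) (v := v) 1 w
    have h2 := II_le_KK (α := α) (β := β) hGw
    have := sub_mem (add_mem hxy h2) h1
    convert this using 1
    rw [smul_eq_C_mul]
    ring
  by_cases h0 : iot m₀ ∈ BB F α β v (2 * d - 4)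
  · refine ⟨0, fun x => ?_⟩
    obtain ⟨c, hc⟩ := key x
    have := add_mem hc (Submodule.smul_mem _ c h0)
    simp only [sub_add_cancel] at this
    simp [this]
  · obtain ⟨τ, hτ, hle⟩ := Submodule.exists_le_ker_of_notMem h0
    refine ⟨τ, fun x => ⟨fun hx => ?_, fun hx => hle hx⟩⟩
    obtain ⟨c, hc⟩ := key x
    have h1 : τ (x - c • iot m₀) = 0 := hle hc
    rw [map_sub, hx, map_smul, zero_sub, neg_eq_zero, smul_eq_mul, mul_eq_zero] at h1
    rcases h1 with h1 | h1
    · simpa [h1] using hc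
    · exact absurd h1 hτ

/-- `τ` is a residue functional. -/
def IsTau (d : ℕ) (F : S3) (α β : ℂ) (v : Fin 3 → ℂ) (τ : S3 →ₗ[ℂ] ℂ) : Prop :=
  ∀ x, τ x = 0 ↔ x ∈ BB F α β v (2 * d - 4)

variable {τ : S3 →ₗ[ℂ] ℂ}

lemma IsTau.KK (ht : IsTau d F α β v τ) {x : S3} (hx : x ∈ KK F α β v) : τ x = 0 :=
  (ht x).2 (mem_BB.2 ⟨0, isHomogeneous_zero _ _ _, by simpa using hx⟩)

lemma IsTau.congr (ht : IsTau d F α β v τ) {x y : S3} (hx : x - y ∈ _root_.KK F α β v) :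
    τ x = τ y := by
  have := ht.KK hx
  rwa [map_sub, sub_eq_zero] at this

lemma IsTau.low (ht : IsTau d F α β v τ) {x : S3} {k : ℕ} (hk : k ≤ 2 * d - 4)
    (hx : x.IsHomogeneous k) : τ x = 0 := by
  refine (ht x).2 (mem_BB.2 ⟨_, ?_, ellpow_sub_mem (2 * d - 4 - k) x⟩)
  have := ell_mul_homog (α := α) (β := β) (2 * d - 4 - k) hx
  rwa [Nat.sub_add_cancel hk] at this

lemma Cfg.dual_rho (K : Cfg d F α β v) (ht : IsTau d F α β v τ) {x y : S3} {k : ℕ}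
    (hk : k ≤ 2 * d - 3) (hy : y.IsHomogeneous k) (hxy : x - y ∈ KK F α β v)
    (h : ∀ z : S3, z.IsHomogeneous (2 * d - 3 - k) → τ (x * z) = 0) :
    rho α β y ∈ Ideal.span {rho α β F, rho α β (dv v F)} := by
  have hd := K.hd
  apply binary_dual (rho_homog K.hF) (rho_homog K.g_homog) K.rF0 K.rg0 K.rel (2 * d - 3 - k)
    (i := k) (by omega) (rho_homog hy)
  intro Q hQ
  have h1 := (ht _).1 (h _ (iot_homog hQ))
  obtain ⟨w, hw, hxw⟩ := mem_BB.1 h1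
  have h2 : y * iot Q - ell α β ^ 1 * w ∈ KK F α β v := by
    have e1 := ellpow_sub_mem (F := F) (α := α) (β := β) (v := v) 1 w
    have e2 := Ideal.mul_mem_right (iot Q) _ hxy
    have := add_mem (sub_mem hxw e2) e1
    convert this using 1
    ring
  have h3 : (y * iot Q - ell α β ^ 1 * w).IsHomogeneous (2 * d - 3) := by
    refine IsHomogeneous.sub ?_ ?_
    · have := hy.mul (iot_homog hQ)
      rwa [Nat.add_sub_cancel' hk] at this
    · have := ell_mul_homog (α := α) (β := β) 1 hw
      have e : 1 + (2 * d - 4) = 2 * d - 3 := by omega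
      rwa [e] at this
  obtain ⟨p, q, hpq⟩ := Ideal.mem_span_pair.1 (K.R2 h3 h2)
  refine Ideal.mem_span_pair.2 ⟨rho α β p, rho α β q, ?_⟩
  have := congrArg (rho α β) hpq
  rw [map_add, map_mul, map_mul, map_sub, map_mul, map_mul, pow_one, rho_ell, rho_iot, zero_mul,
    sub_zero] at this
  rw [this, mul_comm]

lemma Cfg.dual_succ (K : Cfg d F α β v) (ht : IsTau d F α β v τ) {x y : S3} {k : ℕ}
    (hk : k + 1 ≤ 2 * d - 3) (hy : y.IsHomogeneous (k + 1)) (hxy : x - y ∈ KK F α β v)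
    (h : ∀ z : S3, z.IsHomogeneous (2 * d - 3 - (k + 1)) → τ (x * z) = 0) :
    ∃ w : S3, w.IsHomogeneous k ∧ x - w ∈ KK F α β v := by
  obtain ⟨w, hw, hyw⟩ := K.lift hy (K.dual_rho ht hk hy hxy h)
  refine ⟨w, hw, ?_⟩
  have h1 := ellpow_sub_mem (F := F) (α := α) (β := β) (v := v) 1 w
  have h2 := II_le_KK (α := α) (β := β) hyw
  have := sub_mem (add_mem hxy h2) h1
  convert this using 1
  ring

lemma Cfg.dual_zero (K : Cfg d F α β v) (ht : IsTau d F α β v τ) {x y : S3}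
    (hy : y.IsHomogeneous 0) (hxy : x - y ∈ KK F α β v)
    (h : ∀ z : S3, z.IsHomogeneous (2 * d - 3) → τ (x * z) = 0) : x ∈ KK F α β v := by
  have hd := K.hd
  have h1 := K.dual_rho ht (Nat.zero_le _) hy hxy h
  obtain ⟨p, q, hpq, _, _, hp, hq'⟩ := homog_coeffs (rho_homog K.hF) (rho_homog K.g_homog)
    (rho_homog hy) h1
  rw [hp (by omega), hq' (by omega), zero_mul, zero_mul, add_zero] at hpq
  have : y = 0 := eq_zero_of_dvd_of_lt (ell_homog α β) hy (by omega) (ell_dvd_of_rho hpq)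
  simpa [this] using hxy

lemma Cfg.dual_iter (K : Cfg d F α β v) (ht : IsTau d F α β v τ) {x : S3} {j : ℕ}
    (h : ∀ z : S3, z.IsHomogeneous j → τ (x * z) = 0) (i : ℕ) (hij : i ≤ j + 1)
    (hi : i ≤ 2 * d - 3) : ∃ w : S3, w.IsHomogeneous (2 * d - 3 - i) ∧ x - w ∈ KK F α β v := by
  induction i with
  | zero => exact K.red x
  | succ i ih =>
    obtain ⟨y, hy, hxy⟩ := ih (by omega) (by omega)
    have e : 2 * d - 3 - i = 2 * d - 3 - (i + 1) + 1 := by omega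
    rw [e] at hy
    refine K.dual_succ ht (by omega) hy hxy ?_
    intro z hz
    have hz' : (ell α β ^ (j - i) * z).IsHomogeneous j := by
      have := ell_mul_homog (α := α) (β := β) (j - i) hz
      convert this using 1
      omega
    rw [← h _ hz']
    apply ht.congr
    have := Ideal.mul_mem_left _ x
      (ellpow_sub_mem (F := F) (α := α) (β := β) (v := v) (j - i) z)
    convert this using 1
    ring

lemma Cfg.nondeg (K : Cfg d F α β v) (ht : IsTau d F α β v τ) {x : S3}
    (h : ∀ z : S3, τ (x * z) = 0) : x ∈ KK F α β v := by
  obtain ⟨y, hy, hxy⟩ := K.dual_iter ht (j := 2 * d - 3) (fun z _ => h z) (2 * d - 3)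
    (by omega) le_rfl
  rw [Nat.sub_self] at hy
  exact K.dual_zero ht hy hxy (fun z _ => h z)

lemma Cfg.rep_functional (K : Cfg d F α β v) (ht : IsTau d F α β v τ) (φ : S3 →ₗ[ℂ] ℂ)
    (hφ : ∀ x ∈ KK F α β v, φ x = 0) : ∃ y, ∀ x, φ x = τ (y * x) := by
  have key : ∀ φ : S3 →ₗ[ℂ] ℂ, (∀ x ∈ KK F α β v, φ x = 0) →
      ∃ φ' : (S3 ⧸ KK F α β v) →ₗ[ℂ] ℂ, ∀ x, φ' (Ideal.Quotient.mk _ x) = φ x := by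
    intro φ hφ
    refine ⟨(((KK F α β v).restrictScalars ℂ).liftQ φ (fun x hx => hφ x hx)).comp
      (Submodule.Quotient.restrictScalarsEquiv ℂ (KK F α β v)).symm.toLinearMap, fun x => rfl⟩
  obtain ⟨τ', hτ'⟩ := key τ (fun x hx => ht.KK hx)
  obtain ⟨φ', hφ'⟩ := key φ hφ
  have : Module.Finite ℂ (S3 ⧸ KK F α β v) := by
    refine Module.Finite.of_surjective (M := homogeneousSubmodule (Fin 3) ℂ (2 * d - 3))
      ((Ideal.Quotient.mkₐ ℂ (KK F α β v)).toLinearMap.comp (Submodule.subtype _)) ?_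
    intro a
    obtain ⟨x, rfl⟩ := Ideal.Quotient.mk_surjective a
    obtain ⟨y, hy, hxy⟩ := K.red x
    exact ⟨⟨y, hy⟩, (Ideal.Quotient.eq.2 hxy).symm⟩
  let ψ : (S3 ⧸ KK F α β v) →ₗ[ℂ] Module.Dual ℂ (S3 ⧸ KK F α β v) :=
    (LinearMap.mul ℂ (S3 ⧸ KK F α β v)).compr₂ τ'
  have hinj : Function.Injective ψ := by
    rw [← LinearMap.ker_eq_bot, LinearMap.ker_eq_bot']
    intro a ha
    obtain ⟨x, rfl⟩ := Ideal.Quotient.mk_surjective a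
    rw [Ideal.Quotient.eq_zero_iff_mem]
    refine K.nondeg ht fun z => ?_
    have := DFunLike.congr_fun ha (Ideal.Quotient.mk _ z)
    rw [← hτ', map_mul]
    exact this
  have hsurj : Function.Surjective ψ :=
    (LinearMap.injective_iff_surjective_of_finrank_eq_finrank
      (Subspace.dual_finrank_eq (K := ℂ)).symm).1 hinj
  obtain ⟨a, ha⟩ := hsurj φ'
  obtain ⟨y, rfl⟩ := Ideal.Quotient.mk_surjective a
  refine ⟨y, fun x => ?_⟩
  have := DFunLike.congr_fun ha (Ideal.Quotient.mk _ x)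
  rw [← hφ', ← this, ← hτ', map_mul]
  rfl

end D2
/-! ### Local analysis -/

section D3

/-- Maximal ideal of a point. -/
def mx (p : Fin 3 → ℂ) : Ideal S3 := RingHom.ker (eval p)

lemma mem_mx {p : Fin 3 → ℂ} {x : S3} : x ∈ mx p ↔ eval p x = 0 := RingHom.mem_ker

/-- Local coordinates. -/
def uu (p : Fin 3 → ℂ) (i : Fin 3) : S3 := X i - C (p i)

lemma uu_mem (p : Fin 3 → ℂ) (i : Fin 3) : uu p i ∈ mx p := by
  rw [mem_mx]; simp [uu]

lemma sub_eval_mem (p : Fin 3 → ℂ) (G : S3) : G - C (eval p G) ∈ mx p := by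
  rw [mem_mx]; simp

/-- Second order Taylor remainder. -/
def tay2 (p : Fin 3 → ℂ) (G : S3) : S3 := G - C (eval p G) - (C (eval p (pderiv 0 G)) * uu p 0
  + C (eval p (pderiv 1 G)) * uu p 1 + C (eval p (pderiv 2 G)) * uu p 2)

/-- Hessian quadratic form in the local coordinates. -/
def hess2 (p : Fin 3 → ℂ) (G : S3) : S3 :=
  C (eval p (pderiv 0 (pderiv 0 G))) * uu p 0 * uu p 0
  + C (eval p (pderiv 1 (pderiv 1 G))) * uu p 1 * uu p 1
  + C (eval p (pderiv 2 (pderiv 2 G))) * uu p 2 * uu p 2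
  + 2 * C (eval p (pderiv 0 (pderiv 1 G))) * uu p 0 * uu p 1
  + 2 * C (eval p (pderiv 0 (pderiv 2 G))) * uu p 0 * uu p 2
  + 2 * C (eval p (pderiv 1 (pderiv 2 G))) * uu p 1 * uu p 2

lemma tay2_mul (p : Fin 3 → ℂ) (G : S3) (k : Fin 3) :
    tay2 p (G * X k) = C (p k) * tay2 p G + uu p k * (G - C (eval p G)) := by
  unfold tay2
  fin_cases k <;> simp [pderiv_X, uu] <;> ring

lemma tay3_mul (p : Fin 3 → ℂ) (G : S3) (k : Fin 3) :
    2 * tay2 p (G * X k) - hess2 p (G * X k) =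
      C (p k) * (2 * tay2 p G - hess2 p G) + 2 * uu p k * tay2 p G := by
  rw [tay2_mul]
  unfold tay2 hess2
  fin_cases k <;> simp [pderiv_X, uu] <;> ring

lemma tay2_mem (p : Fin 3 → ℂ) (G : S3) : tay2 p G ∈ mx p ^ 2 := by
  induction G using MvPolynomial.induction_on with
  | C a => simp [tay2]
  | add f g hf hg =>
    have : tay2 p (f + g) = tay2 p f + tay2 p g := by
      simp [tay2]; ring
    rw [this]; exact add_mem hf hg
  | mul_X f k hf =>
    rw [tay2_mul]
    refine add_mem (Ideal.mul_mem_left _ _ hf) ?_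
    rw [pow_two]
    exact Ideal.mul_mem_mul (uu_mem _ _) (sub_eval_mem _ _)

lemma tay3_mem (p : Fin 3 → ℂ) (G : S3) : 2 * tay2 p G - hess2 p G ∈ mx p ^ 3 := by
  induction G using MvPolynomial.induction_on with
  | C a => simp [tay2, hess2]
  | add f g hf hg =>
    have : 2 * tay2 p (f + g) - hess2 p (f + g) =
        (2 * tay2 p f - hess2 p f) + (2 * tay2 p g - hess2 p g) := by
      simp [tay2, hess2]; ring
    rw [this]; exact add_mem hf hg
  | mul_X f k hf =>
    rw [tay3_mul]
    refine add_mem (Ideal.mul_mem_left _ _ hf) ?_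
    rw [mul_assoc, pow_succ']
    exact Ideal.mul_mem_left _ _ (Ideal.mul_mem_mul (uu_mem _ _) (tay2_mem _ _))

lemma C_mul_mem {J : Ideal S3} {c : ℂ} (hc : c ≠ 0) {x : S3} (h : C c * x ∈ J) : x ∈ J := by
  have := Ideal.mul_mem_left J (C c⁻¹) h
  rwa [← mul_assoc, ← C_mul, inv_mul_cancel₀ hc, C_1, one_mul] at this

/-- `𝔪` is contained in `J + 𝔪²` as soon as the coordinates are. -/
lemma mx_le_of_uu {p : Fin 3 → ℂ} {J : Ideal S3} (h : ∀ i, uu p i ∈ J ⊔ mx p ^ 2) :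
    mx p ≤ J ⊔ mx p ^ 2 := by
  intro x hx
  have h1 : tay2 p x ∈ J ⊔ mx p ^ 2 := le_sup_right (a := J) (tay2_mem p x)
  have h2 : x = tay2 p x + (C (eval p (pderiv 0 x)) * uu p 0
    + C (eval p (pderiv 1 x)) * uu p 1 + C (eval p (pderiv 2 x)) * uu p 2) := by
    rw [mem_mx] at hx
    simp [tay2, hx]
  rw [h2]
  exact add_mem h1 (add_mem (add_mem (Ideal.mul_mem_left _ _ (h 0)) (Ideal.mul_mem_left _ _ (h 1)))
    (Ideal.mul_mem_left _ _ (h 2)))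

lemma mx2_le_of_uu {p : Fin 3 → ℂ} {J : Ideal S3} (h : ∀ i j, uu p i * uu p j ∈ J ⊔ mx p ^ 3) :
    mx p ^ 2 ≤ J ⊔ mx p ^ 3 := by
  rw [pow_two]
  refine Ideal.mul_le.2 ?_
  intro x hx y hy
  have e : ∀ {z : S3}, z ∈ mx p → z - tay2 p z = (C (eval p (pderiv 0 z)) * uu p 0
    + C (eval p (pderiv 1 z)) * uu p 1 + C (eval p (pderiv 2 z)) * uu p 2) := by
    intro z hz
    rw [mem_mx] at hz
    simp [tay2, hz]
  have hle : mx p ^ 3 ≤ J ⊔ mx p ^ 3 := le_sup_right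
  have hxt : tay2 p x * y ∈ J ⊔ mx p ^ 3 := hle (by
    rw [pow_succ]; exact Ideal.mul_mem_mul (tay2_mem p x) hy)
  have hyt : (x - tay2 p x) * tay2 p y ∈ J ⊔ mx p ^ 3 := hle (by
    rw [pow_succ']
    exact Ideal.mul_mem_mul
      (sub_mem hx (Ideal.pow_le_self (by norm_num) (tay2_mem p x))) (tay2_mem p y))
  have h3 : (x - tay2 p x) * (y - tay2 p y) ∈ J ⊔ mx p ^ 3 := by
    rw [e hx, e hy]
    have : ∀ a b (i j : Fin 3), a * uu p i * (b * uu p j) ∈ J ⊔ mx p ^ 3 := by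
      intro a b i j
      have := Ideal.mul_mem_left _ (a * b) (h i j)
      convert this using 1
      ring
    simp only [mul_add, add_mul]
    refine add_mem (add_mem (add_mem (add_mem ?_ ?_) ?_) (add_mem (add_mem ?_ ?_) ?_))
      (add_mem (add_mem ?_ ?_) ?_) <;> exact this _ _ _ _
  have := add_mem (add_mem hxt hyt) h3
  convert this using 1
  ring

end D3
section D4
variable {d : ℕ} {F : S3} {α β : ℂ} {v : Fin 3 → ℂ}

/-- Linear form in the local coordinates. -/
def lin (p c : Fin 3 → ℂ) : S3 := C (c 0) * uu p 0 + C (c 1) * uu p 1 + C (c 2) * uu p 2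

lemma lin_cramer (p a b c : Fin 3 → ℂ) (i : Fin 3) :
    C (a 0 * (b 1 * c 2 - b 2 * c 1) + a 1 * (b 2 * c 0 - b 0 * c 2)
      + a 2 * (b 0 * c 1 - b 1 * c 0)) * uu p i =
    C ((![b 1 * c 2 - b 2 * c 1, b 2 * c 0 - b 0 * c 2, b 0 * c 1 - b 1 * c 0] : Fin 3 → ℂ) i)
      * lin p a
    + C ((![c 1 * a 2 - c 2 * a 1, c 2 * a 0 - c 0 * a 2, c 0 * a 1 - c 1 * a 0] : Fin 3 → ℂ) i)
      * lin p b
    + C ((![a 1 * b 2 - a 2 * b 1, a 2 * b 0 - a 0 * b 2, a 0 * b 1 - a 1 * b 0] : Fin 3 → ℂ) i)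
      * lin p c := by
  unfold lin
  fin_cases i <;> simp <;> ring

lemma tay2_eq {p : Fin 3 → ℂ} {G : S3} (h : eval p G = 0) (c : Fin 3 → ℂ)
    (hc : ∀ i, eval p (pderiv i G) = c i) : lin p c = G - tay2 p G := by
  simp [tay2, lin, h, hc]

/-- The covector of the line at infinity. -/
def lc (α β : ℂ) : Fin 3 → ℂ := ![-α, -β, 1]

lemma lin_lc {p : Fin 3 → ℂ} (h : eval p (ell α β) = 1) : lin p (lc α β) = ell α β - 1 := by
  rw [eval_ell] at h
  have : (1 : S3) = C (p 2 - α * p 0 - β * p 1) := by rw [h]; simp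
  rw [this]
  simp [lin, lc, uu, ell]
  ring

/-- Affine representatives of the singular points. -/
def Da (F : S3) (α β : ℂ) : Set (Fin 3 → ℂ) :=
  {x | eval x (ell α β) = 1 ∧ ∀ i, eval x (pderiv i F) = 0}

/-- Affine representatives of the residual points. -/
def Ra (F : S3) (α β : ℂ) (v : Fin 3 → ℂ) : Set (Fin 3 → ℂ) :=
  {x | eval x (ell α β) = 1 ∧ eval x F = 0 ∧ eval x (dv v F) = 0 ∧
    ¬ ∀ i, eval x (pderiv i F) = 0}

lemma ne_zero_of_ell {x : Fin 3 → ℂ} (h : eval x (ell α β) = 1) : x ≠ 0 := by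
  rintro rfl
  rw [eval_ell] at h
  simp at h

lemma euler_eval {G : S3} {m : ℕ} (hG : G.IsHomogeneous m) (x : Fin 3 → ℂ) :
    x 0 * eval x (pderiv 0 G) + x 1 * eval x (pderiv 1 G) + x 2 * eval x (pderiv 2 G)
      = m * eval x G := by
  have := congrArg (eval x) (euler0 hG)
  simpa using this

lemma Cfg.F_Da (K : Cfg d F α β v) {p : Fin 3 → ℂ} (hp : p ∈ Da F α β) : eval p F = 0 := by
  have h := euler_eval K.hF p
  rw [hp.2, hp.2, hp.2] at h
  have hd : (d : ℂ) ≠ 0 := by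
    have := K.hd
    exact_mod_cast (by omega : d ≠ 0)
  have : (d : ℂ) * eval p F = 0 := by rw [← h]; ring
  exact (mul_eq_zero.1 this).resolve_left hd

lemma g_Da {p : Fin 3 → ℂ} (hp : p ∈ Da F α β) : eval p (dv v F) = 0 := by
  rw [eval_dv, hp.2, hp.2, hp.2]; ring

lemma la_ra {l f γ r v : Fin 3 → ℂ} (hf : ¬ ∀ i, f i = 0)
    (fr : r 0 * f 0 + r 1 * f 1 + r 2 * f 2 = 0) (fv : v 0 * f 0 + v 1 * f 1 + v 2 * f 2 = 0)
    (gr : r 0 * γ 0 + r 1 * γ 1 + r 2 * γ 2 = 0) (gv : v 0 * γ 0 + v 1 * γ 1 + v 2 * γ 2 ≠ 0)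
    (lr : l 0 * r 0 + l 1 * r 1 + l 2 * r 2 = 1) :
    l 0 * (f 1 * γ 2 - f 2 * γ 1) + l 1 * (f 2 * γ 0 - f 0 * γ 2)
      + l 2 * (f 0 * γ 1 - f 1 * γ 0) ≠ 0 := by
  have hm : (![r 1 * v 2 - r 2 * v 1, r 2 * v 0 - r 0 * v 2, r 0 * v 1 - r 1 * v 0] : Fin 3 → ℂ)
      ≠ 0 := by
    intro h
    have e0 := congrFun h 0
    have e1 := congrFun h 1
    have e2 := congrFun h 2
    simp at e0 e1 e2
    apply gv
    have : (v 0 * γ 0 + v 1 * γ 1 + v 2 * γ 2) * (l 0 * r 0 + l 1 * r 1 + l 2 * r 2) = 0 := by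
      linear_combination (l 0 * v 0 + l 1 * v 1 + l 2 * v 2) * gr
        + (l 1 * γ 2 - l 2 * γ 1) * e0 + (l 2 * γ 0 - l 0 * γ 2) * e1
        + (l 0 * γ 1 - l 1 * γ 0) * e2
    rwa [lr, mul_one] at this
  obtain ⟨t, ht⟩ := par_of_cross (a := f) hm
    (by simp; linear_combination r 0 * fv - v 0 * fr)
    (by simp; linear_combination r 1 * fv - v 1 * fr)
    (by simp; linear_combination r 2 * fv - v 2 * fr)
  have ht0 : t ≠ 0 := by
    rintro rfl
    exact hf (fun i => by rw [ht i, zero_mul])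
  have e0 := ht 0
  have e1 := ht 1
  have e2 := ht 2
  simp at e0 e1 e2
  have : l 0 * (f 1 * γ 2 - f 2 * γ 1) + l 1 * (f 2 * γ 0 - f 0 * γ 2)
      + l 2 * (f 0 * γ 1 - f 1 * γ 0) = - t * (v 0 * γ 0 + v 1 * γ 1 + v 2 * γ 2) := by
    rw [e0, e1, e2]
    linear_combination t * (l 0 * v 0 + l 1 * v 1 + l 2 * v 2) * gr
      - t * (v 0 * γ 0 + v 1 * γ 1 + v 2 * γ 2) * lr
  rw [this]
  exact mul_ne_zero (neg_ne_zero.2 ht0) gv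

lemma la_da {l h p v : Fin 3 → ℂ} {H : Fin 3 → Fin 3 → ℂ} (hs : ∀ i j, H i j = H j i)
    (hh : ∀ i, h i = H i 0 * v 0 + H i 1 * v 1 + H i 2 * v 2)
    (hp : ∀ i, H i 0 * p 0 + H i 1 * p 1 + H i 2 * p 2 = 0)
    (lp : l 0 * p 0 + l 1 * p 1 + l 2 * p 2 = 1)
    (hv : h 0 * v 0 + h 1 * v 1 + h 2 * v 2 ≠ 0)
    (ker : ∀ w : Fin 3 → ℂ, (∀ i, H i 0 * w 0 + H i 1 * w 1 + H i 2 * w 2 = 0) →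
      ∃ c : ℂ, w = c • p) {m : Fin 3 → ℂ} (m0 : m 0 = l 1 * h 2 - l 2 * h 1)
    (m1 : m 1 = l 2 * h 0 - l 0 * h 2) (m2 : m 2 = l 0 * h 1 - l 1 * h 0) :
    m 0 * (H 0 0 * m 0 + H 0 1 * m 1 + H 0 2 * m 2)
      + m 1 * (H 1 0 * m 0 + H 1 1 * m 1 + H 1 2 * m 2)
      + m 2 * (H 2 0 * m 0 + H 2 1 * m 1 + H 2 2 * m 2) ≠ 0 := by
  intro hq
  set w : Fin 3 → ℂ := fun i => H i 0 * m 0 + H i 1 * m 1 + H i 2 * m 2 with hw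
  have wi : ∀ i, w i = H i 0 * m 0 + H i 1 * m 1 + H i 2 * m 2 := fun i => rfl
  have hph : p 0 * h 0 + p 1 * h 1 + p 2 * h 2 = 0 := by
    rw [hh 0, hh 1, hh 2, hs 1 0, hs 2 0, hs 2 1]
    have a0 := hp 0
    have a1 := hp 1
    have a2 := hp 2
    rw [hs 1 0] at a1
    rw [hs 2 0, hs 2 1] at a2
    linear_combination v 0 * a0 + v 1 * a1 + v 2 * a2
  have wm : m 0 * w 0 + m 1 * w 1 + m 2 * w 2 = 0 := hq
  have wp : p 0 * w 0 + p 1 * w 1 + p 2 * w 2 = 0 := by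
    have a0 := hp 0
    have a1 := hp 1
    have a2 := hp 2
    rw [wi 0, wi 1, wi 2, hs 1 0, hs 2 0, hs 2 1]
    rw [hs 1 0] at a1
    rw [hs 2 0, hs 2 1] at a2
    linear_combination m 0 * a0 + m 1 * a1 + m 2 * a2
  have wv : v 0 * w 0 + v 1 * w 1 + v 2 * w 2 = 0 := by
    have : v 0 * w 0 + v 1 * w 1 + v 2 * w 2 = m 0 * h 0 + m 1 * h 1 + m 2 * h 2 := by
      rw [wi 0, wi 1, wi 2, hh 0, hh 1, hh 2, hs 1 0, hs 2 0, hs 2 1]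
      ring
    rw [this, m0, m1, m2]
    ring
  have det : m 0 * (p 1 * v 2 - p 2 * v 1) + m 1 * (p 2 * v 0 - p 0 * v 2)
      + m 2 * (p 0 * v 1 - p 1 * v 0) = h 0 * v 0 + h 1 * v 1 + h 2 * v 2 := by
    rw [m0, m1, m2]
    linear_combination (h 0 * v 0 + h 1 * v 1 + h 2 * v 2) * lp
      - (l 0 * v 0 + l 1 * v 1 + l 2 * v 2) * hph
  have w0 : w 0 = 0 := by
    have : (h 0 * v 0 + h 1 * v 1 + h 2 * v 2) * w 0 = 0 := by
      rw [← det]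
      linear_combination (p 1 * v 2 - p 2 * v 1) * wm + (v 1 * m 2 - v 2 * m 1) * wp
        + (m 1 * p 2 - m 2 * p 1) * wv
    exact (mul_eq_zero.1 this).resolve_left hv
  have w1 : w 1 = 0 := by
    have : (h 0 * v 0 + h 1 * v 1 + h 2 * v 2) * w 1 = 0 := by
      rw [← det]
      linear_combination (p 2 * v 0 - p 0 * v 2) * wm + (v 2 * m 0 - v 0 * m 2) * wp
        + (m 2 * p 0 - m 0 * p 2) * wv
    exact (mul_eq_zero.1 this).resolve_left hv
  have w2 : w 2 = 0 := by
    have : (h 0 * v 0 + h 1 * v 1 + h 2 * v 2) * w 2 = 0 := by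
      rw [← det]
      linear_combination (p 0 * v 1 - p 1 * v 0) * wm + (v 0 * m 1 - v 1 * m 0) * wp
        + (m 0 * p 1 - m 1 * p 0) * wv
    exact (mul_eq_zero.1 this).resolve_left hv
  obtain ⟨c, hc⟩ := ker m (by
    intro i
    fin_cases i
    · exact w0
    · exact w1
    · exact w2)
  have c0 := congrFun hc 0
  have c1 := congrFun hc 1
  have c2 := congrFun hc 2
  simp only [Pi.smul_apply, smul_eq_mul] at c0 c1 c2
  have hc0 : c = 0 := by
    have : l 0 * m 0 + l 1 * m 1 + l 2 * m 2 = 0 := by rw [m0, m1, m2]; ring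
    rw [c0, c1, c2] at this
    linear_combination this - c * lp
  apply hv
  rw [← det, c0, c1, c2, hc0]
  ring

end D4
section D5
variable {d : ℕ} {F : S3} {α β : ℂ} {v : Fin 3 → ℂ}

lemma dvdv_eq (p : Fin 3 → ℂ) : eval p (dv v (dv v F)) =
    eval p (pderiv 0 (dv v F)) * v 0 + eval p (pderiv 1 (dv v F)) * v 1
      + eval p (pderiv 2 (dv v F)) * v 2 := by
  rw [eval_dv]; ring

lemma lc_dot (x : Fin 3 → ℂ) : lc α β 0 * x 0 + lc α β 1 * x 1 + lc α β 2 * x 2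
    = eval x (ell α β) := by
  rw [eval_ell]; simp [lc]; ring

lemma Cfg.loc_Ra (K : Cfg d F α β v) {r : Fin 3 → ℂ} (hr : r ∈ Ra F α β v) :
    mx r ≤ KK F α β v ⊔ mx r ^ 2 := by
  obtain ⟨hl, hF, hg, hs⟩ := hr
  apply mx_le_of_uu
  intro i
  have hdet := la_ra (l := lc α β) (f := fun i => eval r (pderiv i F))
    (γ := fun i => eval r (pderiv i (dv v F))) (r := r) (v := v) hs
    (by have := euler_eval K.hF r; rw [hF, mul_zero] at this; exact this)
    (by rw [← hg, eval_dv])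
    (by have := euler_eval K.g_homog r; rw [hg, mul_zero] at this; exact this)
    (by
      have := K.h2 r (ne_zero_of_ell hl) hF hg
      rwa [eval_dv] at this)
    (by rw [lc_dot, hl])
  apply C_mul_mem hdet
  have hcr := lin_cramer r (lc α β) (fun i => eval r (pderiv i F))
    (fun i => eval r (pderiv i (dv v F))) i
  beta_reduce at hcr
  rw [hcr]
  have hKK : ∀ x ∈ KK F α β v, x ∈ KK F α β v ⊔ mx r ^ 2 := fun x hx => le_sup_left
    (b := mx r ^ 2) hx
  have hmm : ∀ x ∈ mx r ^ 2, x ∈ KK F α β v ⊔ mx r ^ 2 := fun x hx => le_sup_right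
    (a := KK F α β v) hx
  refine add_mem (add_mem ?_ ?_) ?_
  · refine Ideal.mul_mem_left _ _ (hKK _ ?_)
    rw [lin_lc hl]
    exact ell_sub_mem
  · refine Ideal.mul_mem_left _ _ ?_
    rw [tay2_eq hF _ (fun i => rfl)]
    exact sub_mem (hKK _ (II_le_KK F_mem_II)) (hmm _ (tay2_mem _ _))
  · refine Ideal.mul_mem_left _ _ ?_
    rw [tay2_eq hg _ (fun i => rfl)]
    exact sub_mem (hKK _ (II_le_KK g_mem_II)) (hmm _ (tay2_mem _ _))

/-- The tangent direction used at a node: the cross product of the line at infinity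
with the polar covector. -/
def mdir (F : S3) (α β : ℂ) (v p : Fin 3 → ℂ) : Fin 3 → ℂ :=
  ![lc α β 1 * eval p (pderiv 2 (dv v F)) - lc α β 2 * eval p (pderiv 1 (dv v F)),
    lc α β 2 * eval p (pderiv 0 (dv v F)) - lc α β 0 * eval p (pderiv 2 (dv v F)),
    lc α β 0 * eval p (pderiv 1 (dv v F)) - lc α β 1 * eval p (pderiv 0 (dv v F))]

lemma Cfg.mdir_hess (K : Cfg d F α β v) {p : Fin 3 → ℂ} (hp : p ∈ Da F α β) :
    ∃ q : ℂ, q ≠ 0 ∧ ∀ m, m = mdir F α β v p → q =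
    m 0 * (eval p (pderiv 0 (pderiv 0 F)) * m 0 + eval p (pderiv 0 (pderiv 1 F)) * m 1
        + eval p (pderiv 0 (pderiv 2 F)) * m 2)
      + m 1 * (eval p (pderiv 1 (pderiv 0 F)) * m 0 + eval p (pderiv 1 (pderiv 1 F)) * m 1
        + eval p (pderiv 1 (pderiv 2 F)) * m 2)
      + m 2 * (eval p (pderiv 2 (pderiv 0 F)) * m 0 + eval p (pderiv 2 (pderiv 1 F)) * m 1
        + eval p (pderiv 2 (pderiv 2 F)) * m 2) := by
  refine ⟨_, la_da (l := lc α β) (h := fun i => eval p (pderiv i (dv v F))) (p := p) (v := v)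
    (H := fun i j => eval p (pderiv i (pderiv j F))) (m := mdir F α β v p)
    (fun i j => by rw [pd_comm i j]) ?_ ?_ ?_ ?_ ?_ rfl rfl rfl, ?_⟩
  · intro i
    simp only [pd_dv, map_add, map_mul, eval_C]
    ring
  · intro i
    have := congrArg (eval p) (euler1 K.hF i)
    simp only [map_add, map_mul, eval_X, hp.2 i, mul_zero] at this
    linear_combination this
  · rw [lc_dot, hp.1]
  · have := K.h2 p (ne_zero_of_ell hp.1) (K.F_Da hp) (g_Da hp)
    rwa [dvdv_eq] at this
  · intro w hw
    refine K.ker p (ne_zero_of_ell hp.1) hp.2 w ?_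
    intro i
    rw [Fin.sum_univ_three]
    exact hw i
  · rintro m rfl
    rfl

lemma Cfg.mdir_ne (K : Cfg d F α β v) {p : Fin 3 → ℂ} (hp : p ∈ Da F α β) :
    ∃ k, mdir F α β v p k ≠ 0 := by
  obtain ⟨q, hq, hm⟩ := K.mdir_hess hp
  by_contra! h
  apply hq
  rw [hm _ rfl, h 0, h 1, h 2]
  ring

lemma Cfg.loc_Da (K : Cfg d F α β v) {p : Fin 3 → ℂ} (hp : p ∈ Da F α β) :
    mx p ^ 2 ≤ KK F α β v ⊔ mx p ^ 3 := by
  obtain ⟨q, hq, hm⟩ := K.mdir_hess hp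
  obtain ⟨k, hk⟩ := K.mdir_ne hp
  set J := KK F α β v ⊔ mx p ^ 3 with hJ
  have hKK : ∀ x ∈ KK F α β v, x ∈ J := fun x hx => le_sup_left
    (b := mx p ^ 3) hx
  have hmm : ∀ x ∈ mx p ^ 3, x ∈ J := fun x hx => le_sup_right
    (a := KK F α β v) hx
  apply mx2_le_of_uu
  set m := mdir F α β v p with hmdef
  have hm' := hm m rfl
  set n : Fin 3 → ℂ := Pi.single k (m k)⁻¹ with hn
  have hdet : n 0 * m 0 + n 1 * m 1 + n 2 * m 2 = 1 := by
    rw [hn]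
    fin_cases k <;> simp at hk ⊢ <;> field_simp
  set h : Fin 3 → ℂ := fun i => eval p (pderiv i (dv v F)) with hh
  have hA : lin p (lc α β) ∈ J := by
    rw [lin_lc hp.1]
    exact hKK _ ell_sub_mem
  have hB : ∀ y ∈ mx p, lin p h * y ∈ J := by
    intro y hy
    rw [tay2_eq (g_Da hp) h (fun i => rfl), sub_mul]
    refine sub_mem (hKK _ (Ideal.mul_mem_right _ _ (II_le_KK g_mem_II))) (hmm _ ?_)
    rw [pow_succ]
    exact Ideal.mul_mem_mul (tay2_mem _ _) hy
  have hW : ∀ i, ∃ a b : S3, uu p i = a * lin p (lc α β) + b * lin p h + C (m i) * lin p n := by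
    intro i
    have := lin_cramer p (lc α β) h n i
    have e : lc α β 0 * (h 1 * n 2 - h 2 * n 1) + lc α β 1 * (h 2 * n 0 - h 0 * n 2)
        + lc α β 2 * (h 0 * n 1 - h 1 * n 0) = 1 := by
      rw [← hdet]
      simp only [hmdef, mdir, Matrix.cons_val_zero, Matrix.cons_val_one, Matrix.cons_val]
      ring
    rw [e, C_1, one_mul] at this
    exact ⟨_, _, this⟩
  have hnm : lin p n ∈ mx p := by
    unfold lin
    exact add_mem (add_mem (Ideal.mul_mem_left _ _ (uu_mem _ _))
      (Ideal.mul_mem_left _ _ (uu_mem _ _))) (Ideal.mul_mem_left _ _ (uu_mem _ _))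
  have hWy : ∀ i, ∀ y ∈ mx p, (uu p i - C (m i) * lin p n) * y ∈ J := by
    intro i y hy
    obtain ⟨a, b, hab⟩ := hW i
    have : (uu p i - C (m i) * lin p n) * y = a * y * lin p (lc α β) + b * (lin p h * y) := by
      rw [hab]; ring
    rw [this]
    exact add_mem (Ideal.mul_mem_left _ _ hA) (Ideal.mul_mem_left _ _ (hB y hy))
  have hij : ∀ i j, uu p i * uu p j - C (m i) * C (m j) * lin p n ^ 2 ∈ J := by
    intro i j
    have := add_mem (hWy i _ (uu_mem p j)) (Ideal.mul_mem_left _ (C (m i)) (hWy j _ hnm))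
    convert this using 1
    ring
  have hhess : hess2 p F ∈ J := by
    have h1 := hmm _ (tay3_mem p F)
    have h2 : tay2 p F = F := by simp [tay2, K.F_Da hp, hp.2]
    rw [h2] at h1
    have h3 := hKK _ (Ideal.mul_mem_left _ 2 (II_le_KK (F_mem_II (F := F) (v := v))))
    have := sub_mem h3 h1
    convert this using 1
    ring
  have hCC : C q * lin p n ^ 2 ∈ J := by
    have : C q * lin p n ^ 2 = hess2 p F
      - (C (eval p (pderiv 0 (pderiv 0 F))) * (uu p 0 * uu p 0 - C (m 0) * C (m 0) * lin p n ^ 2)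
      + C (eval p (pderiv 1 (pderiv 1 F))) * (uu p 1 * uu p 1 - C (m 1) * C (m 1) * lin p n ^ 2)
      + C (eval p (pderiv 2 (pderiv 2 F))) * (uu p 2 * uu p 2 - C (m 2) * C (m 2) * lin p n ^ 2)
      + 2 * C (eval p (pderiv 0 (pderiv 1 F))) *
        (uu p 0 * uu p 1 - C (m 0) * C (m 1) * lin p n ^ 2)
      + 2 * C (eval p (pderiv 0 (pderiv 2 F))) *
        (uu p 0 * uu p 2 - C (m 0) * C (m 2) * lin p n ^ 2)
      + 2 * C (eval p (pderiv 1 (pderiv 2 F))) *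
        (uu p 1 * uu p 2 - C (m 1) * C (m 2) * lin p n ^ 2)) := by
      rw [hm', pd_comm 1 0 F, pd_comm 2 0 F, pd_comm 2 1 F]
      simp only [hess2, map_add, map_mul]
      ring
    rw [this]
    refine sub_mem hhess ?_
    exact add_mem (add_mem (add_mem (add_mem (add_mem (Ideal.mul_mem_left _ _ (hij _ _))
      (Ideal.mul_mem_left _ _ (hij _ _))) (Ideal.mul_mem_left _ _ (hij _ _)))
      (Ideal.mul_mem_left _ _ (hij _ _))) (Ideal.mul_mem_left _ _ (hij _ _)))
      (Ideal.mul_mem_left _ _ (hij _ _))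
  have hC := C_mul_mem hq hCC
  intro i j
  have := add_mem (hij i j) (Ideal.mul_mem_left _ (C (m i) * C (m j)) hC)
  convert this using 1
  ring

lemma loc_of_nak {J : Ideal S3} {p : Fin 3 → ℂ} {n : ℕ} (h : mx p ^ n ≤ J ⊔ mx p ^ (n + 1))
    {x : S3} (hx : x ∈ mx p ^ n) : ∃ g, eval p g ≠ 0 ∧ g * x ∈ J := by
  obtain ⟨s, hs, hle⟩ := Submodule.exists_sub_one_mem_and_smul_le_of_fg_of_le_sup
    (I := mx p) (N := J) (N' := mx p ^ n) (P := mx p ^ n)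
    (IsNoetherian.noetherian _) le_rfl (by rw [smul_eq_mul, ← pow_succ']; exact h)
  refine ⟨s, ?_, ?_⟩
  · rw [mem_mx, map_sub, map_one, sub_eq_zero] at hs
    rw [hs]; exact one_ne_zero
  · exact hle (Submodule.smul_mem_pointwise_smul x s _ hx)

lemma Cfg.L1 (K : Cfg d F α β v) {x : S3} (h1 : ∀ p ∈ Da F α β, x ∈ mx p ^ 2)
    (h2 : ∀ r ∈ Ra F α β v, eval r x = 0) : x ∈ KK F α β v := by
  apply local_global
  intro q
  by_cases c1 : eval q (ell α β) = 1
  · by_cases c2 : eval q F = 0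
    · by_cases c3 : eval q (dv v F) = 0
      · by_cases c4 : ∀ i, eval q (pderiv i F) = 0
        · exact loc_of_nak (K.loc_Da ⟨c1, c4⟩) (h1 q ⟨c1, c4⟩)
        · have hr : q ∈ Ra F α β v := ⟨c1, c2, c3, c4⟩
          refine loc_of_nak (n := 1) ?_ (x := x) ?_
          · simpa using K.loc_Ra hr
          · simpa [mem_mx] using h2 q hr
      · exact ⟨_, c3, Ideal.mul_mem_right _ _ (II_le_KK g_mem_II)⟩
    · exact ⟨_, c2, Ideal.mul_mem_right _ _ (II_le_KK F_mem_II)⟩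
  · refine ⟨ell α β - 1, ?_, Ideal.mul_mem_right _ _ ell_sub_mem⟩
    rw [map_sub, map_one]
    exact sub_ne_zero.2 c1

end D5
section D6
variable {d : ℕ} {F : S3} {α β : ℂ} {v : Fin 3 → ℂ}

/-- All affine intersection points. -/
def Za (F : S3) (α β : ℂ) (v : Fin 3 → ℂ) : Set (Fin 3 → ℂ) :=
  {x | eval x (ell α β) = 1 ∧ eval x F = 0 ∧ eval x (dv v F) = 0}

lemma Cfg.Da_sub (K : Cfg d F α β v) : Da F α β ⊆ Za F α β v :=
  fun _ hp => ⟨hp.1, K.F_Da hp, g_Da hp⟩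

lemma Ra_sub : Ra F α β v ⊆ Za F α β v := fun _ hp => ⟨hp.1, hp.2.1, hp.2.2.1⟩

lemma Da_Ra_ne {p r : Fin 3 → ℂ} (hp : p ∈ Da F α β) (hr : r ∈ Ra F α β v) : p ≠ r := by
  rintro rfl
  exact hr.2.2.2 hp.2

lemma Za_cases {q : Fin 3 → ℂ} (hq : q ∈ Za F α β v) : q ∈ Da F α β ∨ q ∈ Ra F α β v := by
  by_cases h : ∀ i, eval q (pderiv i F) = 0
  · exact Or.inl ⟨hq.1, h⟩
  · exact Or.inr ⟨hq.1, hq.2.1, hq.2.2, h⟩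

lemma KK_eval {x : S3} (hx : x ∈ KK F α β v) {q : Fin 3 → ℂ} (hq : q ∈ Za F α β v) :
    eval q x = 0 := by
  obtain ⟨c, hc⟩ := mem_KK.1 hx
  obtain ⟨a, b, hab⟩ := Ideal.mem_span_pair.1 hc
  have := congrArg (eval q) hab
  simp only [map_add, map_mul, map_sub, map_one, hq.1, hq.2.1, hq.2.2] at this
  linear_combination - this

lemma KK_deriv {x : S3} (hx : x ∈ KK F α β v) {p : Fin 3 → ℂ} (hp : p ∈ Da F α β)
    (hF : eval p F = 0) :
    mdir F α β v p 0 * eval p (pderiv 0 x) + mdir F α β v p 1 * eval p (pderiv 1 x)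
      + mdir F α β v p 2 * eval p (pderiv 2 x) = 0 := by
  obtain ⟨c, hc⟩ := mem_KK.1 hx
  obtain ⟨a, b, hab⟩ := Ideal.mem_span_pair.1 hc
  have hx' : x = a * F + b * dv v F + c * (ell α β - 1) := by linear_combination - hab
  have e : ∀ i, eval p (pderiv i x) = eval p b * eval p (pderiv i (dv v F))
      + eval p c * eval p (pderiv i (ell α β)) := by
    intro i
    rw [hx']
    simp only [map_add, Derivation.leibniz, map_sub, Derivation.map_one_eq_zero, smul_eq_mul,
      map_mul, hp.2 i, hF, g_Da hp, hp.1, map_one, map_zero]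
    ring
  have l0 : eval p (pderiv 0 (ell α β)) = lc α β 0 := by
    simp [ell, lc, pderiv_X]
  have l1 : eval p (pderiv 1 (ell α β)) = lc α β 1 := by
    simp [ell, lc, pderiv_X]
  have l2 : eval p (pderiv 2 (ell α β)) = lc α β 2 := by
    simp [ell, lc, pderiv_X]
  rw [e 0, e 1, e 2, l0, l1, l2]
  simp only [mdir, Matrix.cons_val_zero, Matrix.cons_val_one, Matrix.cons_val]
  ring

lemma Cfg.not_dvd (K : Cfg d F α β v) {m : ℕ} (hm : m < d) {x : S3} (hx : x.IsHomogeneous m)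
    (h : F ∣ x) : x = 0 := eq_zero_of_dvd_of_lt K.hF hx hm h

lemma Cfg.Za_finite (K : Cfg d F α β v) : (Za F α β v).Finite := by
  have hd := K.hd
  have h1 := weak_bezout K.hF K.g_homog K.irr
    (fun h => K.g0 (K.not_dvd (by omega) K.g_homog h))
  classical
  let f : (Fin 3 → ℂ) → P2 := fun x => if hx : x ≠ 0 then Projectivization.mk ℂ x hx
    else Projectivization.mk ℂ ![1, 0, 0] (by simp)
  have hf : ∀ x, x ≠ 0 → ∃ c : ℂ, c ≠ 0 ∧ (f x).rep = c • x := by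
    intro x hx
    obtain ⟨a, ha⟩ := Projectivization.exists_smul_eq_mk_rep ℂ x hx
    refine ⟨a, Units.ne_zero _, ?_⟩
    simp only [f, hx, ne_eq, not_false_eq_true, dite_true]
    exact ha.symm
  refine Set.Finite.of_injOn (f := f) (t := zeroSet F (dv v F)) ?_ ?_ h1
  · intro x hx
    obtain ⟨c, hc, e⟩ := hf x (ne_zero_of_ell hx.1)
    constructor
    · show eval (f x).rep F = 0
      rw [e, homog_zero_smul K.hF hc]
      exact hx.2.1
    · show eval (f x).rep (dv v F) = 0
      rw [e, homog_zero_smul K.g_homog hc]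
      exact hx.2.2
  · intro x hx y hy hxy
    obtain ⟨c, hc, e⟩ := hf x (ne_zero_of_ell hx.1)
    obtain ⟨c', hc', e'⟩ := hf y (ne_zero_of_ell hy.1)
    have e2 : c • x = c' • y := by rw [← e, ← e', hxy]
    have e3 := congrArg (fun z => eval z (ell α β)) e2
    simp only [eval_smul_homog (ell_homog α β), hx.1, hy.1] at e3
    have e4 : c = c' := by simpa using e3
    rw [e4] at e2
    exact smul_right_injective _ hc' e2

lemma interp_finset (s : Finset (Fin 3 → ℂ)) (q : Fin 3 → ℂ) (hq : q ∉ s) :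
    ∃ e : S3, eval q e = 1 ∧ ∀ z ∈ s, eval z e = 0 := by
  classical
  induction s using Finset.induction_on with
  | empty => exact ⟨1, by simp, by simp⟩
  | insert a s ha ih =>
    obtain ⟨e, he1, he2⟩ := ih (fun h => hq (Finset.mem_insert_of_mem h))
    have hqa : q ≠ a := fun h => hq (h ▸ Finset.mem_insert_self _ _)
    obtain ⟨i, hi⟩ := Function.ne_iff.1 hqa
    refine ⟨e * (C (q i - a i)⁻¹ * (X i - C (a i))), ?_, ?_⟩
    · have : q i - a i ≠ 0 := sub_ne_zero.2 hi
      simp only [map_mul, map_sub, eval_C, eval_X, he1, one_mul]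
      exact inv_mul_cancel₀ this
    · intro z hz
      rcases Finset.mem_insert.1 hz with rfl | hz
      · simp
      · rw [map_mul, he2 z hz, zero_mul]

lemma Cfg.interp (K : Cfg d F α β v) (q : Fin 3 → ℂ) :
    ∃ e : S3, eval q e = 1 ∧ ∀ z ∈ Za F α β v, z ≠ q → e ∈ mx z ^ 2 := by
  obtain ⟨e, h1, h2⟩ := interp_finset (K.Za_finite.toFinset.erase q) q (Finset.notMem_erase _ _)
  refine ⟨e ^ 2, by simp [h1], fun z hz hzq => ?_⟩
  apply Ideal.pow_mem_pow
  rw [mem_mx]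
  exact h2 z (by simp [hz, hzq])

lemma mx2_eval {p : Fin 3 → ℂ} {x : S3} (h : x ∈ mx p ^ 2) : eval p x = 0 :=
  mem_mx.1 (Ideal.pow_le_self (by norm_num) h)

lemma mx2_pd {p : Fin 3 → ℂ} {x : S3} (h : x ∈ mx p ^ 2) (i : Fin 3) :
    eval p (pderiv i x) = 0 := by
  rw [pow_two] at h
  refine Submodule.mul_induction_on h ?_ ?_
  · intro a ha b hb
    rw [mem_mx] at ha hb
    simp [Derivation.leibniz, ha, hb]
  · intro a b ha hb
    rw [map_add, map_add, ha, hb, add_zero]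

lemma Cfg.FN_step (K : Cfg d F α β v) {N G : S3} (hN : N.IsHomogeneous (d - 1))
    (hND : ∀ p ∈ Da F α β, eval p N = 0) (hNR : ∀ r ∈ Ra F α β v, eval r N = 0)
    (hG : G.IsHomogeneous (d - 1)) (hGD : ∀ p ∈ Da F α β, eval p G = 0) :
    ∃ b : S3, (b.IsHomogeneous (d - 1) ∧ ∀ p ∈ Da F α β, eval p b = 0) ∧
      F ∣ N * G - b * dv v F := by
  have hd := K.hd
  have h1 : N * G ∈ KK F α β v := by
    apply K.L1
    · intro p hp
      rw [pow_two]
      exact Ideal.mul_mem_mul (mem_mx.2 (hND p hp)) (mem_mx.2 (hGD p hp))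
    · intro r hr
      rw [map_mul, hNR r hr, zero_mul]
  obtain ⟨a, b, hab, ha, hb, _, _⟩ := homog_coeffs K.hF K.g_homog (hN.mul hG)
    (K.R2 (hN.mul hG) h1)
  rw [Nat.add_sub_cancel] at hb
  refine ⟨b, ⟨hb, ?_⟩, ⟨a, by rw [hab]; ring⟩⟩
  intro p hp
  have e := congrArg (fun z => eval p (dv v z)) hab
  simp only [eval_dv, map_add, Derivation.leibniz, smul_eq_mul, map_mul, hND p hp, hGD p hp,
    hp.2, K.F_Da hp, g_Da hp] at e
  have h2 := K.h2 p (ne_zero_of_ell hp.1) (K.F_Da hp) (g_Da hp)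
  rw [eval_dv] at h2
  have : eval p b * (v 0 * eval p (pderiv 0 (dv v F)) + v 1 * eval p (pderiv 1 (dv v F))
      + v 2 * eval p (pderiv 2 (dv v F))) = 0 := by linear_combination - e
  exact (mul_eq_zero.1 this).resolve_right h2

/-- Homogeneous forms of degree `k` vanishing on the affine set. -/
def VD (F : S3) (α β : ℂ) (k : ℕ) : Submodule ℂ S3 where
  carrier := {G | G.IsHomogeneous k ∧ ∀ p ∈ Da F α β, eval p G = 0}
  add_mem' := by
    rintro a b ⟨ha, ha'⟩ ⟨hb, hb'⟩
    exact ⟨ha.add hb, fun p hp => by rw [map_add, ha' p hp, hb' p hp, add_zero]⟩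
  zero_mem' := ⟨isHomogeneous_zero _ _ _, fun p _ => map_zero _⟩
  smul_mem' := by
    rintro c a ⟨ha, ha'⟩
    exact ⟨(homogeneousSubmodule (Fin 3) ℂ k).smul_mem c ha,
      fun p hp => by rw [smul_eval, ha' p hp, mul_zero]⟩

lemma VD_le (k : ℕ) : VD F α β k ≤ homogeneousSubmodule (Fin 3) ℂ k := fun _ h => h.1

instance VD_finite (k : ℕ) : Module.Finite ℂ (VD F α β k) :=
  Submodule.finiteDimensional_of_le (VD_le k)

lemma Cfg.FN (K : Cfg d F α β v) {N : S3} (hN : N.IsHomogeneous (d - 1))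
    (hND : ∀ p ∈ Da F α β, eval p N = 0) (hNR : ∀ r ∈ Ra F α β v, eval r N = 0) :
    ∃ c : ℂ, N = C c * dv v F := by
  have hd := K.hd
  have hg : ¬ F ∣ dv v F := fun h => K.g0 (K.not_dvd (by omega) K.g_homog h)
  choose! f hf1 hf2 using fun (G : S3) (hG : G ∈ VD F α β (d - 1)) =>
    K.FN_step hN hND hNR hG.1 hG.2
  have uniq : ∀ b b' : S3, b.IsHomogeneous (d - 1) → b'.IsHomogeneous (d - 1) →
      F ∣ (b - b') * dv v F → b = b' := by
    intro b b' hb hb' h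
    have := (K.irr.prime.dvd_or_dvd h).resolve_right hg
    exact sub_eq_zero.1 (K.not_dvd (by omega) (hb.sub hb') this)
  let L : VD F α β (d - 1) →ₗ[ℂ] VD F α β (d - 1) :=
    { toFun := fun G => ⟨f G, hf1 G G.2⟩
      map_add' := by
        rintro ⟨a, ha⟩ ⟨b, hb⟩
        apply Subtype.ext
        show f (a + b) = f a + f b
        apply uniq _ _ (hf1 _ (add_mem ha hb)).1 ((hf1 a ha).1.add (hf1 b hb).1)
        have := dvd_sub (dvd_add (hf2 a ha) (hf2 b hb)) (hf2 _ (add_mem ha hb))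
        convert this using 1
        ring
      map_smul' := by
        rintro c ⟨a, ha⟩
        apply Subtype.ext
        show f (c • a) = c • f a
        apply uniq _ _ (hf1 _ (Submodule.smul_mem _ c ha)).1
          (Submodule.smul_mem (VD F α β (d - 1)) c (hf1 a ha)).1
        have := dvd_sub ((hf2 a ha).mul_left (C c)) (hf2 _ (Submodule.smul_mem _ c ha))
        convert this using 1
        rw [smul_eq_C_mul, smul_eq_C_mul]
        ring }
  have : Nontrivial (VD F α β (d - 1)) :=
    ⟨⟨⟨dv v F, K.g_homog, fun p hp => g_Da hp⟩, 0, fun h => K.g0 (congrArg Subtype.val h)⟩⟩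
  obtain ⟨c, hc⟩ := Module.End.exists_eigenvalue L
  obtain ⟨⟨G, hG⟩, hGc⟩ := hc.exists_hasEigenvector
  have hG0 : G ≠ 0 := fun h => hGc.2 (Subtype.ext h)
  have h1 : f G = c • G := congrArg Subtype.val hGc.apply_eq_smul
  have h2 := hf2 G hG
  rw [h1, smul_eq_C_mul] at h2
  have h3 : F ∣ (N - C c * dv v F) * G := by convert h2 using 1; ring
  have h4 : F ∣ N - C c * dv v F := (K.irr.prime.dvd_or_dvd h3).resolve_right
    (fun h => hG0 (K.not_dvd (by omega) hG.1 h))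
  refine ⟨c, sub_eq_zero.1 (K.not_dvd (m := d - 1) (by omega) (hN.sub ?_) h4)⟩
  have := (isHomogeneous_C (Fin 3) c).mul K.g_homog
  rwa [zero_add] at this

lemma Cfg.VD_inj (K : Cfg d F α β v) {A : S3} (hA : A ∈ VD F α β (d - 3))
    (hR : ∀ r ∈ Ra F α β v, eval r A = 0) : A = 0 := by
  have hd := K.hd
  have key : ∀ i : Fin 3, ∃ c : ℂ, X i ^ 2 * A = C c * dv v F := by
    intro i
    apply K.FN
    · have := ((isHomogeneous_X ℂ i).pow 2).mul hA.1
      have e : 1 * 2 + (d - 3) = d - 1 := by omega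
      rwa [e] at this
    · intro p hp
      rw [map_mul, hA.2 p hp, mul_zero]
    · intro p hp
      rw [map_mul, hR p hp, mul_zero]
  obtain ⟨a, ha⟩ := key 0
  obtain ⟨b, hb⟩ := key 1
  by_contra hA0
  have h1 : (C b * X 0 ^ 2 - C a * X 1 ^ 2 : S3) = 0 := by
    apply mul_right_cancel₀ hA0
    linear_combination C b * ha - C a * hb
  have h2 := congrArg (eval ![1, 0, 0]) h1
  have h3 := congrArg (eval ![0, 1, 0]) h1
  simp at h2 h3
  rw [h3, C_0, zero_mul] at ha
  rcases mul_eq_zero.1 ha with h | h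
  · exact pow_ne_zero 2 (X_ne_zero (R := ℂ) (0 : Fin 3)) h
  · exact hA0 h

end D6
section D7
variable {d : ℕ} {F : S3} {α β : ℂ} {v : Fin 3 → ℂ}

/-- The determinant of `a, X, v`. -/
def dN (v : Fin 3 → ℂ) (a : Fin 3 → S3) : S3 :=
  a 0 * (X 1 * C (v 2) - X 2 * C (v 1)) + a 1 * (X 2 * C (v 0) - X 0 * C (v 2))
    + a 2 * (X 0 * C (v 1) - X 1 * C (v 0))

/-- The Jacobian combination. -/
def jc (F : S3) (a : Fin 3 → S3) : S3 := a 0 * pderiv 0 F + a 1 * pderiv 1 F + a 2 * pderiv 2 F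

lemma dN_homog {a : Fin 3 → S3} {k : ℕ} (ha : ∀ i, (a i).IsHomogeneous k) :
    (dN v a).IsHomogeneous (k + 1) := by
  have h : ∀ (i : Fin 3) (c : ℂ), (X i * C c : S3).IsHomogeneous 1 := by
    intro i c
    have := (isHomogeneous_X ℂ i).mul (isHomogeneous_C (Fin 3) c)
    rwa [add_zero] at this
  exact (((ha 0).mul ((h _ _).sub (h _ _))).add ((ha 1).mul ((h _ _).sub (h _ _)))).add
    ((ha 2).mul ((h _ _).sub (h _ _)))

lemma la_ra2 {f γ r v : Fin 3 → ℂ} (hr : r ≠ 0) (hf : ¬ ∀ i, f i = 0)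
    (fr : r 0 * f 0 + r 1 * f 1 + r 2 * f 2 = 0) (fv : v 0 * f 0 + v 1 * f 1 + v 2 * f 2 = 0)
    (gr : r 0 * γ 0 + r 1 * γ 1 + r 2 * γ 2 = 0) (gv : v 0 * γ 0 + v 1 * γ 1 + v 2 * γ 2 ≠ 0) :
    ∃ t : ℂ, t ≠ 0 ∧ f 0 = t * (r 1 * v 2 - r 2 * v 1) ∧ f 1 = t * (r 2 * v 0 - r 0 * v 2) ∧
      f 2 = t * (r 0 * v 1 - r 1 * v 0) := by
  have hm : (![r 1 * v 2 - r 2 * v 1, r 2 * v 0 - r 0 * v 2, r 0 * v 1 - r 1 * v 0] : Fin 3 → ℂ)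
      ≠ 0 := by
    intro h
    have e0 := congrFun h 0
    have e1 := congrFun h 1
    have e2 := congrFun h 2
    simp at e0 e1 e2
    apply hr
    have k0 : (v 0 * γ 0 + v 1 * γ 1 + v 2 * γ 2) * r 0 = 0 := by
      linear_combination v 0 * gr + γ 2 * (-e1) + γ 1 * e2
    have k1 : (v 0 * γ 0 + v 1 * γ 1 + v 2 * γ 2) * r 1 = 0 := by
      linear_combination v 1 * gr + γ 2 * e0 - γ 0 * e2
    have k2 : (v 0 * γ 0 + v 1 * γ 1 + v 2 * γ 2) * r 2 = 0 := by
      linear_combination v 2 * gr - γ 1 * e0 + γ 0 * e1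
    funext i
    fin_cases i
    · exact (mul_eq_zero.1 k0).resolve_left gv
    · exact (mul_eq_zero.1 k1).resolve_left gv
    · exact (mul_eq_zero.1 k2).resolve_left gv
  obtain ⟨t, ht⟩ := par_of_cross (a := f) hm
    (by simp; linear_combination r 0 * fv - v 0 * fr)
    (by simp; linear_combination r 1 * fv - v 1 * fr)
    (by simp; linear_combination r 2 * fv - v 2 * fr)
  refine ⟨t, ?_, ht 0, ht 1, ht 2⟩
  rintro rfl
  exact hf (fun i => by rw [ht i, zero_mul])

lemma Cfg.dN_Ra (K : Cfg d F α β v) {r : Fin 3 → ℂ} (hr : r ∈ Ra F α β v) :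
    ∃ t : ℂ, t ≠ 0 ∧ ∀ a : Fin 3 → S3, eval r (jc F a) = t * eval r (dN v a) := by
  obtain ⟨hl, hF, hg, hs⟩ := hr
  obtain ⟨t, ht, t0, t1, t2⟩ := la_ra2 (f := fun i => eval r (pderiv i F))
    (γ := fun i => eval r (pderiv i (dv v F))) (r := r) (v := v) (ne_zero_of_ell hl) hs
    (by have := euler_eval K.hF r; rw [hF, mul_zero] at this; exact this)
    (by rw [← hg, eval_dv])
    (by have := euler_eval K.g_homog r; rw [hg, mul_zero] at this; exact this)
    (by
      have := K.h2 r (ne_zero_of_ell hl) hF hg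
      rwa [eval_dv] at this)
  refine ⟨t, ht, fun a => ?_⟩
  simp only [jc, dN, map_add, map_mul, map_sub, eval_X, eval_C, t0, t1, t2]
  ring

lemma Cfg.dN_Da (K : Cfg d F α β v) {p : Fin 3 → ℂ} (hp : p ∈ Da F α β) {a : Fin 3 → S3}
    (h : ∀ i, eval p (pderiv i (jc F a)) = 0) : eval p (dN v a) = 0 := by
  obtain ⟨c, hc⟩ := K.ker p (ne_zero_of_ell hp.1) hp.2 (fun i => eval p (a i)) (by
    intro i
    rw [← h i]
    simp only [jc, map_add, Derivation.leibniz, smul_eq_mul, map_mul, hp.2, Fin.sum_univ_three]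
    ring)
  have c0 := congrFun hc 0
  have c1 := congrFun hc 1
  have c2 := congrFun hc 2
  simp only [Pi.smul_apply, smul_eq_mul] at c0 c1 c2
  simp only [dN, map_add, map_mul, map_sub, eval_X, eval_C, c0, c1, c2]
  ring

lemma Cfg.syz (K : Cfg d F α β v) {a : Fin 3 → S3} (ha : ∀ i, (a i).IsHomogeneous (d - 2))
    (h : jc F a = 0) : ∀ i, a i = 0 := by
  have hd := K.hd
  have hN : (dN v a).IsHomogeneous (d - 1) := by
    have := dN_homog (v := v) ha
    have e : d - 2 + 1 = d - 1 := by omega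
    rwa [e] at this
  obtain ⟨c, hc⟩ := K.FN hN (fun p hp => K.dN_Da hp (by simp [h])) (by
    intro r hr
    obtain ⟨t, ht, e⟩ := K.dN_Ra hr
    have := e a
    rw [h, map_zero] at this
    exact (mul_eq_zero.1 this.symm).resolve_left ht)
  have hg : ¬ F ∣ dv v F := fun h => K.g0 (K.not_dvd (by omega) K.g_homog h)
  have E := euler0 K.hF
  have hX : ∀ i j : Fin 3, (a i * X j).IsHomogeneous (d - 1) := by
    intro i j
    have := (ha i).mul (isHomogeneous_X ℂ j)
    have e : d - 2 + 1 = d - 1 := by omega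
    rwa [e] at this
  have hcf : ∀ i, (C c * pderiv i F).IsHomogeneous (d - 1) := by
    intro i
    have := (isHomogeneous_C (Fin 3) c).mul (homog_pd K.hF i)
    rwa [zero_add] at this
  have fin : ∀ P i, (P : S3).IsHomogeneous (d - 1) → F ∣ dv v F * (P - C c * pderiv i F) →
      P = C c * pderiv i F := by
    intro P i hP hd'
    have := (K.irr.prime.dvd_or_dvd hd').resolve_left hg
    exact sub_eq_zero.1 (K.not_dvd (by omega) (hP.sub (hcf i)) this)
  unfold dN at hc
  unfold jc at h
  have P0 : a 1 * X 2 - a 2 * X 1 = C c * pderiv 0 F := by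
    refine fin _ 0 ((hX _ _).sub (hX _ _))
      ⟨-(d : S3) * (C (v 1) * a 2 - C (v 2) * a 1), ?_⟩
    unfold dv at hc ⊢
    linear_combination (C (v 1) * X 2 - C (v 2) * X 1) * h
      - (C (v 1) * a 2 - C (v 2) * a 1) * E + pderiv 0 F * hc
  have P1 : a 2 * X 0 - a 0 * X 2 = C c * pderiv 1 F := by
    refine fin _ 1 ((hX _ _).sub (hX _ _))
      ⟨-(d : S3) * (C (v 2) * a 0 - C (v 0) * a 2), ?_⟩
    unfold dv at hc ⊢
    linear_combination (C (v 2) * X 0 - C (v 0) * X 2) * h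
      - (C (v 2) * a 0 - C (v 0) * a 2) * E + pderiv 1 F * hc
  have P2 : a 0 * X 1 - a 1 * X 0 = C c * pderiv 2 F := by
    refine fin _ 2 ((hX _ _).sub (hX _ _))
      ⟨-(d : S3) * (C (v 0) * a 1 - C (v 1) * a 0), ?_⟩
    unfold dv at hc ⊢
    linear_combination (C (v 0) * X 1 - C (v 1) * X 0) * h
      - (C (v 0) * a 1 - C (v 1) * a 0) * E + pderiv 2 F * hc
  have hdF : (d : S3) * F ≠ 0 := by
    refine mul_ne_zero ?_ K.irr.ne_zero
    exact_mod_cast (by omega : d ≠ 0)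
  have hc0 : (C c : S3) = 0 := by
    have : C c * ((d : S3) * F) = 0 := by
      rw [← E]
      linear_combination - X 0 * P0 - X 1 * P1 - X 2 * P2
    exact (mul_eq_zero.1 this).resolve_right hdF
  rw [hc0, zero_mul] at P0 P1 P2
  have key : ∀ i, a i * ((d : S3) * F) = 0 := by
    intro i
    rw [← E]
    fin_cases i
    · show a 0 * _ = 0
      linear_combination pderiv 1 F * P2 - pderiv 2 F * P1 + X 0 * h
    · show a 1 * _ = 0
      linear_combination pderiv 2 F * P0 - pderiv 0 F * P2 + X 1 * h
    · show a 2 * _ = 0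
      linear_combination pderiv 0 F * P1 - pderiv 1 F * P0 + X 2 * h
  intro i
  exact (mul_eq_zero.1 (key i)).resolve_right hdF

end D7
section D8
variable {d : ℕ} {F : S3} {α β : ℂ} {v : Fin 3 → ℂ} {τ : S3 →ₗ[ℂ] ℂ}

lemma Cfg.exists_T (K : Cfg d F α β v) : ∃ T : Finset (Fin 3 → ℂ), (∀ r ∈ T, r ∈ Ra F α β v) ∧
    (∀ A ∈ VD F α β (d - 3), (∀ r ∈ T, eval r A = 0) → A = 0) ∧
    ∀ r ∈ T, ∃ B ∈ VD F α β (d - 3), eval r B = 1 ∧ ∀ r' ∈ T, r' ≠ r → eval r' B = 0 := by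
  classical
  have hfin : (Ra F α β v).Finite := K.Za_finite.subset Ra_sub
  obtain ⟨T, hle, hT⟩ := exists_minimal_le_of_wellFoundedLT
    (fun T : Finset (Fin 3 → ℂ) => ∀ A ∈ VD F α β (d - 3), (∀ r ∈ T, eval r A = 0) → A = 0)
    hfin.toFinset (fun A hA h => K.VD_inj hA (fun r hr => h r (by simpa using hr)))
  refine ⟨T, fun r hr => by simpa using hle hr, hT.prop, ?_⟩
  intro r hr
  have h1 := hT.not_prop_of_lt (Finset.erase_ssubset hr)
  push Not at h1
  obtain ⟨B, hB, hB1, hB0⟩ := h1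
  have hBr : eval r B ≠ 0 := by
    intro h
    apply hB0
    apply hT.prop B hB
    intro r' hr'
    by_cases e : r' = r
    · rw [e, h]
    · exact hB1 r' (Finset.mem_erase.2 ⟨e, hr'⟩)
  refine ⟨(eval r B)⁻¹ • B, Submodule.smul_mem _ _ hB, ?_, ?_⟩
  · rw [smul_eval, inv_mul_cancel₀ hBr]
  · intro r' hr' e
    rw [smul_eval, hB1 r' (Finset.mem_erase.2 ⟨e, hr'⟩), mul_zero]

lemma Cfg.eps_mul (K : Cfg d F α β v) {r : Fin 3 → ℂ} {e : S3}
    (h1 : eval r e = 1) (h2 : ∀ z ∈ Za F α β v, z ≠ r → e ∈ mx z ^ 2) (hr : r ∈ Ra F α β v)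
    (x : S3) : x * e - C (eval r x) * e ∈ KK F α β v := by
  apply K.L1
  · intro p hp
    have := h2 p (K.Da_sub hp) (Da_Ra_ne hp hr)
    exact sub_mem (Ideal.mul_mem_left _ _ this) (Ideal.mul_mem_left _ _ this)
  · intro r' hr'
    by_cases h : r' = r
    · subst h
      simp [h1]
    · have := mx2_eval (h2 r' (Ra_sub hr') h)
      simp [this]

lemma Cfg.eps_ne (K : Cfg d F α β v) (ht : IsTau d F α β v τ) {r : Fin 3 → ℂ} {e : S3}
    (h1 : eval r e = 1) (h2 : ∀ z ∈ Za F α β v, z ≠ r → e ∈ mx z ^ 2) (hr : r ∈ Ra F α β v) :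
    τ e ≠ 0 := by
  intro h
  have : e ∈ KK F α β v := by
    apply K.nondeg ht
    intro z
    have := ht.congr (K.eps_mul h1 h2 hr z)
    rw [mul_comm, this, ← smul_eq_C_mul, map_smul, h, smul_zero]
  have := KK_eval this (Ra_sub hr)
  rw [h1] at this
  exact one_ne_zero this

lemma Cfg.low_sep (K : Cfg d F α β v) {T : Finset (Fin 3 → ℂ)}
    (hTR : ∀ r ∈ T, r ∈ Ra F α β v)
    (hT : ∀ A ∈ VD F α β (d - 3), (∀ r ∈ T, eval r A = 0) → A = 0) {r : Fin 3 → ℂ} (hr : r ∈ T)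
    {E : S3} (hE : E ∈ VD F α β (d - 4)) (hE0 : ∀ r' ∈ T, r' ≠ r → eval r' E = 0) :
    eval r E = 0 := by
  have hd := K.hd
  by_contra hne
  have hEne : E ≠ 0 := by rintro rfl; simp at hne
  have key : ∀ i j, (C (r i) * X j - C (r j) * X i : S3) = 0 := by
    intro i j
    have h0 : ∀ (a : ℂ) (k : Fin 3), (C a * X k : S3).IsHomogeneous 1 := by
      intro a k
      have := (isHomogeneous_C (Fin 3) a).mul (isHomogeneous_X ℂ k)
      rwa [zero_add] at this
    have h1 : (C (r i) * X j - C (r j) * X i) * E ∈ VD F α β (d - 3) := by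
      refine ⟨?_, fun p hp => by rw [map_mul, hE.2 p hp, mul_zero]⟩
      have := ((h0 (r i) j).sub (h0 (r j) i)).mul hE.1
      have e : 1 + (d - 4) = d - 3 := by omega
      rwa [e] at this
    have h2 := hT _ h1 (by
      intro r' hr'
      by_cases e : r' = r
      · rw [e]; simp; left; ring
      · rw [map_mul, hE0 r' hr' e, mul_zero])
    exact (mul_eq_zero.1 h2).resolve_right hEne
  apply ne_zero_of_ell (hTR r hr).1
  funext i
  obtain ⟨j, hj⟩ : ∃ j : Fin 3, j ≠ i := ⟨i + 1, by fin_cases i <;> decide⟩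
  have := congrArg (eval (Pi.single j 1)) (key i j)
  simpa [hj, hj.symm] using this

lemma Cfg.exists_s (K : Cfg d F α β v) {T : Finset (Fin 3 → ℂ)}
    (hTR : ∀ r ∈ T, r ∈ Ra F α β v)
    (hT : ∀ A ∈ VD F α β (d - 3), (∀ r ∈ T, eval r A = 0) → A = 0)
    (w : (Fin 3 → ℂ) → ℂ) (hw : ∀ r ∈ T, w r ≠ 0) :
    ∃ s : T → ℂ, (∀ r, s r ≠ 0) ∧
      ∀ E ∈ VD F α β (d - 4), ∑ r : T, s r * (w r * eval r.1 E) = 0 := by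
  classical
  let Φ : VD F α β (d - 4) →ₗ[ℂ] (T → ℂ) :=
    { toFun := fun E r => w r * eval r.1 E.1
      map_add' := by intro a b; funext r; simp [mul_add]
      map_smul' := by intro c a; funext r; simp; ring }
  let U : Submodule ℂ (T → ℂ) :=
    { carrier := {s | ∀ E ∈ VD F α β (d - 4), ∑ r : T, s r * (w r * eval r.1 E) = 0}
      add_mem' := by
        intro a b ha hb E hE
        simp only [Pi.add_apply, add_mul, Finset.sum_add_distrib, ha E hE, hb E hE, add_zero]
      zero_mem' := by intro E hE; simp
      smul_mem' := by
        intro c a ha E hE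
        simp only [Pi.smul_apply, smul_eq_mul, mul_assoc, ← Finset.mul_sum, ha E hE, mul_zero] }
  have h1 : ∀ r : T, ∃ s ∈ U, s r ≠ 0 := by
    intro r
    have hnot : (Pi.single r 1 : T → ℂ) ∉ LinearMap.range Φ := by
      rintro ⟨E, hE⟩
      have e1 := congrFun hE r
      have e2 : ∀ r' : T, r' ≠ r → w r' * eval r'.1 E.1 = 0 := by
        intro r' hne
        have := congrFun hE r'
        simpa [Φ, hne] using this
      have e3 : eval r.1 E.1 = 0 := by
        apply K.low_sep hTR hT r.2 E.2
        intro r' hr' hne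
        exact (mul_eq_zero.1 (e2 ⟨r', hr'⟩ (fun h => hne (congrArg Subtype.val h)))).resolve_left
          (hw r' hr')
      have e4 : w r * eval r.1 E.1 = 1 := by simpa [Φ] using e1
      rw [e3, mul_zero] at e4
      exact zero_ne_one e4
    obtain ⟨φ, hφ, hle⟩ := Submodule.exists_le_ker_of_notMem hnot
    refine ⟨fun r' => φ (Pi.single r' 1), ?_, hφ⟩
    intro E hE
    have h2 : φ (Φ ⟨E, hE⟩) = 0 := hle ⟨_, rfl⟩
    rw [← h2, LinearMap.pi_apply_eq_sum_univ φ]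
    apply Finset.sum_congr rfl
    intro r' _
    have : (fun j => if r' = j then (1 : ℂ) else 0) = Pi.single r' 1 := by
      funext j; simp [Pi.single_apply, eq_comm]
    rw [smul_eq_mul, mul_comm]
    congr 1
    rw [this]
  obtain ⟨s, hs, h2⟩ := Module.Dual.exists_forall_mem_ne_zero_of_forall_exists U
    (fun r : T => (LinearMap.proj r : (T → ℂ) →ₗ[ℂ] ℂ)) h1
  exact ⟨s, h2, hs⟩

end D8
section D9
variable {d : ℕ} {F : S3} {α β : ℂ} {v : Fin 3 → ℂ} {τ : S3 →ₗ[ℂ] ℂ}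

/-- Polynomials vanishing on all of `Za`, as a complex subspace. -/
def bb (F : S3) (α β : ℂ) (v : Fin 3 → ℂ) : Submodule ℂ S3 where
  carrier := {b | ∀ q ∈ Za F α β v, eval q b = 0}
  add_mem' := by
    intro a b ha hb q hq
    rw [map_add, ha q hq, hb q hq, add_zero]
  zero_mem' := fun q _ => map_zero _
  smul_mem' := by
    intro c a ha q hq
    rw [smul_eval, ha q hq, mul_zero]

lemma Cfg.vanish_of_bb (K : Cfg d F α β v) {E : S3}
    (h : ∀ b ∈ bb F α β v, E * b ∈ KK F α β v) {p : Fin 3 → ℂ} (hp : p ∈ Da F α β) :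
    eval p E = 0 := by
  obtain ⟨e, h1, h2⟩ := K.interp p
  obtain ⟨k, hk⟩ := K.mdir_ne hp
  have hb : uu p k * e ∈ bb F α β v := by
    intro q hq
    by_cases hqp : q = p
    · subst hqp
      rw [map_mul, mem_mx.1 (uu_mem q k), zero_mul]
    · rw [map_mul, mx2_eval (h2 q hq hqp), mul_zero]
  have h3 := KK_deriv (h _ hb) hp (K.F_Da hp)
  have h4 : ∀ i, eval p (pderiv i (E * (uu p k * e))) = if i = k then eval p E else 0 := by
    intro i
    have : eval p (uu p k) = 0 := mem_mx.1 (uu_mem p k)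
    have h5 : eval p (pderiv i (uu p k)) = if i = k then 1 else 0 := by
      simp only [uu, map_sub, pderiv_C, pderiv_X, sub_zero]
      by_cases hik : i = k
      · subst hik; simp
      · simp [hik, Pi.single_apply]
    simp only [Derivation.leibniz, smul_eq_mul, map_add, map_mul, this, h1, h5]
    simp
  simp only [h4] at h3
  fin_cases k <;> simp at h3 hk <;> exact h3.resolve_left hk

lemma Cfg.exists_sigma (K : Cfg d F α β v) (ht : IsTau d F α β v τ) {T : Finset (Fin 3 → ℂ)}
    (hTR : ∀ r ∈ T, r ∈ Ra F α β v) (ε : (Fin 3 → ℂ) → S3) (h1 : ∀ r, eval r (ε r) = 1)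
    (h2 : ∀ r, ∀ z ∈ Za F α β v, z ≠ r → ε r ∈ mx z ^ 2) (s : T → ℂ)
    (hs : ∀ E ∈ VD F α β (d - 4), ∑ r : T, s r * (τ (ε r) * eval r.1 E) = 0) :
    ∃ σ : S3, σ.IsHomogeneous d ∧ ∀ q ∈ Za F α β v, eval q σ = eval q (∑ r : T, s r • ε r) := by
  have hd := K.hd
  by_cases hmem : (∑ r : T, s r • ε r) ∈ homogeneousSubmodule (Fin 3) ℂ d ⊔ bb F α β v
  · obtain ⟨σ, hσ, b, hb, hsum⟩ := Submodule.mem_sup.1 hmem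
    refine ⟨σ, hσ, fun q hq => ?_⟩
    rw [← hsum, map_add, hb q hq, add_zero]
  · exfalso
    obtain ⟨φ, hφ, hle⟩ := Submodule.exists_le_ker_of_notMem hmem
    have hφb : ∀ b ∈ bb F α β v, φ b = 0 := fun b hb => hle (Submodule.mem_sup_right hb)
    have hφd : ∀ b : S3, b.IsHomogeneous d → φ b = 0 := fun b hb => hle (Submodule.mem_sup_left hb)
    obtain ⟨y, hy⟩ := K.rep_functional ht φ (fun x hx => hφb x (fun q hq => KK_eval hx hq))
    obtain ⟨E, hE, hyE⟩ := K.dual_iter ht (x := y) (j := d) (fun z hz => by rw [← hy, hφd z hz])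
      (d + 1) le_rfl (by omega)
    have e1 : 2 * d - 3 - (d + 1) = d - 4 := by omega
    rw [e1] at hE
    have hyE' : ∀ x, φ x = τ (E * x) := by
      intro x
      rw [hy]
      apply ht.congr
      rw [← sub_mul]
      exact Ideal.mul_mem_right _ _ hyE
    have hED : E ∈ VD F α β (d - 4) := by
      refine ⟨hE, fun p hp => K.vanish_of_bb ?_ hp⟩
      intro b hb
      apply K.nondeg ht
      intro z
      rw [mul_assoc, ← hyE']
      apply hφb
      intro q hq
      rw [map_mul, hb q hq, zero_mul]
    apply hφ
    rw [← hs E hED, map_sum]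
    apply Finset.sum_congr rfl
    intro r _
    rw [map_smul, hyE', smul_eq_mul, ht.congr (K.eps_mul (h1 r.1) (h2 r.1) (hTR r.1 r.2) E),
      ← smul_eq_C_mul, map_smul, smul_eq_mul]
    ring

lemma Cfg.main (K : Cfg d F α β v) : ∃ σ : S3, σ.IsHomogeneous d ∧
    (∀ p ∈ Da F α β, eval p σ = 0) ∧
    ∀ A ∈ VD F α β (d - 3), ∀ a : Fin 3 → S3, (∀ i, (a i).IsHomogeneous (d - 2)) →
      σ * A = jc F a → A = 0 := by
  classical
  have hd := K.hd
  obtain ⟨τ, ht⟩ := K.exists_tau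
  replace ht : IsTau d F α β v τ := ht
  obtain ⟨T, hTR, hT, hTB⟩ := K.exists_T
  choose ε h1 h2 using K.interp
  have hw : ∀ r ∈ T, τ (ε r) ≠ 0 := fun r hr => K.eps_ne ht (h1 r) (h2 r) (hTR r hr)
  obtain ⟨s, hs0, hs⟩ := K.exists_s hTR hT (fun r => τ (ε r)) hw
  obtain ⟨σ, hσ, hσe⟩ := K.exists_sigma ht hTR ε h1 h2 s hs
  have hout : ∀ q ∈ Za F α β v, q ∉ T → eval q σ = 0 := by
    intro q hq hqT
    rw [hσe q hq, map_sum]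
    apply Finset.sum_eq_zero
    intro r _
    rw [smul_eval, mx2_eval (h2 r.1 q hq (fun h => hqT (h ▸ r.2))), mul_zero]
  have hin : ∀ r : T, eval r.1 σ = s r := by
    intro r
    rw [hσe r.1 (Ra_sub (hTR r.1 r.2)), map_sum, Finset.sum_eq_single r]
    · rw [smul_eval, h1, mul_one]
    · intro r' _ hne
      rw [smul_eval, mx2_eval (h2 r'.1 r.1 (Ra_sub (hTR r.1 r.2))
        (fun h => hne (Subtype.ext h.symm))), mul_zero]
    · intro h; exact absurd (Finset.mem_univ _) h
  have hDT : ∀ p ∈ Da F α β, p ∉ T := fun p hp hpT => Da_Ra_ne hp (hTR p hpT) rfl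
  have hσD : ∀ p ∈ Da F α β, eval p σ = 0 := fun p hp => hout p (K.Da_sub hp) (hDT p hp)
  refine ⟨σ, hσ, hσD, ?_⟩
  intro A hA a ha hja
  have hN : (dN v a).IsHomogeneous (d - 1) := by
    have := dN_homog (v := v) ha
    have e : d - 2 + 1 = d - 1 := by omega
    rwa [e] at this
  have hND : ∀ p ∈ Da F α β, eval p (dN v a) = 0 := by
    intro p hp
    apply K.dN_Da hp
    intro i
    rw [← hja, Derivation.leibniz]
    simp [hσD p hp, hA.2 p hp]
  have hNR : ∀ r ∈ Ra F α β v, r ∉ T → eval r (dN v a) = 0 := by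
    intro r hr hrT
    obtain ⟨t, ht0, htt⟩ := K.dN_Ra hr
    have := htt a
    rw [← hja, map_mul, hout r (Ra_sub hr) hrT, zero_mul] at this
    exact (mul_eq_zero.1 this.symm).resolve_left ht0
  apply hT A hA
  intro r hr
  have hNr : eval r (dN v a) = 0 := by
    obtain ⟨B, hB, hB1, hB0⟩ := hTB r hr
    have h3 : dN v a * B - C (eval r (dN v a)) * ε r ∈ KK F α β v := by
      apply K.L1
      · intro p hp
        refine sub_mem ?_ (Ideal.mul_mem_left _ _ (h2 r p (K.Da_sub hp)
          (Da_Ra_ne hp (hTR r hr))))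
        rw [pow_two]
        exact Ideal.mul_mem_mul (mem_mx.2 (hND p hp)) (mem_mx.2 (hB.2 p hp))
      · intro q hq
        by_cases hqr : q = r
        · subst hqr
          simp [hB1, h1]
        · rw [map_sub, map_mul, map_mul, mx2_eval (h2 r q (Ra_sub hq) hqr), mul_zero, sub_zero]
          by_cases hqT : q ∈ T
          · rw [hB0 q hqT hqr, mul_zero]
          · rw [hNR q hq hqT, zero_mul]
    have h4 := ht.congr h3
    rw [ht.low (k := d - 1 + (d - 3)) (by omega) (hN.mul hB.1), ← smul_eq_C_mul, map_smul,
      smul_eq_mul] at h4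
    exact (mul_eq_zero.1 h4.symm).resolve_right (hw r hr)
  obtain ⟨t, ht0, htt⟩ := K.dN_Ra (hTR r hr)
  have := htt a
  rw [hNr, mul_zero, ← hja, map_mul, hin ⟨r, hr⟩] at this
  exact (mul_eq_zero.1 this).resolve_left (hs0 _)

end D9
section D10
variable {d : ℕ} {F : S3} {α β : ℂ} {v : Fin 3 → ℂ}

/-- Evaluation of forms of degree `k` at the points of `Da`. -/
def evk (F : S3) (α β : ℂ) (k : ℕ) :
    homogeneousSubmodule (Fin 3) ℂ k →ₗ[ℂ] (Da F α β → ℂ) where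
  toFun := fun x p => eval p.1 x.1
  map_add' := by intro a b; funext p; simp
  map_smul' := by intro c a; funext p; simp

lemma finrank_ker_evk (k : ℕ) :
    Module.finrank ℂ (LinearMap.ker (evk F α β k)) = Module.finrank ℂ (VD F α β k) := by
  have h : LinearMap.ker (evk F α β k) = (VD F α β k).comap
      (homogeneousSubmodule (Fin 3) ℂ k).subtype := by
    ext x
    rw [LinearMap.mem_ker, Submodule.mem_comap]
    constructor
    · intro h
      exact ⟨x.2, fun p hp => congrFun h ⟨p, hp⟩⟩
    · intro h
      funext p
      exact h.2 p.1 p.2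
  rw [h]
  exact (Submodule.comapSubtypeEquivOfLe (VD_le k)).finrank_eq

lemma Cfg.finrank_low (K : Cfg d F α β v) (k : ℕ) :
    (k + 2).choose 2 ≤ Module.finrank ℂ (VD F α β k) + (Da F α β).ncard := by
  have hfin : (Da F α β).Finite := K.Za_finite.subset K.Da_sub
  have := hfin.fintype
  have h1 := (evk F α β k).finrank_range_add_finrank_ker
  have h2 := Submodule.finrank_le (LinearMap.range (evk F α β k))
  rw [Module.finrank_fintype_fun_eq_card, ← Nat.card_eq_fintype_card, Nat.card_coe_set_eq] at h2
  rw [finrank_ker_evk, finrank_homog] at h1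
  have e : (3 + k - 1).choose k = (k + 2).choose 2 := by
    have : 3 + k - 1 = k + 2 := by omega
    rw [this, ← Nat.choose_symm_add]
  omega

lemma Cfg.finrank_top (K : Cfg d F α β v) :
    (2 * d - 1).choose 2 = Module.finrank ℂ (VD F α β (2 * d - 3)) + (Da F α β).ncard := by
  have hd := K.hd
  have hfin : (Da F α β).Finite := K.Za_finite.subset K.Da_sub
  have := hfin.fintype
  classical
  have hsurj : LinearMap.range (evk F α β (2 * d - 3)) = ⊤ := by
    rw [LinearMap.range_eq_top]
    intro c
    choose ε h1 h2 using K.interp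
    obtain ⟨y, hy, hxy⟩ := K.red (∑ p : Da F α β, c p • ε p)
    refine ⟨⟨y, hy⟩, ?_⟩
    funext p
    have h3 := KK_eval hxy (K.Da_sub p.2)
    rw [map_sub, sub_eq_zero, map_sum, Finset.sum_eq_single p] at h3
    · rw [smul_eval, h1, mul_one] at h3
      exact h3.symm
    · intro p' _ hne
      rw [smul_eval, mx2_eval (h2 p'.1 p.1 (K.Da_sub p.2)
        (fun h => hne (Subtype.ext h.symm))), mul_zero]
    · intro h; exact absurd (Finset.mem_univ _) h
  have h1 := (evk F α β (2 * d - 3)).finrank_range_add_finrank_ker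
  rw [hsurj, _root_.finrank_top, Module.finrank_fintype_fun_eq_card, ← Nat.card_eq_fintype_card,
    Nat.card_coe_set_eq, finrank_ker_evk, finrank_homog] at h1
  have e : (3 + (2 * d - 3) - 1).choose (2 * d - 3) = (2 * d - 1).choose 2 := by
    have h2 : 3 + (2 * d - 3) - 1 = 2 * d - 3 + 2 := by omega
    have h3 : 2 * d - 1 = 2 * d - 3 + 2 := by omega
    rw [h2, h3, ← Nat.choose_symm_add]
  omega

/-- The Jacobian combination as a linear map. -/
def jcl (F : S3) (k : ℕ) : (Fin 3 → homogeneousSubmodule (Fin 3) ℂ k) →ₗ[ℂ] S3 where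
  toFun := fun a => jc F (fun i => (a i).1)
  map_add' := by intro a b; simp [jc]; ring
  map_smul' := by intro c a; simp [jc, smul_add]

lemma range_jcl (k : ℕ) : LinearMap.range (jcl F k) = jacSub F k := by
  ext x
  constructor
  · rintro ⟨a, rfl⟩
    exact ⟨_, _, _, (a 0).2, (a 1).2, (a 2).2, rfl⟩
  · rintro ⟨a, b, c, ha, hb, hc, rfl⟩
    exact ⟨![⟨a, ha⟩, ⟨b, hb⟩, ⟨c, hc⟩], rfl⟩

lemma Cfg.finrank_jac (K : Cfg d F α β v) :
    Module.finrank ℂ (jacSub F (d - 2)) = 3 * d.choose 2 := by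
  have hd := K.hd
  rw [← range_jcl, LinearMap.finrank_range_of_inj]
  · rw [Module.finrank_pi_fintype]
    simp only [finrank_homog]
    have e : (3 + (d - 2) - 1).choose (d - 2) = d.choose 2 := by
      have h2 : 3 + (d - 2) - 1 = d := by omega
      rw [h2, Nat.choose_symm (by omega)]
    simp only [e]
    simp
  · rw [← LinearMap.ker_eq_bot, LinearMap.ker_eq_bot']
    intro a ha
    funext i
    exact Subtype.ext (K.syz (a := fun i => (a i).1) (fun i => (a i).2) ha i)

lemma choose_id (hd : 4 ≤ d) : (2 * d - 1).choose 2 = 3 * d.choose 2 + (d - 1).choose 2 := by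
  obtain ⟨m, rfl⟩ : ∃ m, d = m + 1 := ⟨d - 1, by omega⟩
  have e : 2 * (m + 1) - 1 = 2 * m + 1 := by omega
  rw [e, Nat.add_sub_cancel]
  have h : ∀ n : ℕ, (((n.choose 2 : ℕ)) : ℚ) = n * (n - 1) / 2 := Nat.cast_choose_two ℚ
  have : (((2 * m + 1).choose 2 : ℕ) : ℚ) = ((3 * (m + 1).choose 2 + m.choose 2 : ℕ) : ℚ) := by
    push_cast
    rw [h, h, h]
    push_cast
    ring
  exact_mod_cast this

lemma Cfg.final (K : Cfg d F α β v) : ∃ σ : S3, σ.IsHomogeneous d ∧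
    (∀ p ∈ Da F α β, eval p σ = 0) ∧
    jacSub F (d - 2) ⊔ (VD F α β (d - 3)).map (LinearMap.mulLeft ℂ σ) = VD F α β (2 * d - 3) ∧
    Disjoint (jacSub F (d - 2)) ((VD F α β (d - 3)).map (LinearMap.mulLeft ℂ σ)) ∧
    Module.finrank ℂ (VD F α β (2 * d - 3)) =
      3 * d.choose 2 + (d - 1).choose 2 - (Da F α β).ncard := by
  have hd := K.hd
  obtain ⟨σ, hσ, hσD, hmain⟩ := K.main
  have hid := choose_id hd
  have htop := K.finrank_top
  have hdisj : Disjoint (jacSub F (d - 2)) ((VD F α β (d - 3)).map (LinearMap.mulLeft ℂ σ)) := by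
    rw [Submodule.disjoint_def]
    rintro x ⟨a, b, c, ha, hb, hc, rfl⟩ ⟨A, hA, hAx⟩
    have hA0 := hmain A hA ![a, b, c] (by intro i; fin_cases i <;> assumption) hAx
    rw [← hAx, hA0, map_zero]
  refine ⟨σ, hσ, hσD, ?_, hdisj, by omega⟩
  have hle : jacSub F (d - 2) ⊔ (VD F α β (d - 3)).map (LinearMap.mulLeft ℂ σ)
      ≤ VD F α β (2 * d - 3) := by
    apply sup_le
    · rintro x ⟨a, b, c, ha, hb, hc, rfl⟩
      refine ⟨?_, fun p hp => by simp [hp.2]⟩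
      have e : d - 2 + (d - 1) = 2 * d - 3 := by omega
      rw [← e]
      exact ((ha.mul (homog_pd K.hF 0)).add (hb.mul (homog_pd K.hF 1))).add
        (hc.mul (homog_pd K.hF 2))
    · rintro x ⟨A, hA, rfl⟩
      have e : d + (d - 3) = 2 * d - 3 := by omega
      refine ⟨?_, fun p hp => by simp [hσD p hp]⟩
      rw [← e]
      exact hσ.mul hA.1
  apply Submodule.eq_of_le_of_finrank_le hle
  have : Module.Finite ℂ (jacSub F (d - 2)) :=
    Submodule.finiteDimensional_of_le (le_sup_left.trans hle)
  have h1 := Submodule.finrank_sup_add_finrank_inf_eq (jacSub F (d - 2))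
    ((VD F α β (d - 3)).map (LinearMap.mulLeft ℂ σ))
  rw [hdisj.eq_bot, finrank_bot, K.finrank_jac] at h1
  have h2 : Module.finrank ℂ ((VD F α β (d - 3)).map (LinearMap.mulLeft ℂ σ))
      = Module.finrank ℂ (VD F α β (d - 3)) := by
    have h3 : Function.Injective ((LinearMap.mulLeft ℂ σ).domRestrict (VD F α β (d - 3))) := by
      rw [← LinearMap.ker_eq_bot, LinearMap.ker_eq_bot']
      intro A hA
      apply Subtype.ext
      apply hmain A.1 A.2 (fun _ => 0) (fun _ => isHomogeneous_zero _ _ _)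
      have : σ * A.1 = 0 := hA
      rw [this]
      simp [jc]
    rw [← LinearMap.range_domRestrict, LinearMap.finrank_range_of_inj h3]
  have h4 := K.finrank_low (d - 3)
  have e : d - 3 + 2 = d - 1 := by omega
  rw [e] at h4
  have h5 : 3 * d.choose 2 + Module.finrank ℂ (VD F α β (d - 3)) = Module.finrank ℂ
      ↥(jacSub F (d - 2) ⊔ (VD F α β (d - 3)).map (LinearMap.mulLeft ℂ σ)) := by
    rw [← h2]; exact h1.symm
  have h6 : Module.finrank ℂ (VD F α β (2 * d - 3)) ≤ Module.finrank ℂ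
      ↥(jacSub F (d - 2) ⊔ (VD F α β (d - 3)).map (LinearMap.mulLeft ℂ σ)) := by
    omega
  exact h6

end D10
section EE
variable {d : ℕ} {F : S3} {α β : ℂ} {v : Fin 3 → ℂ}

lemma ker_of_nodal (hd : 4 ≤ d) (hF : F.IsHomogeneous d) (hnodal : Nodal F) :
    ∀ x : Fin 3 → ℂ, x ≠ 0 → (∀ i, eval x (pderiv i F) = 0) → ∀ w : Fin 3 → ℂ,
      (∀ i, ∑ j, eval x (pderiv i (pderiv j F)) * w j = 0) → ∃ c : ℂ, w = c • x := by
  intro x hx hs w hw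
  obtain ⟨p, c, hc, rfl⟩ := exists_rep hx
  have hp : SingPt F p := fun i => (homog_zero_smul (homog_pd hF i) hc _).1 (hs i)
  have hrank := (hnodal p hp).2
  set H : Matrix (Fin 3) (Fin 3) ℂ :=
    Matrix.of fun i j : Fin 3 => eval p.rep (pderiv i (pderiv j F)) with hH
  have hwH : H.mulVecLin w = 0 := by
    funext i
    have h1 := hw i
    have h2 : ∀ j, eval (c • p.rep) (pderiv i (pderiv j F)) =
        c ^ (d - 1 - 1) * eval p.rep (pderiv i (pderiv j F)) := fun j =>
      eval_smul_homog (homog_pd (homog_pd hF j) i) c _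
    simp only [h2, mul_assoc, ← Finset.mul_sum] at h1
    have h3 := (mul_eq_zero.1 h1).resolve_left (pow_ne_zero _ hc)
    simpa [H, Matrix.mulVec, dotProduct] using h3
  have hpH : H.mulVecLin p.rep = 0 := by
    funext i
    have h1 := euler_eval (homog_pd hF i) p.rep
    rw [hp i, mul_zero] at h1
    have h2 : ∀ j, pderiv i (pderiv j F) = pderiv j (pderiv i F) := fun j => pd_comm i j F
    simp only [H, Matrix.mulVecLin_apply, Matrix.mulVec, dotProduct, Matrix.of_apply, h2,
      Fin.sum_univ_three, Pi.zero_apply]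
    linear_combination h1
  have hk : Module.finrank ℂ (LinearMap.ker H.mulVecLin) = 1 := by
    have := H.mulVecLin.finrank_range_add_finrank_ker
    have h3 : Module.finrank ℂ (LinearMap.range H.mulVecLin) = 2 := hrank
    rw [h3] at this
    simp at this
    omega
  have hne : (⟨p.rep, hpH⟩ : LinearMap.ker H.mulVecLin) ≠ 0 := by
    intro h
    exact p.rep_nonzero (congrArg Subtype.val h)
  obtain ⟨t, ht⟩ := (finrank_eq_one_iff_of_nonzero' _ hne).1 hk ⟨w, hwH⟩
  refine ⟨t * c⁻¹, ?_⟩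
  have ht' : t • p.rep = w := congrArg Subtype.val ht
  rw [smul_smul, mul_assoc, inv_mul_cancel₀ hc, mul_one, ht']

lemma nodes_eq (hnodal : Nodal F) : nodes F = {p : P2 | SingPt F p} := by
  ext p
  exact ⟨fun h => h.1, fun h => hnodal p h⟩

/-- The normalised representative. -/
def nrm (α β : ℂ) (p : P2) : Fin 3 → ℂ := (eval p.rep (ell α β))⁻¹ • p.rep

lemma Cfg.Da_eq (K : Cfg d F α β v) (hnodal : Nodal F) :
    Da F α β = nrm α β '' nodes F := by
  rw [nodes_eq hnodal]
  ext x
  constructor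
  · rintro ⟨h1, h2⟩
    obtain ⟨p, c, hc, rfl⟩ := exists_rep (ne_zero_of_ell h1)
    refine ⟨p, fun i => (homog_zero_smul (homog_pd K.hF i) hc _).1 (h2 i), ?_⟩
    rw [eval_smul_homog (ell_homog α β), pow_one] at h1
    rw [nrm, inv_eq_of_mul_eq_one_left h1]
  · rintro ⟨p, hp, rfl⟩
    have h := K.h0 p.rep p.rep_nonzero hp
    refine ⟨?_, fun i => (homog_zero_smul (homog_pd K.hF i) (inv_ne_zero h) _).2 (hp i)⟩
    rw [nrm, eval_smul_homog (ell_homog α β), pow_one, inv_mul_cancel₀ h]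

lemma Cfg.nrm_inj (K : Cfg d F α β v) (hnodal : Nodal F) : Set.InjOn (nrm α β) (nodes F) := by
  intro p hp q hq h
  rw [nodes_eq hnodal] at hp hq
  have h1 := K.h0 p.rep p.rep_nonzero hp
  have h2 := K.h0 q.rep q.rep_nonzero hq
  rw [← p.mk_rep, ← q.mk_rep, Projectivization.mk_eq_mk_iff']
  refine ⟨eval p.rep (ell α β) * (eval q.rep (ell α β))⁻¹, ?_⟩
  have h3 : (eval p.rep (ell α β))⁻¹ • p.rep = (eval q.rep (ell α β))⁻¹ • q.rep := h
  rw [mul_smul, ← h3, smul_smul, mul_inv_cancel₀ h1, one_smul]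

lemma Cfg.van_iff (K : Cfg d F α β v) (hnodal : Nodal F) {k : ℕ} {G : S3}
    (hG : G.IsHomogeneous k) :
    (∀ p ∈ nodes F, VanAt G p) ↔ ∀ p ∈ Da F α β, eval p G = 0 := by
  rw [K.Da_eq hnodal, Set.forall_mem_image]
  refine forall₂_congr fun p hp => ?_
  exact (homog_zero_smul hG (inv_ne_zero (K.h0 p.rep p.rep_nonzero hp.1)) _).symm

lemma Cfg.Vsp_eq (K : Cfg d F α β v) (hnodal : Nodal F) (k : ℕ) :
    Vsp k (nodes F) = VD F α β k := by
  ext G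
  constructor
  · rintro ⟨h1, h2⟩
    exact ⟨h1, (K.van_iff hnodal h1).1 h2⟩
  · rintro ⟨h1, h2⟩
    exact ⟨h1, (K.van_iff hnodal h1).2 h2⟩

end EE

theorem stmt_11 (d : ℕ) (hd : 4 ≤ d) (F : MvPolynomial (Fin 3) ℂ)
    (hF : F.IsHomogeneous d) (hirr : Irreducible F) (hnodal : Nodal F)
    (hfin : (nodes F).Finite)
    (hn : (nodes F).ncard ≤ (d - 1).choose 2 - 1) :
    ∃ σ : MvPolynomial (Fin 3) ℂ, σ.IsHomogeneous d ∧
      (∀ p ∈ nodes F, VanAt σ p) ∧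
      jacSub F (d - 2) ⊔
        (Vsp (d - 3) (nodes F)).map (LinearMap.mulLeft ℂ σ) =
        Vsp (2 * d - 3) (nodes F) ∧
      Disjoint (jacSub F (d - 2))
        ((Vsp (d - 3) (nodes F)).map (LinearMap.mulLeft ℂ σ)) ∧
      Module.finrank ℂ (Vsp (2 * d - 3) (nodes F)) =
        3 * d.choose 2 + (d - 1).choose 2 - (nodes F).ncard := by
  have hker := ker_of_nodal hd hF hnodal
  obtain ⟨α, β, v, h0, h1, h2⟩ := exists_choice (by omega) hF hirr
    (by rw [← nodes_eq hnodal]; exact hfin) hker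
  have K : Cfg d F α β v := ⟨hd, hF, hirr, hker, h0, h1, h2⟩
  obtain ⟨σ, hσ, hσD, hsum, hdis, hdim⟩ := K.final
  have hcard : (Da F α β).ncard = (nodes F).ncard := by
    rw [K.Da_eq hnodal, Set.ncard_image_of_injOn (K.nrm_inj hnodal)]
  rw [K.Vsp_eq hnodal, K.Vsp_eq hnodal, ← hcard]
  exact ⟨σ, hσ, (K.van_iff hnodal hσ).2 hσD, hsum, hdis, hdim⟩

end
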